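/- There exists a nonzero polynomial function P on the 35-dimensional space of cubic forms in five variables over ℂ such that, for every cubic form F with P(F) ≠ 0, F defines a smooth cubic threefold V = V(F) ⊂ ℙ⁴ and the set of lines l on V for which there exist 2-planes π₁, π₂ and lines r₁, r₂ on V satisfying V·π₁ = l + 2r₁ and V·π₂ = 2l + r₂ is finite of cardinality exactly 720. (Equivalently: a general smooth cubic threefold contains exactly 720 lines that admit a residual double line and are simultaneously lines of the second type; these are the intersection points of the curves Γ and Γ′ in F(V).) -/

import Mathlib

open MvPolynomial

noncomputable section

/-- `F` defines a smooth cubic threefold: the only common zero of the five partial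
derivatives of `F` is the origin. -/
def IsSmoothCubic (F : MvPolynomial (Fin 5) ℂ) : Prop :=
  ∀ p : Fin 5 → ℂ, (∀ i : Fin 5, eval p (pderiv i F) = 0) → p = 0

/-- A line of `ℙ⁴`: a 2-dimensional linear subspace of `ℂ⁵`. -/
def IsLine (W : Submodule ℂ (Fin 5 → ℂ)) : Prop := Module.finrank ℂ W = 2

/-- A 2-plane of `ℙ⁴`: a 3-dimensional linear subspace of `ℂ⁵`. -/
def IsPlane (W : Submodule ℂ (Fin 5 → ℂ)) : Prop := Module.finrank ℂ W = 3

/-- The linear subspace `W` lies on the hypersurface defined by `F`. -/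
def LiesOn (F : MvPolynomial (Fin 5) ℂ) (W : Submodule ℂ (Fin 5 → ℂ)) : Prop :=
  ∀ p ∈ W, eval p F = 0

/-- The intersection cycle `V(F)·Pl` equals `l + 2r`: the restriction of `F` to the
2-plane `Pl` factors as `c·ℓ·ρ²` where `ℓ`, `ρ` are linear forms, nonzero on `Pl`,
whose kernels cut `l` and `r` respectively out of `Pl`. -/
def CycleLplus2R (F : MvPolynomial (Fin 5) ℂ) (l r Pl : Submodule ℂ (Fin 5 → ℂ)) : Prop :=
  IsLine l ∧ IsLine r ∧ IsPlane Pl ∧ l ≤ Pl ∧ r ≤ Pl ∧ r ≠ l ∧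
  ∃ (c : ℂ) (L R : (Fin 5 → ℂ) →ₗ[ℂ] ℂ), c ≠ 0 ∧
    (∃ p ∈ Pl, L p ≠ 0) ∧ (∃ p ∈ Pl, R p ≠ 0) ∧
    Pl ⊓ LinearMap.ker L = l ∧ Pl ⊓ LinearMap.ker R = r ∧
    ∀ p ∈ Pl, eval p F = c * L p * (R p) ^ 2


/-- The intersection cycle `V(F)·Pl` equals `2l + r`: the restriction of `F` to the
2-plane `Pl` factors as `c·ℓ²·ρ`. -/
def Cycle2LplusR (F : MvPolynomial (Fin 5) ℂ) (l r Pl : Submodule ℂ (Fin 5 → ℂ)) : Prop :=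
  IsLine l ∧ IsLine r ∧ IsPlane Pl ∧ l ≤ Pl ∧ r ≤ Pl ∧ r ≠ l ∧
  ∃ (c : ℂ) (L R : (Fin 5 → ℂ) →ₗ[ℂ] ℂ), c ≠ 0 ∧
    (∃ p ∈ Pl, L p ≠ 0) ∧ (∃ p ∈ Pl, R p ≠ 0) ∧
    Pl ⊓ LinearMap.ker L = l ∧ Pl ⊓ LinearMap.ker R = r ∧
    ∀ p ∈ Pl, eval p F = c * (L p) ^ 2 * R p

/-- The index type of the 35 monomials of degree 3 in five variables, so that
`MvPolynomial Deg3Monomials ℂ` is the ring of polynomial functions (in the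
coefficients) on the 35-dimensional space of cubic forms in five variables. -/
def Deg3Monomials : Type := {d : Fin 5 →₀ ℕ // (d.sum fun _ n => n) = 3}


namespace CT

/-- the ambient five dimensional space -/
abbrev E5 := Fin 5 → ℂ

/-- symmetric 3-tensors in five variables -/
abbrev Cub := Sym (Fin 5) 3 → ℂ

def mk3 (i j k : Fin 5) : Sym (Fin 5) 3 := i ::ₛ j ::ₛ k ::ₛ Sym.nil

theorem mk3_swap12 (i j k : Fin 5) : mk3 i j k = mk3 j i k := by
  unfold mk3; exact Sym.cons_swap _ _ _

theorem mk3_swap23 (i j k : Fin 5) : mk3 i j k = mk3 i k j := by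
  unfold mk3; rw [Sym.cons_swap j k]

theorem mk3_surj (d : Sym (Fin 5) 3) : ∃ p : Fin 5 × Fin 5 × Fin 5, mk3 p.1 p.2.1 p.2.2 = d := by
  obtain ⟨i, d1, rfl⟩ := Sym.exists_eq_cons_of_succ d
  obtain ⟨j, d2, rfl⟩ := Sym.exists_eq_cons_of_succ d1
  obtain ⟨k, d3, rfl⟩ := Sym.exists_eq_cons_of_succ d2
  refine ⟨(i, j, k), ?_⟩
  unfold mk3
  congr 3
  exact Subsingleton.elim _ _

/-- the symmetric trilinear form attached to a tensor -/
def tri (a : Cub) (x y z : E5) : ℂ := ∑ i, ∑ j, ∑ k, a (mk3 i j k) * x i * y j * z k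

theorem tri_add1 (a : Cub) (x x' y z : E5) : tri a (x + x') y z = tri a x y z + tri a x' y z := by
  simp only [tri, ← Finset.sum_add_distrib, Pi.add_apply]
  refine Finset.sum_congr rfl fun i _ => Finset.sum_congr rfl fun j _ => Finset.sum_congr rfl fun k _ => by ring

theorem tri_smul1 (a : Cub) (c : ℂ) (x y z : E5) : tri a (c • x) y z = c * tri a x y z := by
  simp only [tri, Finset.mul_sum, Pi.smul_apply, smul_eq_mul]
  refine Finset.sum_congr rfl fun i _ => Finset.sum_congr rfl fun j _ => Finset.sum_congr rfl fun k _ => by ring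

theorem tri_comm12 (a : Cub) (x y z : E5) : tri a x y z = tri a y x z := by
  simp only [tri]
  rw [Finset.sum_comm]
  refine Finset.sum_congr rfl fun i _ => Finset.sum_congr rfl fun j _ => Finset.sum_congr rfl fun k _ => by
    rw [mk3_swap12]; ring

theorem tri_comm23 (a : Cub) (x y z : E5) : tri a x y z = tri a x z y := by
  simp only [tri]
  refine Finset.sum_congr rfl fun i _ => ?_
  rw [Finset.sum_comm]
  refine Finset.sum_congr rfl fun j _ => Finset.sum_congr rfl fun k _ => by
    rw [mk3_swap23]; ring

theorem tri_comm13 (a : Cub) (x y z : E5) : tri a x y z = tri a z y x := by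
  rw [tri_comm12, tri_comm23, tri_comm12]

theorem tri_add2 (a : Cub) (x y y' z : E5) : tri a x (y + y') z = tri a x y z + tri a x y' z := by
  rw [tri_comm12, tri_add1, tri_comm12 a y, tri_comm12 a y']

theorem tri_add3 (a : Cub) (x y z z' : E5) : tri a x y (z + z') = tri a x y z + tri a x y z' := by
  rw [tri_comm23, tri_add2, tri_comm23 a x z, tri_comm23 a x z']

theorem tri_smul2 (a : Cub) (c : ℂ) (x y z : E5) : tri a x (c • y) z = c * tri a x y z := by
  rw [tri_comm12, tri_smul1, tri_comm12]

theorem tri_smul3 (a : Cub) (c : ℂ) (x y z : E5) : tri a x y (c • z) = c * tri a x y z := by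
  rw [tri_comm23, tri_smul2, tri_comm23]

theorem tri_neg1 (a : Cub) (x y z : E5) : tri a (-x) y z = - tri a x y z := by
  have := tri_smul1 a (-1) x y z; simpa using this
theorem tri_neg2 (a : Cub) (x y z : E5) : tri a x (-y) z = - tri a x y z := by
  have := tri_smul2 a (-1) x y z; simpa using this
theorem tri_neg3 (a : Cub) (x y z : E5) : tri a x y (-z) = - tri a x y z := by
  have := tri_smul3 a (-1) x y z; simpa using this
theorem tri_sub1 (a : Cub) (x x' y z : E5) : tri a (x - x') y z = tri a x y z - tri a x' y z := by
  rw [sub_eq_add_neg, tri_add1, tri_neg1, sub_eq_add_neg]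
theorem tri_sub2 (a : Cub) (x y y' z : E5) : tri a x (y - y') z = tri a x y z - tri a x y' z := by
  rw [sub_eq_add_neg, tri_add2, tri_neg2, sub_eq_add_neg]
theorem tri_sub3 (a : Cub) (x y z z' : E5) : tri a x y (z - z') = tri a x y z - tri a x y z' := by
  rw [sub_eq_add_neg, tri_add3, tri_neg3, sub_eq_add_neg]
theorem tri_zero1 (a : Cub) (y z : E5) : tri a 0 y z = 0 := by
  have := tri_smul1 a 0 0 y z; simpa using this
theorem tri_zero2 (a : Cub) (x z : E5) : tri a x 0 z = 0 := by
  have := tri_smul2 a 0 x 0 z; simpa using this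
theorem tri_zero3 (a : Cub) (x y : E5) : tri a x y 0 = 0 := by
  have := tri_smul3 a 0 x y 0; simpa using this

theorem tri_cub_add (a b : Cub) (x y z : E5) : tri (a + b) x y z = tri a x y z + tri b x y z := by
  simp only [tri, ← Finset.sum_add_distrib, Pi.add_apply]
  refine Finset.sum_congr rfl fun i _ => Finset.sum_congr rfl fun j _ => Finset.sum_congr rfl fun k _ => by ring

theorem tri_cub_smul (c : ℂ) (a : Cub) (x y z : E5) : tri (c • a) x y z = c * tri a x y z := by
  simp only [tri, Finset.mul_sum, Pi.smul_apply, smul_eq_mul]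
  refine Finset.sum_congr rfl fun i _ => Finset.sum_congr rfl fun j _ => Finset.sum_congr rfl fun k _ => by ring

/-- standard basis vector -/
def bv (i : Fin 5) : E5 := Pi.single i 1

theorem vec_eq_sum (x : E5) : x = ∑ i, x i • bv i := by
  ext j; simp [bv, Finset.sum_apply, Pi.single_apply]

/-- the linear form `tri a x y ·` -/
def triL (a : Cub) (x y : E5) : E5 →ₗ[ℂ] ℂ where
  toFun z := tri a x y z
  map_add' := tri_add3 a x y
  map_smul' c z := by simp [tri_smul3]

@[simp] theorem triL_apply (a : Cub) (x y z : E5) : triL a x y z = tri a x y z := rfl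

theorem tri_bv (a : Cub) (i j k : Fin 5) : tri a (bv i) (bv j) (bv k) = a (mk3 i j k) := by
  simp only [tri, bv, Pi.single_apply]
  simp

theorem tri_sum1 {ι : Type*} (s : Finset ι) (a : Cub) (f : ι → E5) (y z : E5) :
    tri a (∑ i ∈ s, f i) y z = ∑ i ∈ s, tri a (f i) y z := by
  classical
  induction s using Finset.induction_on with
  | empty => simp [tri_zero1]
  | insert i s hi ih => rw [Finset.sum_insert hi, Finset.sum_insert hi, tri_add1, ih]

theorem tri_sum2 {ι : Type*} (s : Finset ι) (a : Cub) (f : ι → E5) (x z : E5) :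
    tri a x (∑ i ∈ s, f i) z = ∑ i ∈ s, tri a x (f i) z := by
  rw [tri_comm12, tri_sum1]; exact Finset.sum_congr rfl fun i _ => tri_comm12 _ _ _ _

theorem tri_sum3 {ι : Type*} (s : Finset ι) (a : Cub) (f : ι → E5) (x y : E5) :
    tri a x y (∑ i ∈ s, f i) = ∑ i ∈ s, tri a x y (f i) := by
  rw [tri_comm23, tri_sum2]; exact Finset.sum_congr rfl fun i _ => tri_comm23 _ _ _ _

/-- a tensor is determined by its trilinear form -/
theorem tri_ext {a b : Cub} (h : ∀ x y z, tri a x y z = tri b x y z) : a = b := by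
  ext d
  obtain ⟨⟨i, j, k⟩, rfl⟩ := mk3_surj d
  rw [← tri_bv a, ← tri_bv b, h]

/-- a chosen representative of each multi-index -/
def rep (d : Sym (Fin 5) 3) : Fin 5 × Fin 5 × Fin 5 := (mk3_surj d).choose
theorem rep_spec (d : Sym (Fin 5) 3) : mk3 (rep d).1 (rep d).2.1 (rep d).2.2 = d := (mk3_surj d).choose_spec

/-- change of frame -/
def pull (n : Fin 5 → E5) (a : Cub) : Cub := fun d => tri a (n (rep d).1) (n (rep d).2.1) (n (rep d).2.2)

/-- a function symmetric in three arguments only depends on the class -/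
theorem sym3_eq {α : Type*} (f : Fin 5 → Fin 5 → Fin 5 → α) (h12 : ∀ i j k, f i j k = f j i k)
    (h23 : ∀ i j k, f i j k = f i k j) {i j k i' j' k' : Fin 5} (h : mk3 i j k = mk3 i' j' k') :
    f i j k = f i' j' k' := by
  have hp : [i, j, k].Perm [i', j', k'] := by
    have := congrArg Subtype.val h
    simp only [mk3, Sym.coe_cons, Sym.val_eq_coe] at this
    exact Multiset.coe_eq_coe.mp this
  have key : ∀ l l' : List (Fin 5), l.Perm l' → ∀ i j k i' j' k', l = [i, j, k] → l' = [i', j', k'] →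
      f i j k = f i' j' k' := by
    intro l l' hl i j k i' j' k' e e'
    subst e; subst e'
    rw [List.perm_iff_count] at hl
    have h1 := hl i'; have h2 := hl j'; have h3 := hl k'
    have h4 := hl i; have h5 := hl j; have h6 := hl k
    simp only [List.count_cons, List.count_nil, beq_iff_eq] at h1 h2 h3 h4 h5 h6
    clear hl
    grind
  exact key _ _ hp _ _ _ _ _ _ rfl rfl

theorem pull_mk3 (n : Fin 5 → E5) (a : Cub) (i j k : Fin 5) :
    pull n a (mk3 i j k) = tri a (n i) (n j) (n k) := by
  refine sym3_eq (fun i j k => tri a (n i) (n j) (n k)) (fun i j k => tri_comm12 _ _ _ _)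
    (fun i j k => tri_comm23 _ _ _ _) (rep_spec _)

theorem tri_pull (n : Fin 5 → E5) (a : Cub) (x y z : E5) :
    tri (pull n a) x y z = tri a (∑ i, x i • n i) (∑ i, y i • n i) (∑ i, z i • n i) := by
  rw [tri_sum1, tri]
  refine Finset.sum_congr rfl fun i _ => ?_
  rw [tri_sum2]
  refine Finset.sum_congr rfl fun j _ => ?_
  rw [tri_sum3]
  refine Finset.sum_congr rfl fun k _ => ?_
  rw [pull_mk3, tri_smul1, tri_smul2, tri_smul3]
  ring

end CT

namespace CT

open Topology PrimeSpectrum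

section Chevalley

variable {ι κ : Type} [Finite ι] [Finite κ]

/-- A predicate on `ℂ^ι` which is constructible. -/
def IsC {ι : Type} (Q : (ι → ℂ) → Prop) : Prop :=
  ∃ t : Set (PrimeSpectrum (MvPolynomial ι ℂ)), IsConstructible t ∧
    ∀ x, Q x ↔ (pointToPoint (k := ℂ) x : PrimeSpectrum (MvPolynomial ι ℂ)) ∈ t

/-- polynomial functions -/
def IsPoly {ι : Type} (f : (ι → ℂ) → ℂ) : Prop := ∃ p : MvPolynomial ι ℂ, ∀ x, f x = eval x p

theorem IsC.not {Q : (ι → ℂ) → Prop} (h : IsC Q) : IsC fun x => ¬ Q x := by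
  obtain ⟨t, ht, h⟩ := h
  exact ⟨tᶜ, ht.compl, fun x => by simp [h x]⟩

theorem IsC.and {Q R : (ι → ℂ) → Prop} (h : IsC Q) (h' : IsC R) : IsC fun x => Q x ∧ R x := by
  obtain ⟨t, ht, h⟩ := h
  obtain ⟨t', ht', h'⟩ := h'
  exact ⟨t ∩ t', ht.inter ht', fun x => by simp [h x, h' x]⟩

theorem IsC.or {Q R : (ι → ℂ) → Prop} (h : IsC Q) (h' : IsC R) : IsC fun x => Q x ∨ R x := by
  obtain ⟨t, ht, h⟩ := h
  obtain ⟨t', ht', h'⟩ := h'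
  exact ⟨t ∪ t', ht.union ht', fun x => by simp [h x, h' x]⟩

theorem IsC.imp {Q R : (ι → ℂ) → Prop} (h : IsC Q) (h' : IsC R) : IsC fun x => Q x → R x := by
  have := h.not.or h'
  simpa only [imp_iff_not_or] using this

theorem IsC.all_fin {α : Type*} [Finite α] {Q : α → (ι → ℂ) → Prop} (h : ∀ a, IsC (Q a)) :
    IsC fun x => ∀ a, Q a x := by
  choose t ht h using h
  exact ⟨⋂ a, t a, IsConstructible.iInter ht, fun x => by simp [h]⟩

theorem IsC.ex_fin {α : Type*} [Finite α] {Q : α → (ι → ℂ) → Prop} (h : ∀ a, IsC (Q a)) :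
    IsC fun x => ∃ a, Q a x := by
  have := (IsC.all_fin fun a => (h a).not).not
  simpa using this

theorem IsC.congr {Q R : (ι → ℂ) → Prop} (h : IsC Q) (e : ∀ x, R x ↔ Q x) : IsC R := by
  obtain ⟨t, ht, h⟩ := h
  exact ⟨t, ht, fun x => by rw [e, h]⟩

theorem isConstructible_of_isClosed_spec {t : Set (PrimeSpectrum (MvPolynomial ι ℂ))} (h : IsClosed t) :
    IsConstructible t := by
  have : IsConstructible tᶜ :=
    (TopologicalSpace.NoetherianSpace.isCompact _).isConstructible h.isOpen_compl
  simpa using this.compl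

theorem IsC.eq_zero {f : (ι → ℂ) → ℂ} (hf : IsPoly f) : IsC fun x => f x = 0 := by
  obtain ⟨p, hp⟩ := hf
  refine ⟨zeroLocus {p}, isConstructible_of_isClosed_spec (isClosed_zeroLocus _), fun x => ?_⟩
  change f x = 0 ↔ _
  rw [hp]
  simp only [mem_zeroLocus, Set.singleton_subset_iff, SetLike.mem_coe]
  exact (mem_vanishingIdeal_singleton_iff x p).symm

theorem IsC.eval_comp {Q : (ι → ℂ) → Prop} (h : IsC Q) (φ : (κ → ℂ) → (ι → ℂ))
    (hφ : ∀ i, IsPoly fun y => φ y i) : IsC fun y => Q (φ y) := by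
  obtain ⟨t, ht, h⟩ := h
  choose p hp using hφ
  let f : MvPolynomial ι ℂ →+* MvPolynomial κ ℂ := (aeval p).toRingHom
  refine ⟨comap f ⁻¹' t, ?_, fun y => ?_⟩
  · refine ht.preimage (by fun_prop) ?_
    intro s hs _ u hu huo
    exact TopologicalSpace.NoetherianSpace.isCompact _
  · change Q (φ y) ↔ _
    rw [h, Set.mem_preimage]
    have : (pointToPoint (k := ℂ) (φ y) : PrimeSpectrum (MvPolynomial ι ℂ)) = comap f (pointToPoint y) := by
      ext q
      rw [PrimeSpectrum.comap_asIdeal, Ideal.mem_comap]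
      change q ∈ vanishingIdeal ℂ {φ y} ↔ _ ∈ vanishingIdeal ℂ {y}
      rw [mem_vanishingIdeal_singleton_iff, mem_vanishingIdeal_singleton_iff]
      have e : aeval (φ y) q = aeval y (f q) := by
        change _ = aeval y (aeval p q)
        rw [← AlgHom.comp_apply]
        congr 1
        ext i
        simp [hp, aeval_eq_eval]
      rw [e]
    rw [this]

theorem exists_locallyClosed {t : Set (PrimeSpectrum (MvPolynomial ι ℂ))} (ht : IsConstructible t) :
    ∀ P, ∃ Z, IsLocallyClosed Z ∧ P ∈ Z ∧ (Z ⊆ t ∨ Z ⊆ tᶜ) := by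
  induction ht using IsConstructible.empty_union_induction with
  | open_retrocompact U hU _ =>
    intro P
    by_cases h : P ∈ U
    · exact ⟨U, hU.isLocallyClosed, h, Or.inl subset_rfl⟩
    · exact ⟨Uᶜ, hU.isClosed_compl.isLocallyClosed, h, Or.inr subset_rfl⟩
  | union s hs t ht h1 h2 =>
    intro P
    obtain ⟨Z, hZ, hP, h⟩ := h1 P
    obtain ⟨Z', hZ', hP', h'⟩ := h2 P
    refine ⟨Z ∩ Z', hZ.inter hZ', ⟨hP, hP'⟩, ?_⟩
    rcases h with h | h
    · left; intro x hx; exact Or.inl (h hx.1)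
    rcases h' with h' | h'
    · left; intro x hx; exact Or.inr (h' hx.2)
    · right; intro x hx hx'
      rcases hx' with hx' | hx'
      · exact h hx.1 hx'
      · exact h' hx.2 hx'
  | compl s hs h1 =>
    intro P
    obtain ⟨Z, hZ, hP, h⟩ := h1 P
    refine ⟨Z, hZ, hP, ?_⟩
    rw [compl_compl]; exact h.symm

theorem rename_inl_fp : (rename (Sum.inl : ι → ι ⊕ κ) : MvPolynomial ι ℂ →ₐ[ℂ] _).toRingHom.FinitePresentation := by
  rw [← RingHom.FinitePresentation.of_finiteType]
  have h : ((rename (Sum.inl : ι → ι ⊕ κ) : MvPolynomial ι ℂ →ₐ[ℂ] _).toRingHom.comp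
      (algebraMap ℂ (MvPolynomial ι ℂ))).FiniteType := by
    have : ((rename (Sum.inl : ι → ι ⊕ κ) : MvPolynomial ι ℂ →ₐ[ℂ] _).toRingHom.comp
      (algebraMap ℂ (MvPolynomial ι ℂ))) = algebraMap ℂ (MvPolynomial (ι ⊕ κ) ℂ) := by
      ext x; simp
    rw [this, RingHom.finiteType_algebraMap]
    infer_instance
  exact RingHom.FiniteType.of_comp_finiteType h

theorem IsC.ex {Q : (ι → ℂ) → (κ → ℂ) → Prop}
    (h : IsC fun z : ι ⊕ κ → ℂ => Q (fun i => z (Sum.inl i)) (fun i => z (Sum.inr i))) :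
    IsC fun x => ∃ y, Q x y := by
  obtain ⟨t, ht, h⟩ := h
  let f : MvPolynomial ι ℂ →+* MvPolynomial (ι ⊕ κ) ℂ := (rename Sum.inl).toRingHom
  have hpt : ∀ z : ι ⊕ κ → ℂ, comap f (pointToPoint (k := ℂ) z) = pointToPoint (fun i => z (Sum.inl i)) := by
    intro z
    ext q
    rw [PrimeSpectrum.comap_asIdeal, Ideal.mem_comap]
    change _ ∈ vanishingIdeal ℂ {_} ↔ _ ∈ vanishingIdeal ℂ {_}
    rw [mem_vanishingIdeal_singleton_iff, mem_vanishingIdeal_singleton_iff]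
    change aeval _ (rename Sum.inl q) = 0 ↔ _
    rw [aeval_rename]; rfl
  refine ⟨comap f '' t, isConstructible_comap_image rename_inl_fp ht, fun x => ⟨?_, ?_⟩⟩
  · rintro ⟨y, hy⟩
    refine ⟨pointToPoint (Sum.elim x y), (h (Sum.elim x y)).1 hy, ?_⟩
    rw [hpt]; rfl
  · rintro ⟨P, hP, hPx⟩
    obtain ⟨Z, hZ, hPZ, hZt⟩ := exists_locallyClosed ht P
    have hZt : Z ⊆ t := by
      rcases hZt with h | h
      · exact h
      · exact absurd hP (h hPZ)
    have hcl : IsClosed ({pointToPoint (k := ℂ) x} : Set (PrimeSpectrum (MvPolynomial ι ℂ))) := by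
      rw [isClosed_singleton_iff_isMaximal]
      change (vanishingIdeal ℂ {x}).IsMaximal
      infer_instance
    have hne : (Z ∩ comap f ⁻¹' {pointToPoint (k := ℂ) x}).Nonempty := ⟨P, hPZ, hPx⟩
    have hj : JacobsonSpace (PrimeSpectrum (MvPolynomial (ι ⊕ κ) ℂ)) :=
      isJacobsonRing_iff_jacobsonSpace.1 inferInstance
    obtain ⟨M, ⟨hMZ, hMx⟩, hM⟩ := nonempty_inter_closedPoints hne
      (hZ.inter (hcl.preimage (by fun_prop)).isLocallyClosed)
    rw [mem_closedPoints_iff, isClosed_singleton_iff_isMaximal] at hM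
    obtain ⟨z, hz⟩ := isMaximal_iff_eq_vanishingIdeal_singleton.1 hM
    have hMz : M = pointToPoint (k := ℂ) z := PrimeSpectrum.ext hz
    subst hMz
    have hzt := (h z).2 (hZt hMZ)
    have hx : (fun i => z (Sum.inl i)) = x := by
      rw [Set.mem_preimage, hpt] at hMx
      have h1 := congrArg PrimeSpectrum.asIdeal (Set.mem_singleton_iff.1 hMx)
      change vanishingIdeal ℂ {_} = vanishingIdeal ℂ {_} at h1
      ext i
      have h2 : (X i - C (x i) : MvPolynomial ι ℂ) ∈ vanishingIdeal ℂ {x} := by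
        rw [mem_vanishingIdeal_singleton_iff]; simp
      rw [← h1, mem_vanishingIdeal_singleton_iff] at h2
      simpa [sub_eq_zero] using h2
    change Q (fun i => z (Sum.inl i)) fun i => z (Sum.inr i) at hzt
    rw [hx] at hzt
    exact ⟨_, hzt⟩

theorem IsC.all {Q : (ι → ℂ) → (κ → ℂ) → Prop}
    (h : IsC fun z : ι ⊕ κ → ℂ => Q (fun i => z (Sum.inl i)) (fun i => z (Sum.inr i))) :
    IsC fun x => ∀ y, Q x y := by
  have := (IsC.ex (Q := fun x y => ¬ Q x y) h.not).not
  simpa using this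

/-- A constructible set or its complement lies in a hypersurface. -/
theorem IsC.dichotomy {Q : (ι → ℂ) → Prop} (h : IsC Q) :
    ∃ p : MvPolynomial ι ℂ, p ≠ 0 ∧ ((∀ x, Q x → eval x p = 0) ∨ (∀ x, ¬ Q x → eval x p = 0)) := by
  obtain ⟨t, ht, h⟩ := h
  have key : ∃ p : MvPolynomial ι ℂ, p ≠ 0 ∧ ((∀ x ∈ t, p ∈ x.asIdeal) ∨ (∀ x ∈ tᶜ, p ∈ x.asIdeal)) := by
    clear h
    induction ht using IsConstructible.empty_union_induction with
    | open_retrocompact U hU _ =>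
      obtain ⟨s, hs⟩ := (isClosed_iff_zeroLocus _).1 hU.isClosed_compl
      by_cases h0 : ∃ p ∈ s, p ≠ 0
      · obtain ⟨p, hp, hp0⟩ := h0
        refine ⟨p, hp0, Or.inr fun x hx => ?_⟩
        rw [hs] at hx
        exact hx hp
      · push Not at h0
        refine ⟨1, one_ne_zero, Or.inl fun x hx => ?_⟩
        exfalso
        have : x ∈ Uᶜ := by
          rw [hs]
          intro p hp
          rw [h0 p hp]; exact zero_mem _
        exact this hx
    | union s hs t ht h1 h2 =>
      obtain ⟨p, hp, h1⟩ := h1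
      obtain ⟨q, hq, h2⟩ := h2
      refine ⟨p * q, mul_ne_zero hp hq, ?_⟩
      rcases h1 with h1 | h1
      · rcases h2 with h2 | h2
        · left
          rintro x (hx | hx)
          · exact Ideal.mul_mem_right _ _ (h1 x hx)
          · exact Ideal.mul_mem_left _ _ (h2 x hx)
        · right
          intro x hx
          exact Ideal.mul_mem_left _ _ (h2 x fun h => hx (Or.inr h))
      · right
        intro x hx
        exact Ideal.mul_mem_right _ _ (h1 x fun h => hx (Or.inl h))
    | compl s hs h1 =>
      obtain ⟨p, hp, h1⟩ := h1
      exact ⟨p, hp, by rw [compl_compl]; exact h1.symm⟩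
  obtain ⟨p, hp, hh⟩ := key
  refine ⟨p, hp, ?_⟩
  have aux : ∀ x : ι → ℂ, p ∈ (pointToPoint (k := ℂ) x : PrimeSpectrum (MvPolynomial ι ℂ)).asIdeal → eval x p = 0 := by
    intro x hx
    exact (mem_vanishingIdeal_singleton_iff x p).1 hx
  rcases hh with hh | hh
  · exact Or.inl fun x hx => aux x (hh _ ((h x).1 hx))
  · exact Or.inr fun x hx => aux x (hh _ fun hc => hx ((h x).2 hc))

end Chevalley

section PolyFun
variable {ι : Type}

theorem IsPoly.coord (i : ι) : IsPoly fun x : ι → ℂ => x i := ⟨X i, by simp⟩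
theorem IsPoly.const (c : ℂ) : IsPoly fun _ : ι → ℂ => c := ⟨C c, by simp⟩
theorem IsPoly.add {f g : (ι → ℂ) → ℂ} (hf : IsPoly f) (hg : IsPoly g) : IsPoly fun x => f x + g x := by
  obtain ⟨p, hp⟩ := hf; obtain ⟨q, hq⟩ := hg
  exact ⟨p + q, by simp [hp, hq]⟩
theorem IsPoly.sub {f g : (ι → ℂ) → ℂ} (hf : IsPoly f) (hg : IsPoly g) : IsPoly fun x => f x - g x := by
  obtain ⟨p, hp⟩ := hf; obtain ⟨q, hq⟩ := hg
  exact ⟨p - q, by simp [hp, hq]⟩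
theorem IsPoly.neg {f : (ι → ℂ) → ℂ} (hf : IsPoly f) : IsPoly fun x => - f x := by
  obtain ⟨p, hp⟩ := hf
  exact ⟨-p, by simp [hp]⟩
theorem IsPoly.mul {f g : (ι → ℂ) → ℂ} (hf : IsPoly f) (hg : IsPoly g) : IsPoly fun x => f x * g x := by
  obtain ⟨p, hp⟩ := hf; obtain ⟨q, hq⟩ := hg
  exact ⟨p * q, by simp [hp, hq]⟩
theorem IsPoly.pow {f : (ι → ℂ) → ℂ} (hf : IsPoly f) (n : ℕ) : IsPoly fun x => f x ^ n := by
  obtain ⟨p, hp⟩ := hf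
  exact ⟨p ^ n, by simp [hp]⟩
theorem IsPoly.sum {α : Type*} {s : Finset α} {f : α → (ι → ℂ) → ℂ} (hf : ∀ a, IsPoly (f a)) :
    IsPoly fun x => ∑ a ∈ s, f a x := by
  choose p hp using hf
  exact ⟨∑ a ∈ s, p a, by simp [hp]⟩
theorem IsPoly.prod {α : Type*} {s : Finset α} {f : α → (ι → ℂ) → ℂ} (hf : ∀ a, IsPoly (f a)) :
    IsPoly fun x => ∏ a ∈ s, f a x := by
  choose p hp using hf
  exact ⟨∏ a ∈ s, p a, by simp [hp, eval_prod]⟩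

theorem IsPoly.comp {κ : Type} {f : (ι → ℂ) → ℂ} (hf : IsPoly f) {φ : (κ → ℂ) → ι → ℂ}
    (hφ : ∀ i, IsPoly fun y => φ y i) : IsPoly fun y => f (φ y) := by
  obtain ⟨p, hp⟩ := hf
  choose q hq using hφ
  refine ⟨aeval q p, fun y => ?_⟩
  change f (φ y) = _
  rw [hp]
  have : (eval y).comp (aeval q).toRingHom = (eval (φ y) : MvPolynomial ι ℂ →+* ℂ) := by
    ext i
    · simp
    · simp [hq]
  rw [← this]; rfl

theorem IsPoly.tri {a : (ι → ℂ) → Cub} {x y z : (ι → ℂ) → E5} (ha : ∀ d, IsPoly fun v => a v d)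
    (hx : ∀ i, IsPoly fun v => x v i) (hy : ∀ i, IsPoly fun v => y v i) (hz : ∀ i, IsPoly fun v => z v i) :
    IsPoly fun v => CT.tri (a v) (x v) (y v) (z v) := by
  unfold CT.tri
  exact IsPoly.sum fun i => IsPoly.sum fun j => IsPoly.sum fun k =>
    (((ha _).mul (hx _)).mul (hy _)).mul (hz _)

end PolyFun

end CT

namespace CT

/-! ### frames, volumes -/

/-- determinant of a frame -/
def fdet (n : Fin 5 → E5) : ℂ := Matrix.det (Matrix.of n)

def fr (s t : E5) (K : Fin 3 → E5) : Fin 5 → E5 := ![s, t, K 0, K 1, K 2]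

def vol (s t c p q : E5) : ℂ := fdet ![s, t, c, p, q]

theorem fdet_comb (M : Fin 5 → Fin 5 → ℂ) (n : Fin 5 → E5) :
    fdet (fun i => ∑ j, M i j • n j) = Matrix.det (Matrix.of M) * fdet n := by
  unfold fdet
  rw [← Matrix.det_mul]
  have : (Matrix.of fun i => ∑ j, M i j • n j) = Matrix.of M * Matrix.of n := by
    apply Matrix.ext
    intro i j
    simp [Matrix.mul_apply, Finset.sum_apply]
  rw [this]

theorem fdet_ne_zero_iff (n : Fin 5 → E5) : fdet n ≠ 0 ↔ LinearIndependent ℂ n := by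
  have h1 := Matrix.linearIndependent_rows_iff_isUnit (A := (Matrix.of n : Matrix (Fin 5) (Fin 5) ℂ))
  rw [Matrix.isUnit_iff_isUnit_det, isUnit_iff_ne_zero] at h1
  exact h1.symm

/-- expansion in a frame -/
theorem exists_coord {n : Fin 5 → E5} (h : fdet n ≠ 0) (d : E5) : ∃ z : Fin 5 → ℂ, d = ∑ i, z i • n i := by
  have hli := (fdet_ne_zero_iff n).1 h
  have hs : ⊤ ≤ Submodule.span ℂ (Set.range n) := by
    rw [top_le_iff]
    exact hli.span_eq_top_of_card_eq_finrank (by simp)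
  have := hs (Submodule.mem_top : d ∈ ⊤)
  rw [Submodule.mem_span_range_iff_exists_fun] at this
  obtain ⟨c, hc⟩ := this
  exact ⟨c, hc.symm⟩

theorem exists_coord_fr {s t : E5} {K : Fin 3 → E5} (h : fdet (fr s t K) ≠ 0) (d : E5) :
    ∃ (x y : ℂ) (z : Fin 3 → ℂ), d = x • s + y • t + ∑ i, z i • K i := by
  obtain ⟨z, hz⟩ := exists_coord h d
  refine ⟨z 0, z 1, ![z 2, z 3, z 4], ?_⟩
  rw [hz]
  simp [Fin.sum_univ_succ, fr]
  abel

theorem vol_comb {s t : E5} {K : Fin 3 → E5} (x y : Fin 3 → ℂ) (z p q : Fin 3 → ℂ) :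
    vol s t (x 0 • s + y 0 • t + ∑ i, z i • K i) (x 1 • s + y 1 • t + ∑ i, p i • K i)
      (x 2 • s + y 2 • t + ∑ i, q i • K i) =
      (z 0 * (p 1 * q 2 - p 2 * q 1) - z 1 * (p 0 * q 2 - p 2 * q 0) + z 2 * (p 0 * q 1 - p 1 * q 0))
        * fdet (fr s t K) := by
  have h := fdet_comb ![![1,0,0,0,0], ![0,1,0,0,0], ![x 0, y 0, z 0, z 1, z 2], ![x 1, y 1, p 0, p 1, p 2],
    ![x 2, y 2, q 0, q 1, q 2]] (fr s t K)
  have h2 : (fun i => ∑ j, (![![1,0,0,0,0], ![0,1,0,0,0], ![x 0, y 0, z 0, z 1, z 2], ![x 1, y 1, p 0, p 1, p 2],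
    ![x 2, y 2, q 0, q 1, q 2]] : Fin 5 → Fin 5 → ℂ) i j • (fr s t K) j) =
      ![s, t, (x 0 • s + y 0 • t + ∑ i, z i • K i), (x 1 • s + y 1 • t + ∑ i, p i • K i),
      (x 2 • s + y 2 • t + ∑ i, q i • K i)] := by
    funext i
    fin_cases i <;> simp [Fin.sum_univ_succ, fr] <;> abel
  rw [h2] at h
  rw [vol, h]
  congr 1
  simp [Matrix.det_succ_row_zero, Fin.sum_univ_succ, Fin.succAbove]
  ring

/-! ### the cubic data attached to a frame -/

section Data
variable (F : Cub) (s t : E5) (K : Fin 3 → E5)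

def cross (A B : Fin 3 → ℂ) : Fin 3 → ℂ :=
  ![A 1 * B 2 - A 2 * B 1, A 2 * B 0 - A 0 * B 2, A 0 * B 1 - A 1 * B 0]

@[simp] theorem cross_0 (A B : Fin 3 → ℂ) : cross A B 0 = A 1 * B 2 - A 2 * B 1 := rfl
@[simp] theorem cross_1 (A B : Fin 3 → ℂ) : cross A B 1 = A 2 * B 0 - A 0 * B 2 := rfl
@[simp] theorem cross_2 (A B : Fin 3 → ℂ) : cross A B 2 = A 0 * B 1 - A 1 * B 0 := rfl

def hA : Fin 3 → ℂ := fun i => tri F s s (K i)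
def hc : Fin 3 → ℂ := cross (hA F s K) (hA F t K)
def cK : E5 := ∑ i, hc F s t K i • K i
def uK : ℂ := tri F s (cK F s t K) (cK F s t K)
def wK : ℂ := tri F t (cK F s t K) (cK F s t K)
def eK : Fin 3 → ℂ := fun i => wK F s t K * tri F s (cK F s t K) (K i) - uK F s t K * tri F t (cK F s t K) (K i)
def mK : Fin 3 → ℂ := fun i => uK F s t K ^ 2 * hA F t K i + wK F s t K ^ 2 * hA F s K i
def tK : ℂ := tri F (cK F s t K) (cK F s t K) (cK F s t K)
def RK : Fin 3 → ℂ := fun i => cross (eK F s t K) (mK F s t K) i -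
  uK F s t K * wK F s t K * (1/3) * tK F s t K * hc F s t K i

/-- the last equation -/
def Eqn (σ : ℂ) (g : E5 → E5 → ℂ) (j : Fin 3) : ℂ :=
  σ * RK F s t K j + fdet (fr s t K) ^ 7 * g s t * hc F s t K j

/-- the curve -/
def Gam : Prop := (∀ x, tri F s t x = 0) ∧ tri F s s s = 0 ∧ tri F t t t = 0

/-- a value of the residual section -/
def IsR (ρ : ℂ) : Prop := ∃ (c : E5) (α β : ℂ),
  (∀ p q, vol s t c p q = tri F s s p * tri F t t q - tri F s s q * tri F t t p) ∧
  (∀ x, tri F t c c * tri F s c x - tri F s c c * tri F t c x = α * tri F s s x + β * tri F t t x) ∧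
  ρ = α * tri F s c c ^ 2 - β * tri F t c c ^ 2 - tri F s c c * tri F t c c * (1/3) * tri F c c c

/-- zeros of the system -/
def Zer (σ : ℂ) (g : E5 → E5 → ℂ) : Prop :=
  Gam F s t ∧ ∀ K j, fdet (fr s t K) * Eqn F s t K σ g j = 0

def Tan (s' t' : E5) : Prop := (∀ x, tri F s' t x + tri F s t' x = 0) ∧ tri F s s s' = 0 ∧ tri F t t t' = 0

/-- nondegenerate zeros -/
def NonDeg (σ : ℂ) (g : E5 → E5 → ℂ) : Prop := ∃ K j, fdet (fr s t K) ≠ 0 ∧ hc F s t K j ≠ 0 ∧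
  ∀ s' t', Tan F s t s' t' →
    deriv (fun ε : ℂ => Eqn F (s + ε • s') (t + ε • t') K σ g j) 0 = 0 →
    ∃ a b : ℂ, s' = a • s ∧ t' = b • t

def GoodQ (σ : ℂ) (g : E5 → E5 → ℂ) : Prop := ∀ s t, s ≠ 0 → t ≠ 0 → Zer F s t σ g → NonDeg F s t σ g

/-- admissible homogeneity -/
def HomG (σ : ℂ) (g : E5 → E5 → ℂ) : Prop := ∃ m : ℕ,
  (∀ (a b : ℂ) s t, g (a • s) (b • t) = a ^ m * b ^ m * g s t) ∧ (σ = 0 ∨ m = 8)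

end Data

section Lemmas
variable {F : Cub} {s t : E5} {K : Fin 3 → E5}

theorem Gam.sst (h : Gam F s t) : tri F s s t = 0 := by rw [tri_comm23]; exact h.1 s
theorem Gam.tts (h : Gam F s t) : tri F t t s = 0 := by rw [tri_comm13]; exact h.1 t

theorem Gam.symm (h : Gam F s t) : Gam F t s :=
  ⟨fun x => by rw [tri_comm12]; exact h.1 x, h.2.2, h.2.1⟩

theorem Gam.A_comb (h : Gam F s t) (x y : ℂ) (z : Fin 3 → ℂ) :
    tri F s s (x • s + y • t + ∑ i, z i • K i) = ∑ i, z i * hA F s K i := by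
  rw [tri_add3, tri_add3, tri_smul3, tri_smul3, tri_sum3, h.2.1, h.sst]
  simp [tri_smul3, hA]

theorem Gam.B_comb (h : Gam F s t) (x y : ℂ) (z : Fin 3 → ℂ) :
    tri F t t (x • s + y • t + ∑ i, z i • K i) = ∑ i, z i * hA F t K i := by
  rw [tri_add3, tri_add3, tri_smul3, tri_smul3, tri_sum3, h.2.2, h.tts]
  simp [tri_smul3, hA]

theorem Gam.A_cK (h : Gam F s t) : tri F s s (cK F s t K) = 0 := by
  have := h.A_comb (K := K) 0 0 (hc F s t K)
  simp only [zero_smul, zero_add] at this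
  rw [cK, this]
  simp [Fin.sum_univ_succ, hc]; ring

theorem Gam.B_cK (h : Gam F s t) : tri F t t (cK F s t K) = 0 := by
  have := h.B_comb (K := K) 0 0 (hc F s t K)
  simp only [zero_smul, zero_add] at this
  rw [cK, this]
  simp [Fin.sum_univ_succ, hc]; ring

theorem vol_cK (h : Gam F s t) (hd : fdet (fr s t K) ≠ 0) (p q : E5) :
    vol s t (cK F s t K) p q = fdet (fr s t K) * (tri F s s p * tri F t t q - tri F s s q * tri F t t p) := by
  obtain ⟨x, y, z, rfl⟩ := exists_coord_fr hd p
  obtain ⟨x', y', z', rfl⟩ := exists_coord_fr hd q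
  have := vol_comb (s := s) (t := t) (K := K) ![0, x, x'] ![0, y, y'] (hc F s t K) z z'
  simp only [Matrix.cons_val_zero, Matrix.cons_val_one, Matrix.cons_val, zero_smul, zero_add] at this
  rw [cK, this, h.A_comb, h.A_comb, h.B_comb, h.B_comb]
  simp [Fin.sum_univ_succ, hc]
  ring

/-- if `E ⟂ A × B` then `E` is a combination of `A` and `B` -/
theorem comb_of_perp {A B E : Fin 3 → ℂ} {j : Fin 3} (hj : cross A B j ≠ 0)
    (h : ∑ i, E i * cross A B i = 0) : ∃ α β : ℂ, ∀ i, E i = α * A i + β * B i := by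
  refine ⟨cross E B j / cross A B j, cross A E j / cross A B j, fun i => ?_⟩
  simp only [Fin.sum_univ_three, cross_0, cross_1, cross_2] at h
  rw [div_mul_eq_mul_div, div_mul_eq_mul_div, ← add_div, eq_div_iff hj]
  clear hj
  fin_cases j <;> fin_cases i <;>
    simp only [Fin.zero_eta, Fin.mk_one, Fin.reduceFinMk, cross_0, cross_1, cross_2] <;>
    first | ring1 | linear_combination h

theorem isR_of_frame (h : Gam F s t) (hd : fdet (fr s t K) ≠ 0) {j : Fin 3} (hj : hc F s t K j ≠ 0) :
    ∃ ρ, IsR F s t ρ ∧ ∀ i, RK F s t K i = fdet (fr s t K) ^ 7 * ρ * hc F s t K i := by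
  have hperp : ∑ i, eK F s t K i * hc F s t K i = 0 := by
    have h1 : ∀ i, tri F s (cK F s t K) (K i) * hc F s t K i = tri F s (cK F s t K) (hc F s t K i • K i) := by
      intro i; rw [tri_smul3]; ring
    have h2 : ∀ i, tri F t (cK F s t K) (K i) * hc F s t K i = tri F t (cK F s t K) (hc F s t K i • K i) := by
      intro i; rw [tri_smul3]; ring
    simp only [eK, sub_mul, mul_assoc, h1, h2]
    rw [Finset.sum_sub_distrib, ← Finset.mul_sum, ← Finset.mul_sum, ← tri_sum3, ← tri_sum3, ← cK, uK, wK]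
    ring
  obtain ⟨α, β, hαβ⟩ := comb_of_perp hj hperp
  set δ := fdet (fr s t K) with hδ
  set c := cK F s t K with hc'
  have hE : ∀ x, wK F s t K * tri F s c x - uK F s t K * tri F t c x = α * tri F s s x + β * tri F t t x := by
    intro x
    obtain ⟨x1, y1, z, rfl⟩ := exists_coord_fr hd x
    rw [h.A_comb, h.B_comb, tri_add3, tri_add3, tri_add3, tri_add3, tri_smul3, tri_smul3, tri_smul3, tri_smul3,
      tri_sum3, tri_sum3, tri_comm23 F s c s, tri_comm23 F s c t, tri_comm23 F t c s, tri_comm23 F t c t,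
      h.A_cK, h.1 c, h.symm.1 c, h.B_cK]
    simp only [mul_zero, add_zero, zero_add, tri_smul3, Finset.mul_sum, ← Finset.sum_sub_distrib, ← Finset.sum_add_distrib]
    refine Finset.sum_congr rfl fun i _ => ?_
    have := hαβ i
    simp only [eK] at this
    rw [← hc'] at this
    have e1 : hA F s K i = hA F s K i := rfl
    linear_combination z i * this
  refine ⟨(α * uK F s t K ^ 2 - β * wK F s t K ^ 2 - uK F s t K * wK F s t K * (1/3) * tK F s t K) / δ ^ 7, ?_, ?_⟩
  · refine ⟨δ⁻¹ • c, α / δ ^ 3, β / δ ^ 3, ?_, ?_, ?_⟩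
    · intro p q
      have h1 : vol s t (δ⁻¹ • c) p q = δ⁻¹ * vol s t c p q := by
        obtain ⟨x, y, z, rfl⟩ := exists_coord_fr hd p
        obtain ⟨x', y', z', rfl⟩ := exists_coord_fr hd q
        have e1 := vol_comb (s := s) (t := t) (K := K) ![0, x, x'] ![0, y, y'] (hc F s t K) z z'
        have e2 := vol_comb (s := s) (t := t) (K := K) ![0, x, x'] ![0, y, y'] (δ⁻¹ • hc F s t K) z z'
        simp only [Matrix.cons_val_zero, Matrix.cons_val_one, Matrix.cons_val, zero_smul, zero_add,
          Pi.smul_apply, smul_eq_mul, mul_smul, ← Finset.smul_sum] at e1 e2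
        rw [← cK] at e1 e2
        rw [e1, e2]; ring
      rw [h1, vol_cK h hd, ← hδ]
      field_simp
    · intro x
      have := hE x
      simp only [uK, wK] at this
      rw [← hc'] at this
      simp only [tri_smul2, tri_smul3]
      field_simp
      linear_combination this
    · simp only [tri_smul1, tri_smul2, tri_smul3, uK, wK, tK]
      rw [← hc']
      field_simp
  · intro i
    have e1 : ∀ i, eK F s t K i = α * hA F s K i + β * hA F t K i := hαβ
    have : cross (eK F s t K) (mK F s t K) i = (α * uK F s t K ^ 2 - β * wK F s t K ^ 2) * hc F s t K i := by
      fin_cases i <;> simp [e1, mK, hc] <;> ring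
    rw [RK, this]
    field_simp

theorem isR_unique (h : Gam F s t) (hd : fdet (fr s t K) ≠ 0) {j : Fin 3} (hj : hc F s t K j ≠ 0)
    {ρ ρ' : ℂ} (h1 : IsR F s t ρ) (h2 : IsR F s t ρ') : ρ' = ρ := by
  obtain ⟨c, α, β, hv, he, rfl⟩ := h1
  obtain ⟨c', α', β', hv', he', rfl⟩ := h2
  obtain ⟨x0, y0, z0, hz0⟩ := exists_coord_fr hd c
  obtain ⟨x1, y1, z1, hz1⟩ := exists_coord_fr hd c'
  have hz : z1 = z0 := by
    have key : ∀ p q : Fin 3 → ℂ, (z0 0 * (p 1 * q 2 - p 2 * q 1) - z0 1 * (p 0 * q 2 - p 2 * q 0) + z0 2 * (p 0 * q 1 - p 1 * q 0))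
        = (z1 0 * (p 1 * q 2 - p 2 * q 1) - z1 1 * (p 0 * q 2 - p 2 * q 0) + z1 2 * (p 0 * q 1 - p 1 * q 0)) := by
      intro p q
      have e1 := vol_comb (s := s) (t := t) (K := K) ![x0, 0, 0] ![y0, 0, 0] z0 p q
      have e2 := vol_comb (s := s) (t := t) (K := K) ![x1, 0, 0] ![y1, 0, 0] z1 p q
      simp only [Matrix.cons_val_zero, Matrix.cons_val_one, Matrix.cons_val] at e1 e2
      rw [← hz0, hv] at e1
      rw [← hz1, hv', e1] at e2
      exact mul_right_cancel₀ hd e2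
    have k0 := key ![0,1,0] ![0,0,1]
    have k1 := key ![1,0,0] ![0,0,1]
    have k2 := key ![1,0,0] ![0,1,0]
    simp at k0 k1 k2
    funext i
    fin_cases i
    · exact k0.symm
    · exact k1.symm
    · exact k2.symm
  subst hz
  obtain ⟨x, y, hc'⟩ : ∃ x y : ℂ, c' = c + x • s + y • t :=
    ⟨x1 - x0, y1 - y0, by rw [hz0, hz1]; module⟩
  clear hz0 hz1
  have hAc : tri F s s c = 0 ∧ tri F t t c = 0 := by
    have alt : ∀ p, vol s t c c p = 0 := by
      intro p; unfold vol fdet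
      exact Matrix.det_zero_of_row_eq (i := 2) (j := 3) (by decide) (by ext k; simp)
    have e : ∀ i, tri F s s c * hA F t K i = hA F s K i * tri F t t c := by
      intro i
      have := (hv c (K i)).symm.trans (alt _)
      simp only [hA]; linear_combination this
    have e0 := e 0
    have e1 := e 1
    have e2 := e 2
    have hsq : hc F s t K j * tri F s s c = 0 ∧ hc F s t K j * tri F t t c = 0 := by
      fin_cases j <;> simp only [Fin.zero_eta, Fin.mk_one, Fin.reduceFinMk, hc, cross_0, cross_1, cross_2]
      · exact ⟨by linear_combination hA F s K 1 * e2 - hA F s K 2 * e1, by linear_combination hA F t K 1 * e2 - hA F t K 2 * e1⟩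
      · exact ⟨by linear_combination hA F s K 2 * e0 - hA F s K 0 * e2, by linear_combination hA F t K 2 * e0 - hA F t K 0 * e2⟩
      · exact ⟨by linear_combination hA F s K 0 * e1 - hA F s K 1 * e0, by linear_combination hA F t K 0 * e1 - hA F t K 1 * e0⟩
    exact ⟨(mul_eq_zero.1 hsq.1).resolve_left hj, (mul_eq_zero.1 hsq.2).resolve_left hj⟩
  have st1 : ∀ x, tri F s t x = 0 := h.1
  have st2 : ∀ x, tri F t s x = 0 := h.symm.1
  have st3 : ∀ x, tri F s x t = 0 := fun x => by rw [tri_comm23]; exact h.1 x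
  have st4 : ∀ x, tri F t x s = 0 := fun x => by rw [tri_comm23]; exact h.symm.1 x
  have scs : tri F s c s = 0 := by rw [tri_comm23]; exact hAc.1
  have tct : tri F t c t = 0 := by rw [tri_comm23]; exact hAc.2
  have hu : tri F s c' c' = tri F s c c := by
    rw [hc']; simp only [tri_add2, tri_add3, tri_smul2, tri_smul3, st1, st3, hAc.1, scs, h.2.1]; ring
  have hw : tri F t c' c' = tri F t c c := by
    rw [hc']; simp only [tri_add2, tri_add3, tri_smul2, tri_smul3, st2, st4, hAc.2, tct, h.2.2]; ring
  have ht : tri F c' c' c' = tri F c c c + 3 * x * tri F s c c + 3 * y * tri F t c c := by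
    have a1 : tri F c' c' c' = tri F c c' c' + x * tri F s c' c' + y * tri F t c' c' := by
      conv_lhs => rw [hc']
      rw [tri_add1, tri_add1, tri_smul1, tri_smul1]
      rw [← hc']
    have a2 : tri F c c' c' = tri F c c c + 2 * x * tri F s c c + 2 * y * tri F t c c := by
      rw [hc']; simp only [tri_add2, tri_add3, tri_smul2, tri_smul3]
      rw [tri_comm12 F c s c, tri_comm12 F c t c, tri_comm12 F c s s, tri_comm12 F c t t, tri_comm12 F c s t,
        tri_comm12 F c t s, st3, st4, scs, tct, tri_comm13 F c c s, tri_comm13 F c c t]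
      ring
    rw [a1, a2, hu, hw]; ring
  have hcoef : ∀ z, α' * tri F s s z + β' * tri F t t z =
      (α + x * tri F t c c) * tri F s s z + (β - y * tri F s c c) * tri F t t z := by
    intro z
    rw [← he' z, hu, hw, hc']
    simp only [tri_add2, tri_smul2, st1, st2]
    have := he z
    linear_combination this
  have hind : ∀ a b : ℂ, (∀ z, a * tri F s s z + b * tri F t t z = 0) → a = 0 ∧ b = 0 := by
    intro a b hab
    have h0 := hab (K 0)
    have h1 := hab (K 1)
    have h2 := hab (K 2)
    have hsq : hc F s t K j * a = 0 ∧ hc F s t K j * b = 0 := by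
      fin_cases j <;> simp only [Fin.zero_eta, Fin.mk_one, Fin.reduceFinMk, hc, cross_0, cross_1, cross_2, hA]
      · exact ⟨by linear_combination tri F t t (K 2) * h1 - tri F t t (K 1) * h2, by linear_combination tri F s s (K 1) * h2 - tri F s s (K 2) * h1⟩
      · exact ⟨by linear_combination tri F t t (K 0) * h2 - tri F t t (K 2) * h0, by linear_combination tri F s s (K 2) * h0 - tri F s s (K 0) * h2⟩
      · exact ⟨by linear_combination tri F t t (K 1) * h0 - tri F t t (K 0) * h1, by linear_combination tri F s s (K 0) * h1 - tri F s s (K 1) * h0⟩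
    exact ⟨(mul_eq_zero.1 hsq.1).resolve_left hj, (mul_eq_zero.1 hsq.2).resolve_left hj⟩
  obtain ⟨e1, e2⟩ := hind (α' - (α + x * tri F t c c)) (β' - (β - y * tri F s c c)) (fun z => by
    linear_combination hcoef z)
  rw [hu, hw, ht]
  rw [sub_eq_zero] at e1 e2
  rw [e1, e2]; ring

/-- it suffices to check the last equation in a single good frame -/
theorem zer_of_frame {σ : ℂ} {g : E5 → E5 → ℂ} (h : Gam F s t) (hd : fdet (fr s t K) ≠ 0) {j : Fin 3}
    (hj : hc F s t K j ≠ 0) (he : Eqn F s t K σ g j = 0) : Zer F s t σ g := by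
  obtain ⟨ρ, hρ, hR⟩ := isR_of_frame h hd hj
  have h0 : σ * ρ + g s t = 0 := by
    rw [Eqn, hR] at he
    have : fdet (fr s t K) ^ 7 * hc F s t K j * (σ * ρ + g s t) = 0 := by linear_combination he
    exact (mul_eq_zero.1 this).resolve_left (mul_ne_zero (pow_ne_zero _ hd) hj)
  refine ⟨h, fun K' j' => ?_⟩
  by_cases hd' : fdet (fr s t K') = 0
  · rw [hd', zero_mul]
  by_cases hj0 : ∃ i, hc F s t K' i ≠ 0
  · obtain ⟨i, hi⟩ := hj0
    obtain ⟨ρ', hρ', hR'⟩ := isR_of_frame h hd' hi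
    have := isR_unique h hd hj hρ hρ'
    subst this
    rw [Eqn, hR']
    linear_combination fdet (fr s t K') ^ 8 * hc F s t K' j' * h0
  · -- impossible, but also trivially fine
    push Not at hj0
    have hcz : cK F s t K' = 0 := by simp [cK, hj0]
    have : RK F s t K' j' = 0 := by
      have e : ∀ i, eK F s t K' i = 0 := by intro i; simp [eK, hcz, tri_zero2]
      rw [RK, hj0]
      fin_cases j' <;> simp [e]
    rw [Eqn, this, hj0]; ring

end Lemmas

end CT

namespace CT

/-! ### homogeneity and symmetry -/

section Hom
variable (F : Cub) (s t : E5) (K : Fin 3 → E5) (a b : ℂ)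

theorem hA_smul : hA F (a • s) K = a ^ 2 • hA F s K := by
  funext i; simp [hA, tri_smul1, tri_smul2]; ring

theorem cross_smul (A B : Fin 3 → ℂ) : cross (a • A) (b • B) = (a * b) • cross A B := by
  funext i; fin_cases i <;> simp <;> ring

theorem hc_smul : hc F (a • s) (b • t) K = (a * b) ^ 2 • hc F s t K := by
  rw [hc, hA_smul, hA_smul, cross_smul, hc]; congr 1; ring

theorem cK_smul : cK F (a • s) (b • t) K = (a * b) ^ 2 • cK F s t K := by
  simp [cK, hc_smul, Finset.smul_sum, mul_smul]

theorem uK_smul : uK F (a • s) (b • t) K = a * (a * b) ^ 4 * uK F s t K := by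
  simp [uK, cK_smul, tri_smul1, tri_smul2, tri_smul3]; ring

theorem wK_smul : wK F (a • s) (b • t) K = b * (a * b) ^ 4 * wK F s t K := by
  simp [wK, cK_smul, tri_smul1, tri_smul2, tri_smul3]; ring

theorem tK_smul : tK F (a • s) (b • t) K = (a * b) ^ 6 * tK F s t K := by
  simp [tK, cK_smul, tri_smul1, tri_smul2, tri_smul3]; ring

theorem eK_smul : eK F (a • s) (b • t) K = (a * b) ^ 7 • eK F s t K := by
  funext i; simp [eK, cK_smul, uK_smul, wK_smul, tri_smul1, tri_smul2]; ring

theorem mK_smul : mK F (a • s) (b • t) K = (a * b) ^ 10 • mK F s t K := by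
  funext i; simp [mK, uK_smul, wK_smul, hA_smul]; ring

theorem RK_smul (j : Fin 3) : RK F (a • s) (b • t) K j = (a * b) ^ 17 * RK F s t K j := by
  simp [RK, uK_smul, wK_smul, tK_smul, eK_smul, mK_smul, cross_smul, hc_smul]; ring

theorem fdet_fr_smul : fdet (fr (a • s) (b • t) K) = a * b * fdet (fr s t K) := by
  have h := fdet_comb ![![a,0,0,0,0], ![0,b,0,0,0], ![0,0,1,0,0], ![0,0,0,1,0], ![0,0,0,0,1]] (fr s t K)
  have h2 : (fun i => ∑ j, (![![a,0,0,0,0], ![0,b,0,0,0], ![0,0,1,0,0], ![0,0,0,1,0], ![0,0,0,0,1]] :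
      Fin 5 → Fin 5 → ℂ) i j • (fr s t K) j) = fr (a • s) (b • t) K := by
    funext i
    fin_cases i <;> simp [Fin.sum_univ_succ, fr]
  rw [h2] at h
  rw [h]
  congr 1
  simp [Matrix.det_succ_row_zero, Fin.sum_univ_succ, Fin.succAbove]

theorem Eqn_smul {σ : ℂ} {g : E5 → E5 → ℂ} (hg : HomG σ g) :
    ∃ N, ∀ (F : Cub) (s t : E5) (K : Fin 3 → E5) (a b : ℂ) j,
      Eqn F (a • s) (b • t) K σ g j = (a * b) ^ N * Eqn F s t K σ g j := by
  obtain ⟨m, hm, h⟩ := hg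
  refine ⟨m + 9, fun F s t K a b j => ?_⟩
  rw [Eqn, RK_smul, fdet_fr_smul, hm, hc_smul, Eqn]
  rcases h with rfl | rfl
  · simp; ring
  · simp; ring

theorem Gam.smul {F : Cub} {s t : E5} (h : Gam F s t) (a b : ℂ) : Gam F (a • s) (b • t) := by
  refine ⟨fun x => ?_, ?_, ?_⟩
  · rw [tri_smul1, tri_smul2, h.1]; simp
  · rw [tri_smul1, tri_smul2, tri_smul3, h.2.1]; simp
  · rw [tri_smul1, tri_smul2, tri_smul3, h.2.2]; simp

theorem Zer.smul {F : Cub} {s t : E5} {σ : ℂ} {g : E5 → E5 → ℂ} (hg : HomG σ g) (h : Zer F s t σ g) (a b : ℂ) :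
    Zer F (a • s) (b • t) σ g := by
  obtain ⟨N, hN⟩ := Eqn_smul hg
  refine ⟨h.1.smul a b, fun K j => ?_⟩
  rw [hN, fdet_fr_smul]
  linear_combination (a * b) * (a * b) ^ N * h.2 K j

theorem hc_swap : hc F t s K = - hc F s t K := by
  funext i; fin_cases i <;> simp [hc] <;> ring

theorem cK_swap : cK F t s K = - cK F s t K := by
  simp [cK, hc_swap F s t]

theorem RK_swap (j : Fin 3) : RK F t s K j = RK F s t K j := by
  have hu : uK F t s K = wK F s t K := by simp [uK, wK, cK_swap F s t, tri_neg2, tri_neg3]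
  have hw : wK F t s K = uK F s t K := by simp [uK, wK, cK_swap F s t, tri_neg2, tri_neg3]
  have ht : tK F t s K = - tK F s t K := by simp [tK, cK_swap F s t, tri_neg1, tri_neg2, tri_neg3]
  have he : eK F t s K = eK F s t K := by
    funext i; simp [eK, hu, hw, cK_swap F s t, tri_neg2]; ring
  have hm : mK F t s K = mK F s t K := by
    funext i; simp [mK, hu, hw]; ring
  simp only [RK, hu, hw, ht, he, hm, hc_swap F s t, Pi.neg_apply]; ring

theorem fdet_fr_swap : fdet (fr t s K) = - fdet (fr s t K) := by
  have h := fdet_comb ![![0,1,0,0,0], ![1,0,0,0,0], ![0,0,1,0,0], ![0,0,0,1,0], ![0,0,0,0,1]] (fr s t K)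
  have h2 : (fun i => ∑ j, (![![0,1,0,0,0], ![1,0,0,0,0], ![0,0,1,0,0], ![0,0,0,1,0], ![0,0,0,0,1]] :
      Fin 5 → Fin 5 → ℂ) i j • (fr s t K) j) = fr t s K := by
    funext i
    fin_cases i <;> simp [Fin.sum_univ_succ, fr]
  rw [h2] at h
  rw [h]
  have : Matrix.det (Matrix.of (![![0,1,0,0,0], ![1,0,0,0,0], ![0,0,1,0,0], ![0,0,0,1,0], ![0,0,0,0,1]] :
      Fin 5 → Fin 5 → ℂ)) = -1 := by
    simp [Matrix.det_succ_row_zero, Fin.sum_univ_succ, Fin.succAbove]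
  rw [this]; ring

theorem Zer.swap {F : Cub} {s t : E5} (h : Zer F s t 1 (fun _ _ => 0)) : Zer F t s 1 (fun _ _ => 0) := by
  refine ⟨h.1.symm, fun K j => ?_⟩
  have := h.2 K j
  simp only [Eqn, RK_swap F s t, fdet_fr_swap s t] at *
  linear_combination -this

end Hom

/-! ### normal form of frames -/

theorem lup_aux (n : ℕ → E5) (hn : ∀ m < 5, n m ∉ Submodule.span ℂ (n '' {j | j < m})) (m : ℕ) (hm : m ≤ 5) :
    ∃ (p : ℕ → Fin 5) (u : ℕ → E5) (L : ℕ → ℕ → ℂ), ∀ i < m, u i (p i) = 1 ∧ (∀ j < i, u i (p j) = 0) ∧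
      u i ∈ Submodule.span ℂ (n '' {j | j < i + 1}) ∧
      L i i ≠ 0 ∧ n i = ∑ j ∈ Finset.range (i + 1), L i j • u j := by
  induction m with
  | zero => exact ⟨fun _ => 0, fun _ => 0, fun _ _ => 0, fun i hi => by omega⟩
  | succ m ih =>
    obtain ⟨p, u, L, h⟩ := ih (by omega)
    have key : ∀ l ≤ m, ∃ x : ℕ → ℂ, ∀ j < l, (n m - ∑ i ∈ Finset.range l, x i • u i) (p j) = 0 := by
      intro l
      induction l with
      | zero => intro _; exact ⟨fun _ => 0, fun j hj => by omega⟩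
      | succ l ihl =>
        intro hl
        obtain ⟨x, hx⟩ := ihl (by omega)
        refine ⟨Function.update x l ((n m - ∑ i ∈ Finset.range l, x i • u i) (p l)), fun j hj => ?_⟩
        have e : ∑ i ∈ Finset.range l, Function.update x l ((n m - ∑ i ∈ Finset.range l, x i • u i) (p l)) i • u i
            = ∑ i ∈ Finset.range l, x i • u i := by
          refine Finset.sum_congr rfl fun i hi => ?_
          rw [Function.update_of_ne]
          simp at hi; omega
        rw [Finset.sum_range_succ, e, Function.update_self, ← sub_sub]
        rcases Nat.lt_succ_iff_lt_or_eq.1 hj with hj | rfl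
        · rw [Pi.sub_apply, hx j hj, Pi.smul_apply, (h l (by omega)).2.1 j hj]; simp
        · rw [Pi.sub_apply, Pi.smul_apply, (h j (by omega)).1]; simp
    obtain ⟨x, hx⟩ := key m le_rfl
    set v := n m - ∑ i ∈ Finset.range m, x i • u i with hv
    have hmem : ∑ i ∈ Finset.range m, x i • u i ∈ Submodule.span ℂ (n '' {j | j < m}) := by
      refine Submodule.sum_mem _ fun i hi => Submodule.smul_mem _ _ ?_
      rw [Finset.mem_range] at hi
      refine Submodule.span_mono (Set.image_mono ?_) (h i hi).2.2.1
      intro j hj; simp at hj ⊢; omega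
    have hv0 : v ≠ 0 := by
      intro h0
      rw [hv, sub_eq_zero] at h0
      exact hn m (by omega) (h0 ▸ hmem)
    obtain ⟨q, hq⟩ : ∃ q, v q ≠ 0 := by
      by_contra hc; push Not at hc; exact hv0 (funext hc)
    refine ⟨Function.update p m q, Function.update u m ((v q)⁻¹ • v),
      Function.update L m (Function.update x m (v q)), fun i hi => ?_⟩
    have upd : ∀ j < m, Function.update p m q j = p j := fun j hj => Function.update_of_ne (by omega) _ _
    have updu : ∀ j < m, Function.update u m ((v q)⁻¹ • v) j = u j := fun j hj => Function.update_of_ne (by omega) _ _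
    rcases Nat.lt_succ_iff_lt_or_eq.1 hi with hi | rfl
    · rw [upd i hi, updu i hi, Function.update_of_ne (by omega : i ≠ m)]
      obtain ⟨h1, h2, h3, h4, h5⟩ := h i hi
      refine ⟨h1, fun j hj => by rw [upd j (by omega)]; exact h2 j hj, h3, h4, h5.trans ?_⟩
      refine Finset.sum_congr rfl fun j hj => ?_
      rw [Finset.mem_range] at hj
      rw [updu j (by omega)]
    · simp only [Function.update_self]
      refine ⟨?_, fun j hj => ?_, ?_, hq, ?_⟩
      · simp [hq]
      · rw [upd j hj, Pi.smul_apply, hx j hj]; simp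
      · refine Submodule.smul_mem _ _ (Submodule.sub_mem _ (Submodule.subset_span ⟨i, by simp, rfl⟩) ?_)
        refine Submodule.span_mono (Set.image_mono ?_) hmem
        intro j hj; simp at hj ⊢; omega
      · rw [Finset.sum_range_succ, Function.update_self, Function.update_self, smul_smul, mul_inv_cancel₀ hq, one_smul]
        have : ∑ j ∈ Finset.range i, Function.update x i (v q) j • Function.update u i ((v q)⁻¹ • v) j =
            ∑ j ∈ Finset.range i, x j • u j := by
          refine Finset.sum_congr rfl fun j hj => ?_
          rw [Finset.mem_range] at hj
          rw [updu j hj, Function.update_of_ne (by omega)]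
        rw [this, hv]; abel

/-- parametrised frames -/
def fam (π : Equiv.Perm (Fin 5)) (L U : Fin 5 → Fin 5 → ℂ) : Fin 5 → E5 :=
  fun i => ∑ j, L i j • ∑ k, U j k • bv (π k)

/-- upper unitriangular matrix -/
def upr (U : Fin 5 → Fin 5 → ℂ) : Fin 5 → Fin 5 → ℂ := fun i k => if i = k then 1 else if i < k then U i k else 0

theorem lup {n : Fin 5 → E5} (hn : LinearIndependent ℂ n) : ∃ (π : Equiv.Perm (Fin 5)) (L U : Fin 5 → Fin 5 → ℂ),
    (∀ i, L i i ≠ 0) ∧ (∀ i j, i < j → L i j = 0) ∧ n = fam π L (upr U) := by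
  obtain ⟨p, u, L, h⟩ := lup_aux (fun i => if hi : i < 5 then n ⟨i, hi⟩ else 0) (by
    intro m hm
    rw [dif_pos hm]
    have := hn.notMem_span_image (s := {j | j.1 < m}) (x := ⟨m, hm⟩) (by simp)
    intro hc
    refine this (Submodule.span_mono ?_ hc)
    rintro _ ⟨j, hj, rfl⟩
    have hj' : j < 5 := lt_trans hj hm
    refine ⟨⟨j, hj'⟩, hj, ?_⟩
    simp [hj']) 5 le_rfl
  have hinj : Function.Injective (fun i : Fin 5 => p i) := by
    intro i j hij
    simp only at hij
    rcases lt_trichotomy i j with hlt | heq | hgt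
    · have h1 := (h j j.2).1; have h2 := (h j j.2).2.1 i hlt
      rw [hij, h1] at h2; exact absurd h2 one_ne_zero
    · exact heq
    · have h1 := (h i i.2).1; have h2 := (h i i.2).2.1 j hgt
      rw [← hij, h1] at h2; exact absurd h2 one_ne_zero
  refine ⟨Equiv.ofBijective _ (Finite.injective_iff_bijective.1 hinj), fun i j => if j ≤ i then L i j else 0,
    fun i k => u i (p k), fun i => by simpa using (h i i.2).2.2.2.1, fun i j hij => by simp [not_le.2 hij], ?_⟩
  have hu : ∀ i : Fin 5, u i = ∑ k, upr (fun i k => u i (p k)) i k • bv (p k) := by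
    intro i
    have e : ∀ k : Fin 5, upr (fun i k : Fin 5 => u i (p k)) i k = u i (p k) := by
      intro k
      unfold upr
      split_ifs with h1 h2
      · subst h1; exact (h i i.2).1.symm
      · rfl
      · exact ((h i i.2).2.1 k (by have : k < i := by omega
                                   exact this)).symm
    simp only [e]
    conv_lhs => rw [vec_eq_sum (u i)]
    exact (Equiv.sum_comp (Equiv.ofBijective _ (Finite.injective_iff_bijective.1 hinj)) (fun k => u i k • bv k)).symm
  funext i
  have := (h i i.2).2.2.2.2
  simp only [i.2, dif_pos, Fin.eta] at this
  rw [this]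
  unfold fam
  simp only [Equiv.ofBijective_apply]
  simp only [← hu]
  have e2 : ∑ j : Fin 5, (if j ≤ i then L i j else 0) • u j = ∑ j ∈ Finset.range 5, (if j ≤ i then L i j else 0) • u j :=
    Fin.sum_univ_eq_sum_range (fun j => (if j ≤ (i : ℕ) then L i j else 0) • u j) 5
  refine Eq.trans ?_ e2.symm
  rw [← Finset.sum_subset (s₁ := Finset.range (i + 1)) (s₂ := Finset.range 5)]
  · refine Finset.sum_congr rfl fun j hj => ?_
    rw [Finset.mem_range] at hj
    rw [if_pos (by omega)]
  · intro j hj; rw [Finset.mem_range] at *; omega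
  · intro j _ hj
    rw [Finset.mem_range] at hj
    rw [if_neg (by omega), zero_smul]

theorem fdet_fam (π : Equiv.Perm (Fin 5)) {L : Fin 5 → Fin 5 → ℂ} (U : Fin 5 → Fin 5 → ℂ) (h1 : ∀ i, L i i ≠ 0)
    (h2 : ∀ i j, i < j → L i j = 0) : fdet (fam π L (upr U)) ≠ 0 := by
  have e : fam π L (upr U) = fun i => ∑ j, L i j • (fun j => ∑ k, upr U j k • (fun k => bv (π k)) k) j := rfl
  rw [e, fdet_comb, fdet_comb]
  refine mul_ne_zero ?_ (mul_ne_zero ?_ ?_)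
  · rw [Matrix.det_of_lowerTriangular]
    · exact Finset.prod_ne_zero_iff.2 fun i _ => h1 i
    · intro i j hij
      exact h2 i j hij
  · rw [Matrix.det_of_upperTriangular]
    · simp [upr]
    · intro i j hij
      have : j < i := hij
      simp [upr, this.ne', this.le]
  · rw [fdet_ne_zero_iff]
    have : LinearIndependent ℂ (fun i => bv i) := by
      have := (Pi.basisFun ℂ (Fin 5)).linearIndependent
      convert this using 2
      ext; simp [bv]
    exact this.comp _ π.injective

end CT

namespace CT

/-- smoothness in tensor form -/
def Smooth3 (F : Cub) : Prop := ∀ p, (∀ x, tri F p p x = 0) → p = 0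

theorem extend_li {m : ℕ} (hm : m < 5) {v : Fin m → E5} (hv : LinearIndependent ℂ v) :
    ∃ w, LinearIndependent ℂ (Fin.snoc v w : Fin (m + 1) → E5) := by
  have : ∃ w, w ∉ Submodule.span ℂ (Set.range v) := by
    by_contra hc
    push Not at hc
    have htop : Submodule.span ℂ (Set.range v) = ⊤ := by
      rw [eq_top_iff]; intro w _; exact hc w
    have h1 := finrank_span_eq_card hv
    rw [htop, finrank_top] at h1
    simp at h1; omega
  obtain ⟨w, hw⟩ := this
  exact ⟨w, linearIndependent_finSnoc.2 ⟨hv, hw⟩⟩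

theorem extend4 {a b c d : E5} (h : LinearIndependent ℂ ![a, b, c, d]) :
    ∃ e, LinearIndependent ℂ ![a, b, c, d, e] := by
  obtain ⟨w, hw⟩ := extend_li (by norm_num) h
  refine ⟨w, ?_⟩
  convert hw using 1
  funext i; fin_cases i <;> rfl

theorem extend3 {a b c : E5} (h : LinearIndependent ℂ ![a, b, c]) :
    ∃ d e, LinearIndependent ℂ ![a, b, c, d, e] := by
  obtain ⟨w, hw⟩ := extend_li (by norm_num) h
  refine ⟨w, extend4 ?_⟩
  convert hw using 1
  funext i; fin_cases i <;> rfl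

theorem extend2 {a b : E5} (h : LinearIndependent ℂ ![a, b]) :
    ∃ c d e, LinearIndependent ℂ ![a, b, c, d, e] := by
  obtain ⟨w, hw⟩ := extend_li (by norm_num) h
  refine ⟨w, extend3 ?_⟩
  convert hw using 1
  funext i; fin_cases i <;> rfl

theorem extend1 {a : E5} (h : a ≠ 0) :
    ∃ b c d e, LinearIndependent ℂ ![a, b, c, d, e] := by
  have h1 : LinearIndependent ℂ ![a] := by
    rw [linearIndependent_unique_iff]; simpa using h
  obtain ⟨w, hw⟩ := extend_li (by norm_num) h1
  refine ⟨w, extend2 ?_⟩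
  convert hw using 1
  funext i; fin_cases i <;> rfl

variable {F : Cub} {s t : E5}

theorem Gam.li (hS : Smooth3 F) (h : Gam F s t) (hs : s ≠ 0) (ht : t ≠ 0) : LinearIndependent ℂ ![s, t] := by
  rw [LinearIndependent.pair_iff' hs]
  intro a ha
  have ha0 : a ≠ 0 := by rintro rfl; simp at ha; exact ht ha.symm
  refine hs (hS s fun x => ?_)
  have := h.1 x
  rw [← ha, tri_smul2] at this
  exact (mul_eq_zero.1 this).resolve_left ha0

theorem Gam.quad (h : Gam F s t) (x y : ℂ) (z : E5) : tri F (x • s + y • t) (x • s + y • t) z =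
    x ^ 2 * tri F s s z + y ^ 2 * tri F t t z := by
  simp only [tri_add1, tri_add2, tri_smul1, tri_smul2, h.1, h.symm.1]; ring

theorem Gam.indep (hS : Smooth3 F) (h : Gam F s t) (hs : s ≠ 0) (ht : t ≠ 0) {x y : ℂ}
    (hxy : ∀ z, x * tri F s s z + y * tri F t t z = 0) : x = 0 ∧ y = 0 := by
  obtain ⟨x', rfl⟩ := IsAlgClosed.exists_pow_nat_eq x (n := 2) (by norm_num)
  obtain ⟨y', rfl⟩ := IsAlgClosed.exists_pow_nat_eq y (n := 2) (by norm_num)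
  have h0 := hS (x' • s + y' • t) fun z => by rw [h.quad, hxy]
  have := LinearIndependent.pair_iff.1 (h.li hS hs ht) x' y' h0
  rw [this.1, this.2]; simp

theorem exists_frame0 (hli : LinearIndependent ℂ ![s, t]) :
    ∃ k : Fin 3 → Fin 5, fdet (fr s t (fun i => bv (k i))) ≠ 0 := by
  obtain ⟨c, d, e, h⟩ := extend2 hli
  obtain ⟨π, L, U, h1, h2, h3⟩ := lup h
  refine ⟨fun i => π (![2,3,4] i), ?_⟩
  have : fr s t (fun i => bv (π (![2,3,4] i))) = fam π (fun i j => if i < 2 then L i j else if i = j then 1 else 0)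
    (upr (fun i j => if i < 2 then U i j else 0)) := by
    have e0 := congrFun h3 0
    have e1 := congrFun h3 1
    have l0 : ∀ j : Fin 5, 0 < j → L 0 j = 0 := h2 0
    have l1 : ∀ j : Fin 5, 1 < j → L 1 j = 0 := h2 1
    simp only [Matrix.cons_val_zero, Matrix.cons_val_one] at e0 e1
    funext i
    fin_cases i
    · simp only [fr, fam, Fin.zero_eta, Matrix.cons_val_zero]
      rw [e0]; simp [fam, Fin.sum_univ_succ, upr, l0 _ (Fin.succ_pos _)]
    · simp only [fr, fam, Fin.mk_one, Matrix.cons_val_one, Matrix.cons_val_zero]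
      rw [e1]; simp [fam, Fin.sum_univ_succ, upr, l1 2 (by decide), l1 3 (by decide), l1 4 (by decide)]
    · simp [fr, fam, Fin.sum_univ_succ, upr]
    · simp [fr, fam, Fin.sum_univ_succ, upr]
    · simp [fr, fam, Fin.sum_univ_succ, upr]
  rw [this]
  apply fdet_fam
  · intro i; simp only; split_ifs <;> simp [h1]
  · intro i j hij; split_ifs
    · exact h2 i j hij
    · omega
    · rfl

theorem Gam.exists_hc (hS : Smooth3 F) (h : Gam F s t) (hs : s ≠ 0) (ht : t ≠ 0) {K : Fin 3 → E5}
    (hd : fdet (fr s t K) ≠ 0) : ∃ j, hc F s t K j ≠ 0 := by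
  by_contra hcon
  push Not at hcon
  have c0 : hA F s K 1 * hA F t K 2 - hA F s K 2 * hA F t K 1 = 0 := hcon 0
  have c1 : hA F s K 2 * hA F t K 0 - hA F s K 0 * hA F t K 2 = 0 := hcon 1
  have c2 : hA F s K 0 * hA F t K 1 - hA F s K 1 * hA F t K 0 = 0 := hcon 2
  have key : ∀ x y : ℂ, (∀ i, x * hA F s K i + y * hA F t K i = 0) → x = 0 ∧ y = 0 := by
    intro x y hxy
    refine h.indep hS hs ht fun z => ?_
    obtain ⟨a, b, z, rfl⟩ := exists_coord_fr hd z
    rw [h.A_comb, h.B_comb, Fin.sum_univ_three, Fin.sum_univ_three]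
    linear_combination z 0 * hxy 0 + z 1 * hxy 1 + z 2 * hxy 2
  by_cases hA0 : ∀ i, hA F s K i = 0
  · exact one_ne_zero (key 1 0 (fun i => by rw [hA0]; ring)).1
  · push Not at hA0
    obtain ⟨i, hi⟩ := hA0
    have := (key (- hA F t K i) (hA F s K i) (fun l => by
      fin_cases i <;> fin_cases l <;> simp only [Fin.zero_eta, Fin.mk_one, Fin.reduceFinMk] <;>
      first | ring1 | linear_combination c0 | linear_combination c1 | linear_combination c2 |
        linear_combination -c0 | linear_combination -c1 | linear_combination -c2)).2
    exact hi this

theorem fdet_fr_perm (K K' : Fin 3 → E5) (M : Fin 3 → Fin 3 → ℂ) (hK : ∀ i, K' i = ∑ j, M i j • K j)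
    : fdet (fr s t K') = Matrix.det (Matrix.of M) * fdet (fr s t K) := by
  have h := vol_comb (s := s) (t := t) (K := K) ![0,0,0] ![0,0,0] (M 0) (M 1) (M 2)
  simp only [Matrix.cons_val_zero, Matrix.cons_val_one, Matrix.cons_val, zero_smul, zero_add, ← hK] at h
  rw [vol] at h
  rw [fr, h, Matrix.det_fin_three]
  simp only [Matrix.of_apply]
  ring

theorem Gam.exists_frame (hS : Smooth3 F) (h : Gam F s t) (hs : s ≠ 0) (ht : t ≠ 0) :
    ∃ k : Fin 3 → Fin 5, fdet (fr s t (fun i => bv (k i))) ≠ 0 ∧ hc F s t (fun i => bv (k i)) 0 ≠ 0 := by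
  obtain ⟨k, hk⟩ := exists_frame0 (h.li hS hs ht)
  obtain ⟨j, hj⟩ := h.exists_hc hS hs ht hk
  fin_cases j
  · exact ⟨k, hk, hj⟩
  · refine ⟨![k 1, k 0, k 2], ?_, ?_⟩
    · rw [fdet_fr_perm (fun i => bv (k i)) _ ![![0,1,0],![1,0,0],![0,0,1]]
        (by intro i; fin_cases i <;> simp [Fin.sum_univ_three])]
      refine mul_ne_zero ?_ hk
      simp [Matrix.det_fin_three]
    · intro h0; apply hj
      simp only [hc, cross_0, hA, Matrix.cons_val_zero, Matrix.cons_val_one, Matrix.cons_val, Fin.mk_one, cross_1] at h0 ⊢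
      linear_combination -h0
  · refine ⟨![k 2, k 1, k 0], ?_, ?_⟩
    · rw [fdet_fr_perm (fun i => bv (k i)) _ ![![0,0,1],![0,1,0],![1,0,0]]
        (by intro i; fin_cases i <;> simp [Fin.sum_univ_three])]
      refine mul_ne_zero ?_ hk
      simp [Matrix.det_fin_three]
    · intro h0; apply hj
      simp only [hc, cross_0, hA, Matrix.cons_val_zero, Matrix.cons_val_one, Matrix.cons_val, Fin.reduceFinMk, cross_2] at h0 ⊢
      linear_combination -h0

/-- good systems live on smooth cubics -/
theorem GoodQ.smooth {σ : ℂ} {g : E5 → E5 → ℂ} (h : GoodQ F σ g) : Smooth3 F := by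
  intro p hp
  by_contra h0
  obtain ⟨K, j, hd, -⟩ := h p p h0 h0 ⟨⟨hp, hp p, hp p⟩, fun K j => by
    have : fdet (fr p p K) = 0 := by
      by_contra hne
      have := ((fdet_ne_zero_iff _).1 hne).injective (a₁ := 0) (a₂ := 1) (by simp [fr])
      exact absurd this (by decide)
    rw [this, zero_mul]⟩
  have := ((fdet_ne_zero_iff _).1 hd).injective (a₁ := 0) (a₂ := 1) (by simp [fr])
  exact absurd this (by decide)

end CT

namespace CT

open Filter Topology

/-! ### conservation of number: topology -/

theorem conserve {T S M : Type*} [TopologicalSpace T] [TopologicalSpace S] [TopologicalSpace M] [CompactSpace S]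
    [T2Space M] (p : S → M) (hp : Continuous p) (Zc : Set (T × S)) (hZ : IsClosed Zc) (Z : T → Set M)
    (hZZ : ∀ τ, Z τ = p '' {s | (τ, s) ∈ Zc}) (τ0 : T)
    (hloc : ∀ z0 ∈ Z τ0, ∀ W ∈ 𝓝 z0, ∃ U ∈ 𝓝 z0, U ⊆ W ∧ ∀ᶠ τ in 𝓝 τ0, ∃! z, z ∈ U ∧ z ∈ Z τ) :
    (Z τ0).Finite ∧ ∀ᶠ τ in 𝓝 τ0, (Z τ).Finite ∧ (Z τ).ncard = (Z τ0).ncard := by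
  have hcomp : IsCompact (Z τ0) := by
    rw [hZZ]
    refine IsCompact.image ?_ hp
    exact (hZ.preimage (Continuous.prodMk_right τ0)).isCompact
  have hfin : (Z τ0).Finite := by
    choose! U hU _ hU3 using fun z0 hz0 => hloc z0 hz0 Set.univ Filter.univ_mem
    obtain ⟨F, hF1, hF2⟩ := hcomp.elim_nhds_subcover U hU
    have : Z τ0 ⊆ ⋃ x ∈ F, (U x ∩ Z τ0) := by
      intro z hz
      obtain ⟨x, hx, hzx⟩ := Set.mem_iUnion₂.1 (hF2 hz)
      exact Set.mem_iUnion₂.2 ⟨x, hx, hzx, hz⟩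
    refine Set.Finite.subset (Set.Finite.biUnion F.finite_toSet fun x hx => ?_) this
    refine Set.Subsingleton.finite ?_
    intro a ha b hb
    exact (hU3 x (hF1 x hx)).self_of_nhds.unique ha hb
  refine ⟨hfin, ?_⟩
  obtain ⟨D, hD1, hD2⟩ := hfin.t2_separation
  choose! U hU hUW hU3 using fun z0 (hz0 : z0 ∈ Z τ0) => hloc z0 hz0 (D z0) ((hD1 z0).2.mem_nhds (hD1 z0).1)
  have h1 : ∀ᶠ τ in 𝓝 τ0, ∀ z0 ∈ Z τ0, ∃! z, z ∈ U z0 ∧ z ∈ Z τ :=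
    (Filter.eventually_all_finite hfin).2 hU3
  have h2 : ∀ᶠ τ in 𝓝 τ0, Z τ ⊆ ⋃ z ∈ Z τ0, U z := by
    have hO : IsOpen (⋃ z ∈ Z τ0, interior (U z)) := isOpen_biUnion fun _ _ => isOpen_interior
    have hcl : IsClosed (Zc ∩ {q | p q.2 ∉ ⋃ z ∈ Z τ0, interior (U z)}) :=
      hZ.inter ((hO.preimage (hp.comp continuous_snd)).isClosed_compl)
    have hcl2 : IsClosed (Prod.fst '' (Zc ∩ {q | p q.2 ∉ ⋃ z ∈ Z τ0, interior (U z)})) :=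
      isClosedMap_fst_of_compactSpace _ hcl
    have hn : τ0 ∉ Prod.fst '' (Zc ∩ {q | p q.2 ∉ ⋃ z ∈ Z τ0, interior (U z)}) := by
      rintro ⟨⟨τ, s⟩, ⟨hq1, hq2⟩, rfl⟩
      apply hq2
      have hz : p s ∈ Z τ := by rw [hZZ]; exact ⟨s, hq1, rfl⟩
      exact Set.mem_iUnion₂.2 ⟨p s, hz, mem_interior_iff_mem_nhds.2 (hU _ hz)⟩
    filter_upwards [hcl2.isOpen_compl.mem_nhds hn] with τ hτ
    intro z hz
    rw [hZZ] at hz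
    obtain ⟨s, hs, rfl⟩ := hz
    by_contra hcon
    apply hτ
    refine ⟨(τ, s), ⟨hs, fun hmem => hcon ?_⟩, rfl⟩
    obtain ⟨x, hx, hx2⟩ := Set.mem_iUnion₂.1 hmem
    exact Set.mem_iUnion₂.2 ⟨x, hx, interior_subset hx2⟩
  filter_upwards [h1, h2] with τ e1 e2
  choose! f hf hfu using e1
  have hinj : Set.InjOn f (Z τ0) := by
    intro a ha b hb hab
    by_contra hne
    have := hD2 ha hb hne
    exact Set.disjoint_left.1 this (hUW a ha (hf a ha).1) (hab ▸ hUW b hb (hf b hb).1)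
  have himg : f '' (Z τ0) = Z τ := by
    apply Set.Subset.antisymm
    · rintro _ ⟨a, ha, rfl⟩; exact (hf a ha).2
    · intro z hz
      obtain ⟨x, hx, hx2⟩ := Set.mem_iUnion₂.1 (e2 hz)
      exact ⟨x, hx, (hfu x hx z ⟨hx2, hz⟩).symm⟩
  refine ⟨himg ▸ hfin.image f, ?_⟩
  rw [← himg, Set.ncard_image_of_injOn hinj]

/-! ### implicit functions -/

theorem ift_loc {V W : Type*} [NormedAddCommGroup V] [NormedSpace ℂ V] [FiniteDimensional ℂ V]
    [NormedAddCommGroup W] [NormedSpace ℂ W] [FiniteDimensional ℂ W]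
    (hdim : Module.finrank ℂ V = Module.finrank ℂ W) (Φ : ℂ × V → W) (hΦ : ContDiff ℂ 1 Φ) (τ0 : ℂ) (p0 : V)
    (h0 : Φ (τ0, p0) = 0) (hinj : ∀ v, fderiv ℂ Φ (τ0, p0) (0, v) = 0 → v = 0) (N : Set V) (hN : N ∈ 𝓝 p0) :
    ∃ N' ∈ 𝓝 p0, N' ⊆ N ∧ ∀ᶠ τ in 𝓝 τ0, ∃! p, p ∈ N' ∧ Φ (τ, p) = 0 := by
  haveI : CompleteSpace V := FiniteDimensional.complete ℂ V
  have hs : HasStrictFDerivAt Φ (fderiv ℂ Φ (τ0, p0)) (τ0, p0) :=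
    hΦ.contDiffAt.hasStrictFDerivAt (by norm_num)
  set G : ℂ × V → ℂ × W := fun q => (q.1, Φ q) with hG
  set A : ℂ × V →L[ℂ] ℂ × W := (ContinuousLinearMap.fst ℂ ℂ V).prod (fderiv ℂ Φ (τ0, p0)) with hA
  have hGs : HasStrictFDerivAt G A (τ0, p0) := hasStrictFDerivAt_fst.prodMk hs
  have hAinj : Function.Injective A.toLinearMap := by
    rw [← LinearMap.ker_eq_bot, LinearMap.ker_eq_bot']
    rintro ⟨a, v⟩ hav
    have h1 : a = 0 := congrArg Prod.fst hav
    have h2 : fderiv ℂ Φ (τ0, p0) (a, v) = 0 := congrArg Prod.snd hav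
    subst h1
    rw [hinj v h2]; rfl
  let e : (ℂ × V) ≃L[ℂ] (ℂ × W) :=
    (LinearEquiv.ofInjectiveOfFinrankEq A.toLinearMap hAinj (by simp [hdim])).toContinuousLinearEquiv
  have heA : (e : ℂ × V →L[ℂ] ℂ × W) = A := by ext <;> rfl
  have hGs' : HasStrictFDerivAt G (e : ℂ × V →L[ℂ] ℂ × W) (τ0, p0) := by rw [heA]; exact hGs
  haveI : CompleteSpace (ℂ × V) := inferInstance
  let H := hGs'.toOpenPartialHomeomorph G
  have hHc : (H : ℂ × V → ℂ × W) = G := hGs'.toOpenPartialHomeomorph_coe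
  have hsrc : H.source ∈ 𝓝 (τ0, p0) := H.open_source.mem_nhds hGs'.mem_toOpenPartialHomeomorph_source
  obtain ⟨T1, hT1, N1, hN1, hTN⟩ := mem_nhds_prod_iff.1 hsrc
  refine ⟨N ∩ N1, inter_mem hN hN1, Set.inter_subset_left, ?_⟩
  have hmap : Filter.map G (𝓝 (τ0, p0)) = 𝓝 (τ0, 0) := by
    have := hGs'.map_nhds_eq_of_equiv
    rw [this, hG]; simp [h0]
  have him : G '' (T1 ×ˢ (N ∩ N1)) ∈ 𝓝 (τ0, (0 : W)) := by
    rw [← hmap]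
    exact image_mem_map (prod_mem_nhds hT1 (inter_mem hN hN1))
  have hev : ∀ᶠ τ in 𝓝 τ0, (τ, (0 : W)) ∈ G '' (T1 ×ˢ (N ∩ N1)) :=
    (Continuous.prodMk_left (0 : W)).continuousAt.eventually him
  filter_upwards [hev, hT1] with τ h1 h2
  obtain ⟨⟨τ', q⟩, ⟨hq1, hq2⟩, hq3⟩ := h1
  have e1 : τ' = τ := congrArg Prod.fst hq3
  have e2 : Φ (τ', q) = 0 := congrArg Prod.snd hq3
  subst e1
  refine ⟨q, ⟨hq2, e2⟩, fun q' ⟨hq', hz'⟩ => ?_⟩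
  have : H (τ', q') = H (τ', q) := by rw [hHc, hG]; simp [e2, hz']
  have := H.injOn (hTN ⟨h2, hq'.2⟩) (hTN ⟨h2, hq2.2⟩) this
  exact congrArg Prod.snd this

/-! ### a model of projective space -/

open ComplexConjugate in
def prj (s : E5) : Fin 5 → Fin 5 → ℂ := fun i j => s i * conj (s j) / ∑ k, s k * conj (s k)

theorem nrm_ne_zero {s : E5} (hs : s ≠ 0) : (∑ k, s k * (starRingEnd ℂ) (s k)) ≠ 0 := by
  simp only [Complex.mul_conj]
  rw [← Complex.ofReal_sum]
  intro h
  rw [Complex.ofReal_eq_zero, Finset.sum_eq_zero_iff_of_nonneg (fun _ _ => Complex.normSq_nonneg _)] at h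
  exact hs (funext fun i => Complex.normSq_eq_zero.1 (h i (Finset.mem_univ i)))

theorem prj_smul {a : ℂ} (ha : a ≠ 0) (s : E5) : prj (a • s) = prj s := by
  funext i j
  simp only [prj, Pi.smul_apply, smul_eq_mul, map_mul]
  have e : ∑ k, a * s k * ((starRingEnd ℂ) a * (starRingEnd ℂ) (s k)) =
      (a * (starRingEnd ℂ) a) * ∑ k, s k * (starRingEnd ℂ) (s k) := by
    rw [Finset.mul_sum]; exact Finset.sum_congr rfl fun k _ => by ring
  rw [e]
  have ha' : (starRingEnd ℂ) a ≠ 0 := by simpa using ha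
  rw [show a * s i * ((starRingEnd ℂ) a * (starRingEnd ℂ) (s j)) =
    (a * (starRingEnd ℂ) a) * (s i * (starRingEnd ℂ) (s j)) by ring, mul_div_mul_left _ _ (mul_ne_zero ha ha')]

theorem prj_ratio {s : E5} {i : Fin 5} (hi : s i ≠ 0) (l : Fin 5) : prj s l i / prj s i i = s l / s i := by
  have hs : s ≠ 0 := fun h => hi (by rw [h]; rfl)
  have := nrm_ne_zero hs
  have hi' : (starRingEnd ℂ) (s i) ≠ 0 := by simpa using hi
  simp only [prj]
  field_simp

theorem prj_diag {s : E5} (hs : s ≠ 0) (i : Fin 5) : prj s i i ≠ 0 ↔ s i ≠ 0 := by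
  have := nrm_ne_zero hs
  simp [prj, this]

theorem prj_eq {s s' : E5} (hs : s ≠ 0) (hs' : s' ≠ 0) (h : prj s = prj s') : ∃ a : ℂ, a ≠ 0 ∧ s' = a • s := by
  obtain ⟨i, hi⟩ : ∃ i, s' i ≠ 0 := by
    by_contra hc; push Not at hc; exact hs' (funext hc)
  have hi2 : s i ≠ 0 := by rw [← prj_diag hs, h, prj_diag hs']; exact hi
  refine ⟨s' i / s i, div_ne_zero hi hi2, ?_⟩
  funext l
  have h1 := prj_ratio hi2 l
  rw [h, prj_ratio hi] at h1
  simp only [Pi.smul_apply, smul_eq_mul]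
  rw [div_eq_div_iff hi hi2] at h1
  field_simp
  linear_combination h1

theorem prj_continuousAt {s : E5} (hs : s ≠ 0) : ContinuousAt prj s := by
  rw [continuousAt_pi]; intro i
  rw [continuousAt_pi]; intro j
  unfold prj
  refine ContinuousAt.div ?_ ?_ (nrm_ne_zero hs)
  · exact ((continuous_apply i).mul (Complex.continuous_conj.comp (continuous_apply j))).continuousAt
  · exact (continuous_finsetSum _ fun k _ =>
      (continuous_apply k).mul (Complex.continuous_conj.comp (continuous_apply k))).continuousAt

/-- the zeros as points of a product of projective spaces -/
def Zset (F : Cub) (σ : ℂ) (g : E5 → E5 → ℂ) : Set ((Fin 5 → Fin 5 → ℂ) × (Fin 5 → Fin 5 → ℂ)) :=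
  {z | ∃ s t, s ≠ 0 ∧ t ≠ 0 ∧ Zer F s t σ g ∧ z = (prj s, prj t)}

end CT

namespace CT

open Filter Topology

section Smoothness
variable {V : Type*} [NormedAddCommGroup V] [NormedSpace ℂ V] {n : WithTop ℕ∞}

theorem ContDiff_tri {F : V → Cub} {x y z : V → E5} (hF : ContDiff ℂ n F) (hx : ContDiff ℂ n x)
    (hy : ContDiff ℂ n y) (hz : ContDiff ℂ n z) : ContDiff ℂ n fun v => tri (F v) (x v) (y v) (z v) := by
  unfold tri
  refine ContDiff.sum fun i _ => ContDiff.sum fun j _ => ContDiff.sum fun k _ => ?_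
  exact (((contDiff_pi.1 hF _).mul (contDiff_pi.1 hx i)).mul (contDiff_pi.1 hy j)).mul (contDiff_pi.1 hz k)

theorem ContDiff_fdet {m : V → Fin 5 → E5} (hm : ∀ i, ContDiff ℂ n fun v => m v i) :
    ContDiff ℂ n fun v => fdet (m v) := by
  unfold fdet
  simp only [Matrix.det_apply, Matrix.of_apply]
  refine ContDiff.sum fun σ _ => ContDiff.const_smul _ ?_
  exact contDiff_prod fun i _ => contDiff_pi.1 (hm _) _

variable {F : V → Cub} {s t : V → E5} {K : V → Fin 3 → E5}

theorem ContDiff_hA (hF : ContDiff ℂ n F) (hs : ContDiff ℂ n s) (ht : ContDiff ℂ n t)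
    (hK : ∀ i, ContDiff ℂ n fun v => K v i) (i : Fin 3) : ContDiff ℂ n fun v => hA (F v) (s v) (K v) i :=
  ContDiff_tri hF hs hs (hK i)

theorem ContDiff_hc (hF : ContDiff ℂ n F) (hs : ContDiff ℂ n s) (ht : ContDiff ℂ n t)
    (hK : ∀ i, ContDiff ℂ n fun v => K v i) (i : Fin 3) : ContDiff ℂ n fun v => hc (F v) (s v) (t v) (K v) i := by
  have h1 := ContDiff_hA hF hs ht hK
  have h2 := ContDiff_hA hF ht ht hK
  fin_cases i
  · exact ((h1 1).mul (h2 2)).sub ((h1 2).mul (h2 1))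
  · exact ((h1 2).mul (h2 0)).sub ((h1 0).mul (h2 2))
  · exact ((h1 0).mul (h2 1)).sub ((h1 1).mul (h2 0))

theorem ContDiff_cK (hF : ContDiff ℂ n F) (hs : ContDiff ℂ n s) (ht : ContDiff ℂ n t)
    (hK : ∀ i, ContDiff ℂ n fun v => K v i) : ContDiff ℂ n fun v => cK (F v) (s v) (t v) (K v) := by
  unfold cK
  exact ContDiff.sum fun i _ => (ContDiff_hc hF hs ht hK i).smul (hK i)

theorem ContDiff_uK (hF : ContDiff ℂ n F) (hs : ContDiff ℂ n s) (ht : ContDiff ℂ n t)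
    (hK : ∀ i, ContDiff ℂ n fun v => K v i) : ContDiff ℂ n fun v => uK (F v) (s v) (t v) (K v) :=
  ContDiff_tri hF hs (ContDiff_cK hF hs ht hK) (ContDiff_cK hF hs ht hK)

theorem ContDiff_wK (hF : ContDiff ℂ n F) (hs : ContDiff ℂ n s) (ht : ContDiff ℂ n t)
    (hK : ∀ i, ContDiff ℂ n fun v => K v i) : ContDiff ℂ n fun v => wK (F v) (s v) (t v) (K v) :=
  ContDiff_tri hF ht (ContDiff_cK hF hs ht hK) (ContDiff_cK hF hs ht hK)

theorem ContDiff_eK (hF : ContDiff ℂ n F) (hs : ContDiff ℂ n s) (ht : ContDiff ℂ n t)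
    (hK : ∀ i, ContDiff ℂ n fun v => K v i) (i : Fin 3) : ContDiff ℂ n fun v => eK (F v) (s v) (t v) (K v) i :=
  ((ContDiff_wK hF hs ht hK).mul (ContDiff_tri hF hs (ContDiff_cK hF hs ht hK) (hK i))).sub
    ((ContDiff_uK hF hs ht hK).mul (ContDiff_tri hF ht (ContDiff_cK hF hs ht hK) (hK i)))

theorem ContDiff_mK (hF : ContDiff ℂ n F) (hs : ContDiff ℂ n s) (ht : ContDiff ℂ n t)
    (hK : ∀ i, ContDiff ℂ n fun v => K v i) (i : Fin 3) : ContDiff ℂ n fun v => mK (F v) (s v) (t v) (K v) i :=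
  (((ContDiff_uK hF hs ht hK).pow 2).mul (ContDiff_hA hF ht ht hK i)).add
    (((ContDiff_wK hF hs ht hK).pow 2).mul (ContDiff_hA hF hs ht hK i))

theorem ContDiff_RK (hF : ContDiff ℂ n F) (hs : ContDiff ℂ n s) (ht : ContDiff ℂ n t)
    (hK : ∀ i, ContDiff ℂ n fun v => K v i) (i : Fin 3) : ContDiff ℂ n fun v => RK (F v) (s v) (t v) (K v) i := by
  have he := ContDiff_eK hF hs ht hK
  have hm := ContDiff_mK hF hs ht hK
  have hc := ContDiff_cK hF hs ht hK
  refine ContDiff.sub ?_ ((((((ContDiff_uK hF hs ht hK).mul (ContDiff_wK hF hs ht hK)).mul contDiff_const)).mul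
    (ContDiff_tri hF hc hc hc)).mul (ContDiff_hc hF hs ht hK i))
  fin_cases i
  · exact ((he 1).mul (hm 2)).sub ((he 2).mul (hm 1))
  · exact ((he 2).mul (hm 0)).sub ((he 0).mul (hm 2))
  · exact ((he 0).mul (hm 1)).sub ((he 1).mul (hm 0))


theorem ContDiff_fr (hF : ContDiff ℂ n F) (hs : ContDiff ℂ n s) (ht : ContDiff ℂ n t)
    (hK : ∀ i, ContDiff ℂ n fun v => K v i) : ContDiff ℂ n fun v => fdet (fr (s v) (t v) (K v)) := by
  refine ContDiff_fdet fun i => ?_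
  fin_cases i
  · exact hs
  · exact ht
  · exact hK 0
  · exact hK 1
  · exact hK 2

theorem ContDiff_Eqn {σ : V → ℂ} {g : V → E5 → E5 → ℂ} (hF : ContDiff ℂ n F) (hs : ContDiff ℂ n s) (ht : ContDiff ℂ n t)
    (hK : ∀ i, ContDiff ℂ n fun v => K v i) (hσ : ContDiff ℂ n σ)
    (hg : ContDiff ℂ n fun v => g v (s v) (t v)) (i : Fin 3) :
    ContDiff ℂ n fun v => Eqn (F v) (s v) (t v) (K v) (σ v) (g v) i :=
  (hσ.mul (ContDiff_RK hF hs ht hK i)).add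
    ((((ContDiff_fr hF hs ht hK).pow 7).mul hg).mul (ContDiff_hc hF hs ht hK i))

end Smoothness

theorem hasDerivAt_tri (F : Cub) {x y z : ℂ → E5} {x' y' z' : E5} {ε : ℂ} (hx : HasDerivAt x x' ε)
    (hy : HasDerivAt y y' ε) (hz : HasDerivAt z z' ε) :
    HasDerivAt (fun ε => tri F (x ε) (y ε) (z ε)) (tri F x' (y ε) (z ε) + tri F (x ε) y' (z ε) + tri F (x ε) (y ε) z') ε := by
  unfold tri
  simp only [← Finset.sum_add_distrib]
  refine HasDerivAt.fun_sum fun i _ => HasDerivAt.fun_sum fun j _ => HasDerivAt.fun_sum fun k _ => ?_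
  have h1 := (((hasDerivAt_pi.1 hx i).const_mul (F (mk3 i j k))).fun_mul (hasDerivAt_pi.1 hy j)).fun_mul (hasDerivAt_pi.1 hz k)
  refine h1.congr_deriv ?_
  ring

/-- a polynomial-like one-parameter family of systems -/
structure Fam where
  F : ℂ → Cub
  σ : ℂ → ℂ
  g : ℂ → E5 → E5 → ℂ
  hF : ContDiff ℂ 1 F
  hσ : ContDiff ℂ 1 σ
  hg : ContDiff ℂ 1 fun q : ℂ × E5 × E5 => g q.1 q.2.1 q.2.2
  hom : ∀ τ, HomG (σ τ) (g τ)

namespace Fam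
variable (A : Fam)

def Eq (K : Fin 3 → E5) (j : Fin 3) (q : ℂ × E5 × E5) : ℂ := Eqn (A.F q.1) q.2.1 q.2.2 K (A.σ q.1) (A.g q.1) j

theorem cdEq (K : Fin 3 → E5) (j : Fin 3) : ContDiff ℂ 1 (A.Eq K j) := by
  have h1 : ContDiff ℂ 1 fun q : ℂ × E5 × E5 => A.F q.1 := A.hF.comp contDiff_fst
  have h2 : ContDiff ℂ 1 fun q : ℂ × E5 × E5 => q.2.1 := contDiff_fst.comp contDiff_snd
  have h3 : ContDiff ℂ 1 fun q : ℂ × E5 × E5 => q.2.2 := contDiff_snd.comp contDiff_snd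
  have h4 : ContDiff ℂ 1 fun q : ℂ × E5 × E5 => A.σ q.1 := A.hσ.comp contDiff_fst
  exact ContDiff_Eqn (V := ℂ × E5 × E5) (F := fun q => A.F q.1) (s := fun q => q.2.1) (t := fun q => q.2.2)
    (K := fun _ => K) (σ := fun q => A.σ q.1) (g := fun q => A.g q.1) h1 h2 h3 (fun _ => contDiff_const) h4 A.hg j

def Phi (K : Fin 3 → E5) (j : Fin 3) (i i' : Fin 5) (c d : ℂ) (q : ℂ × E5 × E5) :
    (Fin 5 → ℂ) × ℂ × ℂ × ℂ × ℂ × ℂ :=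
  (fun k => tri (A.F q.1) q.2.1 q.2.2 (bv k), tri (A.F q.1) q.2.1 q.2.1 q.2.1, tri (A.F q.1) q.2.2 q.2.2 q.2.2,
    A.Eq K j q, q.2.1 i - c, q.2.2 i' - d)

theorem cdPhi (K : Fin 3 → E5) (j : Fin 3) (i i' : Fin 5) (c d : ℂ) : ContDiff ℂ 1 (A.Phi K j i i' c d) := by
  have h1 : ContDiff ℂ 1 fun q : ℂ × E5 × E5 => A.F q.1 := A.hF.comp contDiff_fst
  have h2 : ContDiff ℂ 1 fun q : ℂ × E5 × E5 => q.2.1 := contDiff_fst.comp contDiff_snd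
  have h3 : ContDiff ℂ 1 fun q : ℂ × E5 × E5 => q.2.2 := contDiff_snd.comp contDiff_snd
  refine ContDiff.prodMk (contDiff_pi.2 fun k => ContDiff_tri h1 h2 h3 contDiff_const) ?_
  refine ContDiff.prodMk (ContDiff_tri h1 h2 h2 h2) (ContDiff.prodMk (ContDiff_tri h1 h3 h3 h3) ?_)
  refine ContDiff.prodMk (A.cdEq K j) (ContDiff.prodMk ?_ ?_)
  · exact (contDiff_pi.1 h2 i).sub contDiff_const
  · exact (contDiff_pi.1 h3 i').sub contDiff_const

theorem hasDeriv_line (s s' : E5) : HasDerivAt (fun ε : ℂ => s + ε • s') s' 0 := by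
  have := ((hasDerivAt_id (0 : ℂ)).smul_const s').const_add s
  simpa using this

theorem hasDeriv_Eq (K : Fin 3 → E5) (j : Fin 3) (τ : ℂ) (s t s' t' : E5) :
    HasDerivAt (fun ε : ℂ => Eqn (A.F τ) (s + ε • s') (t + ε • t') K (A.σ τ) (A.g τ) j)
      (fderiv ℂ (A.Eq K j) (τ, s, t) (0, s', t')) 0 := by
  have hl : HasDerivAt (fun ε : ℂ => ((τ, s + ε • s', t + ε • t') : ℂ × E5 × E5)) (0, s', t') 0 :=
    (hasDerivAt_const 0 τ).prodMk ((hasDeriv_line s s').prodMk (hasDeriv_line t t'))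
  have hd : HasFDerivAt (A.Eq K j) (fderiv ℂ (A.Eq K j) (τ, s, t)) (τ, s + (0:ℂ) • s', t + (0:ℂ) • t') := by
    simpa using ((A.cdEq K j).differentiable (by norm_num) (τ, s, t)).hasFDerivAt
  exact hd.comp_hasDerivAt (0 : ℂ) hl

theorem fderiv_Phi (K : Fin 3 → E5) (j : Fin 3) (i i' : Fin 5) (c d τ : ℂ) (s t s' t' : E5) :
    fderiv ℂ (A.Phi K j i i' c d) (τ, s, t) (0, s', t') =
      (fun k => tri (A.F τ) s' t (bv k) + tri (A.F τ) s t' (bv k), 3 * tri (A.F τ) s s s', 3 * tri (A.F τ) t t t',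
        deriv (fun ε : ℂ => Eqn (A.F τ) (s + ε • s') (t + ε • t') K (A.σ τ) (A.g τ) j) 0, s' i, t' i') := by
  have hl : HasDerivAt (fun ε : ℂ => ((τ, s + ε • s', t + ε • t') : ℂ × E5 × E5)) (0, s', t') 0 :=
    (hasDerivAt_const 0 τ).prodMk ((hasDeriv_line s s').prodMk (hasDeriv_line t t'))
  have hd : HasFDerivAt (A.Phi K j i i' c d) (fderiv ℂ (A.Phi K j i i' c d) (τ, s, t)) (τ, s + (0:ℂ) • s', t + (0:ℂ) • t') := by
    simpa using ((A.cdPhi K j i i' c d).differentiable (by norm_num) (τ, s, t)).hasFDerivAt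
  have h1 := hd.comp_hasDerivAt (0 : ℂ) hl
  have h2 : HasDerivAt (A.Phi K j i i' c d ∘ fun ε : ℂ => ((τ, s + ε • s', t + ε • t') : ℂ × E5 × E5))
      (fun k => tri (A.F τ) s' t (bv k) + tri (A.F τ) s t' (bv k), 3 * tri (A.F τ) s s s', 3 * tri (A.F τ) t t t',
        deriv (fun ε : ℂ => Eqn (A.F τ) (s + ε • s') (t + ε • t') K (A.σ τ) (A.g τ) j) 0, s' i, t' i') 0 := by
    refine HasDerivAt.prodMk (hasDerivAt_pi.2 fun k => ?_) (HasDerivAt.prodMk ?_ (HasDerivAt.prodMk ?_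
      (HasDerivAt.prodMk ?_ (HasDerivAt.prodMk ?_ ?_))))
    · refine (hasDerivAt_tri (A.F τ) (hasDeriv_line s s') (hasDeriv_line t t') (hasDerivAt_const 0 (bv k))).congr_deriv ?_
      simp [tri_zero3]
    · refine (hasDerivAt_tri (A.F τ) (hasDeriv_line s s') (hasDeriv_line s s') (hasDeriv_line s s')).congr_deriv ?_
      simp only [zero_smul, add_zero]
      rw [tri_comm13 _ s' s s, tri_comm23 _ s s' s]; ring
    · refine (hasDerivAt_tri (A.F τ) (hasDeriv_line t t') (hasDeriv_line t t') (hasDeriv_line t t')).congr_deriv ?_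
      simp only [zero_smul, add_zero]
      rw [tri_comm13 _ t' t t, tri_comm23 _ t t' t]; ring
    · exact (A.hasDeriv_Eq K j τ s t s' t').differentiableAt.hasDerivAt
    · exact (hasDerivAt_pi.1 (hasDeriv_line s s') i).sub_const c
    · exact (hasDerivAt_pi.1 (hasDeriv_line t t') i').sub_const d
  exact h1.unique h2

theorem tri_all {F : Cub} {x y : E5} (h : ∀ k, tri F x y (bv k) = 0) (z : E5) : tri F x y z = 0 := by
  rw [vec_eq_sum z, tri_sum3]
  refine Finset.sum_eq_zero fun i _ => ?_
  rw [tri_smul3, h, mul_zero]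

theorem tan_iff (F : Cub) (s t s' t' : E5) : Tan F s t s' t' ↔
    (∀ k, tri F s' t (bv k) + tri F s t' (bv k) = 0) ∧ tri F s s s' = 0 ∧ tri F t t t' = 0 := by
  constructor
  · intro h; exact ⟨fun k => h.1 _, h.2⟩
  · rintro ⟨h, h2⟩
    refine ⟨fun x => ?_, h2⟩
    rw [vec_eq_sum x, tri_sum3, tri_sum3, ← Finset.sum_add_distrib]
    refine Finset.sum_eq_zero fun i _ => ?_
    rw [tri_smul3, tri_smul3, ← mul_add, h, mul_zero]

/-- injectivity from nondegeneracy in a frame -/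
theorem inj_of_nondeg {K : Fin 3 → E5} {j : Fin 3} {i i' : Fin 5} {τ : ℂ} {s t : E5} (hi : s i ≠ 0) (hi' : t i' ≠ 0)
    (h : ∀ s' t', Tan (A.F τ) s t s' t' →
      deriv (fun ε : ℂ => Eqn (A.F τ) (s + ε • s') (t + ε • t') K (A.σ τ) (A.g τ) j) 0 = 0 →
      ∃ a b : ℂ, s' = a • s ∧ t' = b • t) (c d : ℂ) (v : E5 × E5)
    (hv : fderiv ℂ (A.Phi K j i i' c d) (τ, s, t) (0, v) = 0) : v = 0 := by
  obtain ⟨s', t'⟩ := v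
  rw [A.fderiv_Phi] at hv
  simp only [Prod.mk_eq_zero] at hv
  obtain ⟨h1, h2, h3, h4, h5, h6⟩ := hv
  have h2' : tri (A.F τ) s s s' = 0 := (mul_eq_zero.1 h2).resolve_left (by norm_num)
  have h3' : tri (A.F τ) t t t' = 0 := (mul_eq_zero.1 h3).resolve_left (by norm_num)
  obtain ⟨a, b, rfl, rfl⟩ := h s' t' ((tan_iff _ _ _ _ _).2 ⟨fun k => congrFun h1 k, h2', h3'⟩) h4
  have ha : a = 0 := by simpa [hi] using h5
  have hb : b = 0 := by simpa [hi'] using h6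
  simp [ha, hb]

theorem euler {K : Fin 3 → E5} {j : Fin 3} {τ : ℂ} {s t : E5}
    (h : Eqn (A.F τ) s t K (A.σ τ) (A.g τ) j = 0) (a b : ℂ) :
    deriv (fun ε : ℂ => Eqn (A.F τ) (s + ε • (a • s)) (t + ε • (b • t)) K (A.σ τ) (A.g τ) j) 0 = 0 := by
  obtain ⟨N, hN⟩ := Eqn_smul (A.hom τ)
  have : (fun ε : ℂ => Eqn (A.F τ) (s + ε • (a • s)) (t + ε • (b • t)) K (A.σ τ) (A.g τ) j) = fun _ => 0 := by
    funext ε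
    rw [show s + ε • (a • s) = (1 + ε * a) • s by module, show t + ε • (b • t) = (1 + ε * b) • t by module, hN, h,
      mul_zero]
  rw [this]; simp

theorem nondeg_of_inj {K : Fin 3 → E5} {j : Fin 3} {i i' : Fin 5} {τ : ℂ} {s t : E5} (hi : s i ≠ 0) (hi' : t i' ≠ 0)
    (hG : Gam (A.F τ) s t) (hE : Eqn (A.F τ) s t K (A.σ τ) (A.g τ) j = 0) (c d : ℂ)
    (h : ∀ v : E5 × E5, fderiv ℂ (A.Phi K j i i' c d) (τ, s, t) (0, v) = 0 → v = 0) (s' t' : E5)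
    (ht : Tan (A.F τ) s t s' t')
    (hd : deriv (fun ε : ℂ => Eqn (A.F τ) (s + ε • s') (t + ε • t') K (A.σ τ) (A.g τ) j) 0 = 0) :
      ∃ a b : ℂ, s' = a • s ∧ t' = b • t := by
  refine ⟨s' i / s i, t' i' / t i', ?_⟩
  set a := s' i / s i with ha
  set b := t' i' / t i' with hb
  have h1 := A.fderiv_Phi K j i i' c d τ s t s' t'
  have h2 := A.fderiv_Phi K j i i' c d τ s t (a • s) (b • t)
  have h3 := h (s' - a • s, t' - b • t) (by
    have e : ((0 : ℂ), (s' - a • s, t' - b • t)) = (0, s', t') - (0, a • s, b • t) := by simp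
    rw [e, map_sub, h1, h2, A.euler hE, hd]
    have e1 : (fun k => tri (A.F τ) s' t (bv k) + tri (A.F τ) s t' (bv k)) = 0 := funext fun k => ht.1 _
    have e2 : (fun k => tri (A.F τ) (a • s) t (bv k) + tri (A.F τ) s (b • t) (bv k)) = 0 := by
      funext k; simp [tri_smul1, tri_smul2, hG.1]
    rw [e1, e2, ht.2.1, ht.2.2, tri_smul3, tri_smul3, hG.2.1, hG.2.2]
    simp [ha, hb, hi, hi'])
  rw [Prod.mk_eq_zero, sub_eq_zero, sub_eq_zero] at h3
  exact h3

end Fam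

end CT

namespace CT

open Filter Topology

namespace Fam
variable (A : Fam)

theorem Phi_zero_iff (K : Fin 3 → E5) (j : Fin 3) (i i' : Fin 5) (c d τ : ℂ) (s t : E5) :
    A.Phi K j i i' c d (τ, s, t) = 0 ↔ Gam (A.F τ) s t ∧ Eqn (A.F τ) s t K (A.σ τ) (A.g τ) j = 0 ∧ s i = c ∧ t i' = d := by
  simp only [Phi, Prod.mk_eq_zero, sub_eq_zero, Eq]
  constructor
  · rintro ⟨h1, h2, h3, h4, h5, h6⟩
    exact ⟨⟨tri_all (fun k => congrFun h1 k), h2, h3⟩, h4, h5, h6⟩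
  · rintro ⟨⟨h1, h2, h3⟩, h4, h5, h6⟩
    exact ⟨funext fun k => h1 _, h2, h3, h4, h5, h6⟩

theorem closed_zer : IsClosed {q : ℂ × E5 × E5 | Zer (A.F q.1) q.2.1 q.2.2 (A.σ q.1) (A.g q.1)} := by
  have h1 : ContDiff ℂ 1 fun q : ℂ × E5 × E5 => A.F q.1 := A.hF.comp contDiff_fst
  have h2 : ContDiff ℂ 1 fun q : ℂ × E5 × E5 => q.2.1 := contDiff_fst.comp contDiff_snd
  have h3 : ContDiff ℂ 1 fun q : ℂ × E5 × E5 => q.2.2 := contDiff_snd.comp contDiff_snd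
  simp only [Zer, Gam, Set.ofPred_and, Set.ofPred_forall]
  refine IsClosed.inter (IsClosed.inter (isClosed_iInter fun x => ?_) (IsClosed.inter ?_ ?_))
    (isClosed_iInter fun K => isClosed_iInter fun j => ?_)
  · exact isClosed_eq (ContDiff_tri h1 h2 h3 contDiff_const).continuous continuous_const
  · exact isClosed_eq (ContDiff_tri h1 h2 h2 h2).continuous continuous_const
  · exact isClosed_eq (ContDiff_tri h1 h3 h3 h3).continuous continuous_const
  · refine isClosed_eq (Continuous.mul ?_ (A.cdEq K j).continuous) continuous_const
    exact (ContDiff_fr (K := fun _ => K) h1 h2 h3 fun _ => contDiff_const).continuous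

theorem finrank_eq : Module.finrank ℂ (E5 × E5) = Module.finrank ℂ ((Fin 5 → ℂ) × ℂ × ℂ × ℂ × ℂ × ℂ) := by
  simp [E5]

theorem ex_ne {s : E5} (hs : s ≠ 0) : ∃ i, s i ≠ 0 := by
  by_contra hc; push Not at hc; exact hs (funext hc)

theorem ev_frame {K : Fin 3 → E5} {j : Fin 3} {τ0 : ℂ} {s0 t0 : E5} (hd : fdet (fr s0 t0 K) ≠ 0)
    (hj : hc (A.F τ0) s0 t0 K j ≠ 0) :
    ∀ᶠ q : ℂ × E5 × E5 in 𝓝 (τ0, s0, t0), fdet (fr q.2.1 q.2.2 K) ≠ 0 ∧ hc (A.F q.1) q.2.1 q.2.2 K j ≠ 0 := by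
  have h1 : ContDiff ℂ 1 fun q : ℂ × E5 × E5 => A.F q.1 := A.hF.comp contDiff_fst
  have h2 : ContDiff ℂ 1 fun q : ℂ × E5 × E5 => q.2.1 := contDiff_fst.comp contDiff_snd
  have h3 : ContDiff ℂ 1 fun q : ℂ × E5 × E5 => q.2.2 := contDiff_snd.comp contDiff_snd
  have e1 : Continuous fun q : ℂ × E5 × E5 => fdet (fr q.2.1 q.2.2 K) :=
    (ContDiff_fr (F := fun q : ℂ × E5 × E5 => A.F q.1) (s := fun q => q.2.1) (t := fun q => q.2.2)
      (K := fun _ => K) h1 h2 h3 fun _ => contDiff_const).continuous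
  have e2 : Continuous fun q : ℂ × E5 × E5 => hc (A.F q.1) q.2.1 q.2.2 K j :=
    (ContDiff_hc (F := fun q : ℂ × E5 × E5 => A.F q.1) (s := fun q => q.2.1) (t := fun q => q.2.2)
      (K := fun _ => K) h1 h2 h3 (fun _ => contDiff_const) j).continuous
  have e3 := e1.continuousAt.eventually_ne (x := (τ0, s0, t0)) hd
  have e4 := e2.continuousAt.eventually_ne (x := (τ0, s0, t0)) hj
  exact e3.and e4

theorem hloc (τ0 : ℂ) (hG : GoodQ (A.F τ0) (A.σ τ0) (A.g τ0)) :
    ∀ z0 ∈ Zset (A.F τ0) (A.σ τ0) (A.g τ0), ∀ W ∈ 𝓝 z0, ∃ U ∈ 𝓝 z0, U ⊆ W ∧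
      ∀ᶠ τ in 𝓝 τ0, ∃! z, z ∈ U ∧ z ∈ Zset (A.F τ) (A.σ τ) (A.g τ) := by
  rintro _ ⟨s0, t0, hs0, ht0, hz0, rfl⟩ W hW
  obtain ⟨K, j, hd, hj, hnd⟩ := hG s0 t0 hs0 ht0 hz0
  obtain ⟨i, hi⟩ := ex_ne hs0
  obtain ⟨i', hi'⟩ := ex_ne ht0
  have hE0 : Eqn (A.F τ0) s0 t0 K (A.σ τ0) (A.g τ0) j = 0 := (mul_eq_zero.1 (hz0.2 K j)).resolve_left hd
  have hprj : ContinuousAt (fun p : E5 × E5 => (prj p.1, prj p.2)) (s0, t0) := by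
    refine ContinuousAt.prodMk ?_ ?_
    · exact ContinuousAt.comp (g := prj) (prj_continuousAt hs0) continuousAt_fst
    · exact ContinuousAt.comp (g := prj) (prj_continuousAt ht0) continuousAt_snd
  obtain ⟨T, hT, N, hN, hTN⟩ := mem_nhds_prod_iff.1 (A.ev_frame hd hj)
  have hN2 : N ∩ (fun p : E5 × E5 => (prj p.1, prj p.2)) ⁻¹' W ∈ 𝓝 (s0, t0) := inter_mem hN (hprj hW)
  obtain ⟨N', hN', hsub, hev⟩ := ift_loc finrank_eq (A.Phi K j i i' (s0 i) (t0 i')) (A.cdPhi K j i i' _ _) τ0 (s0, t0)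
    ((A.Phi_zero_iff _ _ _ _ _ _ _ _ _).2 ⟨hz0.1, hE0, rfl, rfl⟩)
    (fun v hv => A.inj_of_nondeg hi hi' hnd _ _ v hv) _ hN2
  set sec : (Fin 5 → Fin 5 → ℂ) × (Fin 5 → Fin 5 → ℂ) → E5 × E5 := fun z =>
    (fun l => s0 i * (z.1 l i / z.1 i i), fun l => t0 i' * (z.2 l i' / z.2 i' i')) with hsec
  have hsecp : ∀ s t : E5, s i ≠ 0 → t i' ≠ 0 → sec (prj s, prj t) = ((s0 i / s i) • s, (t0 i' / t i') • t) := by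
    intro s t h1 h2
    simp only [hsec, prj_ratio h1, prj_ratio h2]
    refine Prod.ext (funext fun l => ?_) (funext fun l => ?_) <;> simp <;> ring
  have hd1 : prj s0 i i ≠ 0 := (prj_diag hs0 i).2 hi
  have hd2 : prj t0 i' i' ≠ 0 := (prj_diag ht0 i').2 hi'
  have c1 : ∀ l k, Continuous fun z : (Fin 5 → Fin 5 → ℂ) × (Fin 5 → Fin 5 → ℂ) => z.1 l k := fun l k => by fun_prop
  have c2 : ∀ l k, Continuous fun z : (Fin 5 → Fin 5 → ℂ) × (Fin 5 → Fin 5 → ℂ) => z.2 l k := fun l k => by fun_prop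
  have hcs : ContinuousAt sec (prj s0, prj t0) := by
    refine ContinuousAt.prodMk (continuousAt_pi.2 fun l => ?_) (continuousAt_pi.2 fun l => ?_)
    · exact continuousAt_const.mul ((c1 l i).continuousAt.div (c1 i i).continuousAt hd1)
    · exact continuousAt_const.mul ((c2 l i').continuousAt.div (c2 i' i').continuousAt hd2)
  have hs00 : sec (prj s0, prj t0) = (s0, t0) := by
    rw [hsecp s0 t0 hi hi', div_self hi, div_self hi', one_smul, one_smul]
  refine ⟨W ∩ ({z | z.1 i i ≠ 0} ∩ {z | z.2 i' i' ≠ 0} ∩ sec ⁻¹' N'), ?_, Set.inter_subset_left, ?_⟩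
  · refine inter_mem hW (inter_mem (inter_mem ?_ ?_) (hcs (by rw [hs00]; exact hN')))
    · exact (c1 i i).continuousAt.eventually_ne hd1
    · exact (c2 i' i').continuousAt.eventually_ne hd2
  · filter_upwards [hev, hT] with τ hτ hτT
    obtain ⟨⟨s, t⟩, ⟨hst, hphi⟩, huniq⟩ := hτ
    rw [A.Phi_zero_iff] at hphi
    obtain ⟨hG1, hE1, e1, e2⟩ := hphi
    have hsi : s i ≠ 0 := by rw [e1]; exact hi
    have hti : t i' ≠ 0 := by rw [e2]; exact hi'
    have hs : s ≠ 0 := fun h => hsi (by rw [h]; rfl)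
    have ht : t ≠ 0 := fun h => hti (by rw [h]; rfl)
    have hf := hTN (Set.mk_mem_prod hτT (hsub hst).1)
    refine ⟨(prj s, prj t), ⟨⟨(hsub hst).2, ⟨(prj_diag hs i).2 hsi, (prj_diag ht i').2 hti⟩, ?_⟩, s, t, hs, ht,
      zer_of_frame hG1 hf.1 hf.2 hE1, rfl⟩, ?_⟩
    · change sec (prj s, prj t) ∈ N'
      rw [hsecp s t hsi hti, e1, e2, div_self hi, div_self hi', one_smul, one_smul]; exact hst
    · rintro _ ⟨⟨-, ⟨h1, h2⟩, h3⟩, s', t', hs', ht', hz', rfl⟩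
      have hsi' : s' i ≠ 0 := (prj_diag hs' i).1 h1
      have hti' : t' i' ≠ 0 := (prj_diag ht' i').1 h2
      change sec (prj s', prj t') ∈ N' at h3
      rw [hsecp s' t' hsi' hti'] at h3
      have hf' := hTN (Set.mk_mem_prod hτT (hsub h3).1)
      have hz2 := hz'.smul (A.hom τ) (s0 i / s' i) (t0 i' / t' i')
      have := huniq _ ⟨h3, (A.Phi_zero_iff _ _ _ _ _ _ _ _ _).2 ⟨hz2.1, (mul_eq_zero.1 (hz2.2 K j)).resolve_left hf'.1,
        by simp [hsi'], by simp [hti']⟩⟩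
      rw [Prod.mk.injEq] at this
      rw [← this.1, ← this.2, prj_smul (div_ne_zero hi hsi'), prj_smul (div_ne_zero hi' hti')]

abbrev Sph : Type := Metric.sphere (0 : E5) 1

theorem sph_ne (s : Sph) : s.1 ≠ 0 := by
  intro h
  have := s.2
  rw [h] at this
  simp at this

theorem exists_sph {s : E5} (hs : s ≠ 0) : ∃ (a : ℂ) (s' : Sph), a ≠ 0 ∧ s'.1 = a • s := by
  have hn : (‖s‖ : ℂ) ≠ 0 := by simpa using hs
  refine ⟨(‖s‖ : ℂ)⁻¹, ⟨(‖s‖ : ℂ)⁻¹ • s, ?_⟩, inv_ne_zero hn, rfl⟩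
  simp [norm_smul, hs]

theorem local_const (τ0 : ℂ) (hG : GoodQ (A.F τ0) (A.σ τ0) (A.g τ0)) :
    (Zset (A.F τ0) (A.σ τ0) (A.g τ0)).Finite ∧ ∀ᶠ τ in 𝓝 τ0, (Zset (A.F τ) (A.σ τ) (A.g τ)).Finite ∧
      (Zset (A.F τ) (A.σ τ) (A.g τ)).ncard = (Zset (A.F τ0) (A.σ τ0) (A.g τ0)).ncard := by
  refine conserve (S := Sph × Sph) (fun p => (prj p.1.1, prj p.2.1)) ?_
    {q | Zer (A.F q.1) q.2.1.1 q.2.2.1 (A.σ q.1) (A.g q.1)} ?_ (fun τ => Zset (A.F τ) (A.σ τ) (A.g τ)) ?_ τ0 (A.hloc τ0 hG)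
  · rw [continuous_iff_continuousAt]
    rintro ⟨s, t⟩
    refine ContinuousAt.prodMk ?_ ?_
    · exact ContinuousAt.comp (g := prj) (prj_continuousAt (sph_ne s)) (continuous_subtype_val.comp continuous_fst).continuousAt
    · exact ContinuousAt.comp (g := prj) (prj_continuousAt (sph_ne t)) (continuous_subtype_val.comp continuous_snd).continuousAt
  · exact A.closed_zer.preimage (f := fun q : ℂ × Sph × Sph => (q.1, q.2.1.1, q.2.2.1)) (by fun_prop)
  · intro τ
    ext z
    constructor
    · rintro ⟨s, t, hs, ht, hz, rfl⟩
      obtain ⟨a, s', ha, e1⟩ := exists_sph hs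
      obtain ⟨b, t', hb, e2⟩ := exists_sph ht
      refine ⟨(s', t'), ?_, ?_⟩
      · change Zer _ s'.1 t'.1 _ _
        rw [e1, e2]; exact hz.smul (A.hom τ) a b
      · simp only [e1, e2, prj_smul ha, prj_smul hb]
    · rintro ⟨⟨s, t⟩, hz, rfl⟩
      exact ⟨s.1, t.1, sph_ne s, sph_ne t, hz, rfl⟩

theorem NonDeg_smul {F : Cub} {s t : E5} {σ : ℂ} {g : E5 → E5 → ℂ} (hg : HomG σ g) {a b : ℂ} (ha : a ≠ 0) (hb : b ≠ 0)
    (h : NonDeg F (a • s) (b • t) σ g) : NonDeg F s t σ g := by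
  obtain ⟨N, hN⟩ := Eqn_smul hg
  obtain ⟨K, j, hd, hj, h⟩ := h
  refine ⟨K, j, ?_, ?_, ?_⟩
  · rw [fdet_fr_smul] at hd; exact right_ne_zero_of_mul hd
  · rw [hc_smul] at hj; exact right_ne_zero_of_mul hj
  · intro s' t' ht hder
    obtain ⟨x, y, e1, e2⟩ := h (a • s') (b • t') (by
      obtain ⟨h1, h2, h3⟩ := ht
      refine ⟨fun x => ?_, ?_, ?_⟩
      · simp only [tri_smul1, tri_smul2]
        linear_combination (a * b) * h1 x
      · simp only [tri_smul1, tri_smul2, tri_smul3, h2, mul_zero]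
      · simp only [tri_smul1, tri_smul2, tri_smul3, h3, mul_zero]) (by
      have : (fun ε : ℂ => Eqn F (a • s + ε • a • s') (b • t + ε • b • t') K σ g j) =
          fun ε : ℂ => (a * b) ^ N * Eqn F (s + ε • s') (t + ε • t') K σ g j := by
        funext ε
        rw [← hN, smul_add, smul_add, smul_comm ε a, smul_comm ε b]
      rw [this, deriv_const_mul_field, hder, mul_zero])
    refine ⟨x, y, ?_, ?_⟩
    · rw [smul_comm] at e1; exact smul_right_injective _ ha e1
    · rw [smul_comm] at e2; exact smul_right_injective _ hb e2

theorem good_open (τ0 : ℂ) (hG : GoodQ (A.F τ0) (A.σ τ0) (A.g τ0)) :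
    ∀ᶠ τ in 𝓝 τ0, GoodQ (A.F τ) (A.σ τ) (A.g τ) := by
  have key : ∀ᶠ τ in 𝓝 τ0, ∀ p ∈ (Set.univ : Set (Sph × Sph)), Zer (A.F τ) p.1.1 p.2.1 (A.σ τ) (A.g τ) →
      NonDeg (A.F τ) p.1.1 p.2.1 (A.σ τ) (A.g τ) := by
    refine IsCompact.eventually_forall_of_forall_eventually isCompact_univ ?_
    rintro ⟨s0, t0⟩ -
    have hcont : Continuous fun z : ℂ × Sph × Sph => (z.1, z.2.1.1, z.2.2.1) := by fun_prop
    suffices h : ∀ᶠ q : ℂ × E5 × E5 in 𝓝 (τ0, s0.1, t0.1), Zer (A.F q.1) q.2.1 q.2.2 (A.σ q.1) (A.g q.1) →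
        NonDeg (A.F q.1) q.2.1 q.2.2 (A.σ q.1) (A.g q.1) from
      (hcont.tendsto (τ0, s0, t0)).eventually h
    by_cases hz0 : Zer (A.F τ0) s0.1 t0.1 (A.σ τ0) (A.g τ0)
    · obtain ⟨K, j, hd, hj, hnd⟩ := hG s0.1 t0.1 (sph_ne s0) (sph_ne t0) hz0
      obtain ⟨i, hi⟩ := ex_ne (sph_ne s0)
      obtain ⟨i', hi'⟩ := ex_ne (sph_ne t0)
      set D : ℂ × E5 × E5 → (E5 × E5 →L[ℂ] ((Fin 5 → ℂ) × ℂ × ℂ × ℂ × ℂ × ℂ)) := fun q =>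
        (fderiv ℂ (A.Phi K j i i' 0 0) q).comp (ContinuousLinearMap.inr ℂ ℂ (E5 × E5)) with hD
      have hDc : Continuous D := by
        have := (A.cdPhi K j i i' 0 0).continuous_fderiv (by norm_num)
        exact this.clm_comp continuous_const
      have hD0 : Function.Injective (D (τ0, s0.1, t0.1)) := by
        rw [injective_iff_map_eq_zero]
        intro v hv
        exact A.inj_of_nondeg hi hi' hnd 0 0 v hv
      have hev : ∀ᶠ q in 𝓝 (τ0, s0.1, t0.1), Function.Injective (D q) :=
        hDc.continuousAt.eventually (ContinuousLinearMap.isOpen_injective.mem_nhds hD0)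
      have ei : ∀ᶠ q : ℂ × E5 × E5 in 𝓝 (τ0, s0.1, t0.1), q.2.1 i ≠ 0 :=
        (show Continuous fun q : ℂ × E5 × E5 => q.2.1 i by fun_prop).continuousAt.eventually_ne hi
      have ei' : ∀ᶠ q : ℂ × E5 × E5 in 𝓝 (τ0, s0.1, t0.1), q.2.2 i' ≠ 0 :=
        (show Continuous fun q : ℂ × E5 × E5 => q.2.2 i' by fun_prop).continuousAt.eventually_ne hi'
      filter_upwards [hev, ei, ei', A.ev_frame hd hj] with q h1 h2 h3 h4 hz
      refine ⟨K, j, h4.1, h4.2, fun s' t' ht hder => ?_⟩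
      refine A.nondeg_of_inj h2 h3 hz.1 ((mul_eq_zero.1 (hz.2 K j)).resolve_left h4.1) 0 0 (fun v hv => ?_) s' t' ht hder
      exact (injective_iff_map_eq_zero _).1 h1 v hv
    · have := A.closed_zer.isOpen_compl.mem_nhds (x := (τ0, s0.1, t0.1)) hz0
      filter_upwards [this] with q hq hz
      exact absurd hz hq
  filter_upwards [key] with τ hτ s t hs ht hz
  obtain ⟨a, s', ha, e1⟩ := exists_sph hs
  obtain ⟨b, t', hb, e2⟩ := exists_sph ht
  refine NonDeg_smul (A.hom τ) ha hb ?_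
  have := hτ (s', t') trivial
  simp only [e1, e2] at this
  exact this (hz.smul (A.hom τ) a b)

end Fam

end CT

namespace CT

open Filter Topology

section PolyData
variable {ι : Type}

theorem IsPoly.fdet {m : (ι → ℂ) → Fin 5 → E5} (hm : ∀ i k, IsPoly fun v => m v i k) :
    IsPoly fun v => CT.fdet (m v) := by
  unfold CT.fdet
  simp only [Matrix.det_apply, Matrix.of_apply]
  refine IsPoly.sum fun σ => ?_
  have h : IsPoly fun v => ∏ i, m v (σ i) i := IsPoly.prod fun i => hm _ _
  have e : ∀ v, Equiv.Perm.sign σ • ∏ i, m v (σ i) i = ((Equiv.Perm.sign σ : ℤ) : ℂ) * ∏ i, m v (σ i) i := by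
    intro v; rw [Units.smul_def, zsmul_eq_mul]
  simp only [e]
  exact (IsPoly.const _).mul h

variable {F : (ι → ℂ) → Cub} {s t : (ι → ℂ) → E5} {K : (ι → ℂ) → Fin 3 → E5}

structure PD (F : (ι → ℂ) → Cub) (s t : (ι → ℂ) → E5) (K : (ι → ℂ) → Fin 3 → E5) : Prop where
  F : ∀ d, IsPoly fun v => F v d
  s : ∀ i, IsPoly fun v => s v i
  t : ∀ i, IsPoly fun v => t v i
  K : ∀ j i, IsPoly fun v => K v j i

theorem PD.hA (h : PD F s t K) (i : Fin 3) : IsPoly fun v => hA (F v) (s v) (K v) i := IsPoly.tri h.F h.s h.s (h.K i)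
theorem PD.hB (h : PD F s t K) (i : Fin 3) : IsPoly fun v => CT.hA (F v) (t v) (K v) i := IsPoly.tri h.F h.t h.t (h.K i)
theorem PD.hc (h : PD F s t K) (i : Fin 3) : IsPoly fun v => hc (F v) (s v) (t v) (K v) i := by
  fin_cases i
  · exact ((h.hA 1).mul (h.hB 2)).sub ((h.hA 2).mul (h.hB 1))
  · exact ((h.hA 2).mul (h.hB 0)).sub ((h.hA 0).mul (h.hB 2))
  · exact ((h.hA 0).mul (h.hB 1)).sub ((h.hA 1).mul (h.hB 0))
theorem PD.cK (h : PD F s t K) (k : Fin 5) : IsPoly fun v => cK (F v) (s v) (t v) (K v) k := by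
  simp only [CT.cK, Finset.sum_apply, Pi.smul_apply, smul_eq_mul]
  exact IsPoly.sum fun i => (h.hc i).mul (h.K i k)
theorem PD.uK (h : PD F s t K) : IsPoly fun v => uK (F v) (s v) (t v) (K v) := IsPoly.tri h.F h.s h.cK h.cK
theorem PD.wK (h : PD F s t K) : IsPoly fun v => wK (F v) (s v) (t v) (K v) := IsPoly.tri h.F h.t h.cK h.cK
theorem PD.tK (h : PD F s t K) : IsPoly fun v => tK (F v) (s v) (t v) (K v) := IsPoly.tri h.F h.cK h.cK h.cK
theorem PD.eK (h : PD F s t K) (i : Fin 3) : IsPoly fun v => eK (F v) (s v) (t v) (K v) i :=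
  (h.wK.mul (IsPoly.tri h.F h.s h.cK (h.K i))).sub (h.uK.mul (IsPoly.tri h.F h.t h.cK (h.K i)))
theorem PD.mK (h : PD F s t K) (i : Fin 3) : IsPoly fun v => mK (F v) (s v) (t v) (K v) i :=
  ((h.uK.pow 2).mul (h.hB i)).add ((h.wK.pow 2).mul (h.hA i))
theorem PD.RK (h : PD F s t K) (i : Fin 3) : IsPoly fun v => RK (F v) (s v) (t v) (K v) i := by
  refine IsPoly.sub ?_ ((((h.uK.mul h.wK).mul (IsPoly.const _)).mul h.tK).mul (h.hc i))
  fin_cases i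
  · exact ((h.eK 1).mul (h.mK 2)).sub ((h.eK 2).mul (h.mK 1))
  · exact ((h.eK 2).mul (h.mK 0)).sub ((h.eK 0).mul (h.mK 2))
  · exact ((h.eK 0).mul (h.mK 1)).sub ((h.eK 1).mul (h.mK 0))
theorem PD.fr (h : PD F s t K) : IsPoly fun v => CT.fdet (fr (s v) (t v) (K v)) := by
  refine IsPoly.fdet fun i k => ?_
  fin_cases i
  · exact h.s k
  · exact h.t k
  · exact h.K 0 k
  · exact h.K 1 k
  · exact h.K 2 k

/-- polynomial function of two vectors -/
def PolyG (G : E5 → E5 → ℂ) : Prop := IsPoly fun z : Fin 5 ⊕ Fin 5 → ℂ => G (fun i => z (Sum.inl i)) (fun i => z (Sum.inr i))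

theorem PolyG.comp {G : E5 → E5 → ℂ} (hG : PolyG G) (hs : ∀ i, IsPoly fun v => s v i) (ht : ∀ i, IsPoly fun v => t v i) :
    IsPoly fun v => G (s v) (t v) := by
  have := IsPoly.comp hG (φ := fun v => Sum.elim (s v) (t v)) (by
    rintro (i | i)
    · exact hs i
    · exact ht i)
  simpa using this

theorem PD.Eqn (h : PD F s t K) {σ γ : (ι → ℂ) → ℂ} (hσ : IsPoly σ) (hγ : IsPoly γ) {G : E5 → E5 → ℂ} (hG : PolyG G)
    (j : Fin 3) : IsPoly fun v => Eqn (F v) (s v) (t v) (K v) (σ v) (fun a b => γ v * G a b) j :=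
  (hσ.mul (h.RK j)).add (((h.fr.pow 7).mul (hγ.mul (hG.comp h.s h.t))).mul (h.hc j))

theorem IsPoly.inl {κ : Type} {f : (ι → ℂ) → ℂ} (hf : IsPoly f) : IsPoly fun z : ι ⊕ κ → ℂ => f (fun i => z (Sum.inl i)) :=
  hf.comp fun i => IsPoly.coord (Sum.inl i)

theorem IsPoly.deriv {f : (ι → ℂ) → ℂ → ℂ} (hf : IsPoly fun z : ι ⊕ Unit → ℂ => f (fun i => z (Sum.inl i)) (z (Sum.inr ()))) :
    IsPoly fun x => _root_.deriv (f x) 0 := by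
  obtain ⟨p, hp⟩ := hf
  let q : Polynomial (MvPolynomial ι ℂ) := aeval (Sum.elim (fun i => Polynomial.C (X i)) (fun _ => Polynomial.X)) p
  have hq : ∀ x ε, f x ε = (q.map (eval x)).eval ε := by
    intro x ε
    have h1 := hp (Sum.elim x (fun _ => ε))
    simp only [Sum.elim_inl, Sum.elim_inr] at h1
    rw [h1]
    have : (eval (Sum.elim x (fun _ => ε)) : MvPolynomial (ι ⊕ Unit) ℂ →+* ℂ) =
        ((Polynomial.evalRingHom ε).comp (Polynomial.mapRingHom (eval x))).comp
          (aeval (Sum.elim (fun i => Polynomial.C (X i)) (fun _ => Polynomial.X)) :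
            MvPolynomial (ι ⊕ Unit) ℂ →ₐ[ℂ] Polynomial (MvPolynomial ι ℂ)).toRingHom := by
      ext i
      · simp [Polynomial.algebraMap_apply]
      · rcases i with i | i <;> simp
    rw [this]; rfl
  refine ⟨q.coeff 1, fun x => ?_⟩
  have : f x = fun ε => (q.map (eval x)).eval ε := funext (hq x)
  change _root_.deriv (f x) 0 = _
  rw [this, Polynomial.deriv, ← Polynomial.coeff_zero_eq_eval_zero, Polynomial.coeff_derivative]
  simp

end PolyData

section Constr
variable {ι : Type} [Finite ι] {F : (ι → ℂ) → Cub} {s t : (ι → ℂ) → E5} {σ γ : (ι → ℂ) → ℂ} {G : E5 → E5 → ℂ}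

theorem isC_zero_vec {f : (ι → ℂ) → E5} (hf : ∀ i, IsPoly fun v => f v i) : IsC fun v => f v = 0 := by
  refine (IsC.all_fin fun i => IsC.eq_zero (hf i)).congr fun x => ?_
  exact funext_iff

theorem isC_gam (hF : ∀ d, IsPoly fun v => F v d) (hs : ∀ i, IsPoly fun v => s v i) (ht : ∀ i, IsPoly fun v => t v i) :
    IsC fun v => Gam (F v) (s v) (t v) := by
  have h1 : IsC fun v => (∀ k, tri (F v) (s v) (t v) (bv k) = 0) ∧ tri (F v) (s v) (s v) (s v) = 0 ∧
      tri (F v) (t v) (t v) (t v) = 0 := by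
    refine IsC.and (IsC.all_fin fun k => IsC.eq_zero (IsPoly.tri hF hs ht fun i => IsPoly.const _)) (IsC.and ?_ ?_)
    · exact IsC.eq_zero (IsPoly.tri hF hs hs hs)
    · exact IsC.eq_zero (IsPoly.tri hF ht ht ht)
  refine h1.congr fun v => ?_
  constructor
  · intro h; exact ⟨fun k => h.1 _, h.2⟩
  · intro h; exact ⟨Fam.tri_all h.1, h.2⟩

theorem isC_zer (hF : ∀ d, IsPoly fun v => F v d) (hs : ∀ i, IsPoly fun v => s v i) (ht : ∀ i, IsPoly fun v => t v i)
    (hσ : IsPoly σ) (hγ : IsPoly γ) (hG : PolyG G) :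
    IsC fun v => Zer (F v) (s v) (t v) (σ v) (fun a b => γ v * G a b) := by
  refine IsC.and (isC_gam hF hs ht) ?_
  have := IsC.all (ι := ι) (κ := Fin 3 × Fin 5) (Q := fun v y => ∀ j : Fin 3,
    fdet (fr (s v) (t v) (fun i k => y (i, k))) *
      Eqn (F v) (s v) (t v) (fun i k => y (i, k)) (σ v) (fun a b => γ v * G a b) j = 0) (by
    refine IsC.all_fin fun j => IsC.eq_zero ?_
    have hpd : PD (ι := ι ⊕ Fin 3 × Fin 5) (fun z => F fun i => z (Sum.inl i)) (fun z => s fun i => z (Sum.inl i))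
      (fun z => t fun i => z (Sum.inl i)) (fun z i k => z (Sum.inr (i, k))) :=
      ⟨fun d => (hF d).inl, fun d => (hs d).inl, fun d => (ht d).inl, fun j i => IsPoly.coord _⟩
    exact hpd.fr.mul (hpd.Eqn hσ.inl hγ.inl hG j))
  refine this.congr fun v => ?_
  constructor
  · intro h y j; exact h _ j
  · intro h K j; exact h (fun p => K p.1 p.2) j

theorem isPoly_derEqn {ι : Type} {F : (ι → ℂ) → Cub} {s t s' t' : (ι → ℂ) → E5} {K : (ι → ℂ) → Fin 3 → E5}
    (h : PD F s t K) (h' : PD F s' t' K) {σ γ : (ι → ℂ) → ℂ} (hσ : IsPoly σ) (hγ : IsPoly γ) {G : E5 → E5 → ℂ} (hG : PolyG G) (j : Fin 3) :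
    IsPoly fun v => deriv (fun ε : ℂ => Eqn (F v) (s v + ε • s' v) (t v + ε • t' v) (K v) (σ v) (fun a b => γ v * G a b) j) 0 := by
  refine IsPoly.deriv ?_
  have a1 : ∀ i, IsPoly fun z : ι ⊕ Unit → ℂ => (s (fun i => z (Sum.inl i)) + z (Sum.inr ()) • s' (fun i => z (Sum.inl i))) i := by
    intro i
    simp only [Pi.add_apply, Pi.smul_apply, smul_eq_mul]
    exact (h.s i).inl.add ((IsPoly.coord (Sum.inr ())).mul (h'.s i).inl)
  have a2 : ∀ i, IsPoly fun z : ι ⊕ Unit → ℂ => (t (fun i => z (Sum.inl i)) + z (Sum.inr ()) • t' (fun i => z (Sum.inl i))) i := by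
    intro i
    simp only [Pi.add_apply, Pi.smul_apply, smul_eq_mul]
    exact (h.t i).inl.add ((IsPoly.coord (Sum.inr ())).mul (h'.t i).inl)
  have hp : PD (ι := ι ⊕ Unit) (fun z => F fun i => z (Sum.inl i))
      (fun z => s (fun i => z (Sum.inl i)) + z (Sum.inr ()) • s' (fun i => z (Sum.inl i)))
      (fun z => t (fun i => z (Sum.inl i)) + z (Sum.inr ()) • t' (fun i => z (Sum.inl i)))
      (fun z => K fun i => z (Sum.inl i)) :=
    ⟨fun d => (h.F d).inl, a1, a2, fun j i => (h.K j i).inl⟩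
  exact hp.Eqn (hσ.inl) (hγ.inl) hG j

/-- proportionality -/
theorem isC_prop {κ : Type} [Finite κ] {f g : (κ → ℂ) → E5} (hf : ∀ i, IsPoly fun v => f v i)
    (hg : ∀ i, IsPoly fun v => g v i) : IsC fun v => ∃ a : ℂ, f v = a • g v := by
  have := IsC.ex (ι := κ) (κ := Unit) (Q := fun v a => f v - a () • g v = 0) (by
    refine isC_zero_vec fun i => ?_
    exact (hf i).inl.sub ((IsPoly.coord _).mul (hg i).inl))
  refine this.congr fun v => ?_
  constructor
  · rintro ⟨a, h⟩; exact ⟨fun _ => a, sub_eq_zero.2 h⟩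
  · rintro ⟨a, h⟩; exact ⟨a (), sub_eq_zero.1 h⟩

def DegTan (F : Cub) (s t : E5) (K : Fin 3 → E5) (σ : ℂ) (g : E5 → E5 → ℂ) (j : Fin 3) (s' t' : E5) : Prop :=
  ((∀ k, tri F s' t (bv k) + tri F s t' (bv k) = 0) ∧ tri F s s s' = 0 ∧ tri F t t t' = 0) →
    deriv (fun ε : ℂ => Eqn F (s + ε • s') (t + ε • t') K σ g j) 0 = 0 →
    (∃ a : ℂ, s' = a • s) ∧ ∃ b : ℂ, t' = b • t

theorem isC_degTan {ι : Type} [Finite ι] {F : (ι → ℂ) → Cub} {s t s' t' : (ι → ℂ) → E5} {K : (ι → ℂ) → Fin 3 → E5}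
    (h : PD F s t K) (h' : PD F s' t' K) {σ γ : (ι → ℂ) → ℂ} (hσ : IsPoly σ) (hγ : IsPoly γ) {G : E5 → E5 → ℂ} (hG : PolyG G) (j : Fin 3) :
    IsC fun v => DegTan (F v) (s v) (t v) (K v) (σ v) (fun a b => γ v * G a b) j (s' v) (t' v) := by
  have c1 : ∀ k, IsC fun v => tri (F v) (s' v) (t v) (bv k) + tri (F v) (s v) (t' v) (bv k) = 0 := by
    intro k
    have b0 : ∀ i, IsPoly fun _ : ι → ℂ => bv k i := fun i => IsPoly.const (bv k i)
    have b1 := IsPoly.tri (z := fun _ => bv k) h.F h'.s h.t b0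
    have b2 := IsPoly.tri (z := fun _ => bv k) h.F h.s h'.t b0
    exact IsC.eq_zero (b1.add b2)
  have c2 : IsC fun v => tri (F v) (s v) (s v) (s' v) = 0 := IsC.eq_zero (IsPoly.tri h.F h.s h.s h'.s)
  have c3 : IsC fun v => tri (F v) (t v) (t v) (t' v) = 0 := IsC.eq_zero (IsPoly.tri h.F h.t h.t h'.t)
  have d4 : IsPoly fun v => deriv (fun ε : ℂ => Eqn (F v) (s v + ε • s' v) (t v + ε • t' v) (K v) (σ v) (fun a b => γ v * G a b) j) 0 :=
    isPoly_derEqn (F := F) (s := s) (t := t) (s' := s') (t' := t') (K := K) h h' (σ := σ) (γ := γ) hσ hγ (G := G) hG j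
  have c4 := IsC.eq_zero d4
  have c5 := isC_prop h'.s h.s
  have c6 := isC_prop h'.t h.t
  have c7 := ((IsC.all_fin c1).and (c2.and c3)).imp (c4.imp (c5.and c6))
  exact c7

theorem isC_degTan_all {ι : Type} [Finite ι] {F : (ι → ℂ) → Cub} {s t : (ι → ℂ) → E5} {K : (ι → ℂ) → Fin 3 → E5}
    (h : PD F s t K) {σ γ : (ι → ℂ) → ℂ} (hσ : IsPoly σ) (hγ : IsPoly γ) {G : E5 → E5 → ℂ} (hG : PolyG G) (j : Fin 3) :
    IsC fun v => ∀ p : Fin 5 ⊕ Fin 5 → ℂ, DegTan (F v) (s v) (t v) (K v) (σ v) (fun a b => γ v * G a b) j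
      (fun i => p (Sum.inl i)) (fun i => p (Sum.inr i)) := by
  refine IsC.all (κ := Fin 5 ⊕ Fin 5) ?_
  have hp : PD (ι := ι ⊕ (Fin 5 ⊕ Fin 5)) (fun z => F fun i => z (Sum.inl i)) (fun z => s fun i => z (Sum.inl i))
      (fun z => t fun i => z (Sum.inl i)) (fun z => K fun i => z (Sum.inl i)) :=
    ⟨fun d => (h.F d).inl, fun d => (h.s d).inl, fun d => (h.t d).inl, fun j i => (h.K j i).inl⟩
  have hp' : PD (ι := ι ⊕ (Fin 5 ⊕ Fin 5)) (fun z => F fun i => z (Sum.inl i)) (fun z i => z (Sum.inr (Sum.inl i)))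
      (fun z i => z (Sum.inr (Sum.inr i))) (fun z => K fun i => z (Sum.inl i)) :=
    ⟨fun d => (h.F d).inl, fun d => IsPoly.coord _, fun d => IsPoly.coord _, fun j i => (h.K j i).inl⟩
  exact isC_degTan hp hp' hσ.inl hγ.inl hG j

theorem isC_nondeg (hF : ∀ d, IsPoly fun v => F v d) (hs : ∀ i, IsPoly fun v => s v i) (ht : ∀ i, IsPoly fun v => t v i)
    (hσ : IsPoly σ) (hγ : IsPoly γ) (hG : PolyG G) :
    IsC fun v => NonDeg (F v) (s v) (t v) (σ v) (fun a b => γ v * G a b) := by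
  have h1 := IsC.ex (ι := ι) (κ := Fin 3 × Fin 5) (Q := fun v y => ∃ j : Fin 3,
    (¬ fdet (fr (s v) (t v) (fun i k => y (i, k))) = 0) ∧ (¬ hc (F v) (s v) (t v) (fun i k => y (i, k)) j = 0) ∧
    ∀ p : Fin 5 ⊕ Fin 5 → ℂ, DegTan (F v) (s v) (t v) (fun i k => y (i, k)) (σ v) (fun a b => γ v * G a b) j
      (fun i => p (Sum.inl i)) (fun i => p (Sum.inr i))) (by
    refine IsC.ex_fin fun j => ?_
    have hpd : PD (ι := ι ⊕ Fin 3 × Fin 5) (fun z => F fun i => z (Sum.inl i)) (fun z => s fun i => z (Sum.inl i))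
      (fun z => t fun i => z (Sum.inl i)) (fun z i k => z (Sum.inr (i, k))) :=
      ⟨fun d => (hF d).inl, fun d => (hs d).inl, fun d => (ht d).inl, fun j i => IsPoly.coord _⟩
    exact IsC.and (IsC.eq_zero hpd.fr).not (IsC.and (IsC.eq_zero (hpd.hc j)).not
      (isC_degTan_all hpd hσ.inl hγ.inl hG j)))
  refine h1.congr fun v => ?_
  constructor
  · rintro ⟨K, j, hd, hj, h⟩
    refine ⟨fun p => K p.1 p.2, j, hd, hj, fun p hp hder => ?_⟩
    obtain ⟨a, b, e1, e2⟩ := h _ _ ((Fam.tan_iff _ _ _ _ _).2 hp) hder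
    exact ⟨⟨a, e1⟩, ⟨b, e2⟩⟩
  · rintro ⟨y, j, hd, hj, h⟩
    refine ⟨fun i k => y (i, k), j, hd, hj, fun s' t' hp hder => ?_⟩
    obtain ⟨⟨a, e1⟩, ⟨b, e2⟩⟩ := h (Sum.elim s' t') ((Fam.tan_iff _ _ _ _ _).1 hp) hder
    exact ⟨a, b, e1, e2⟩

theorem isC_good (hF : ∀ d, IsPoly fun v => F v d) (hσ : IsPoly σ) (hγ : IsPoly γ) (hG : PolyG G) :
    IsC fun v => GoodQ (F v) (σ v) (fun a b => γ v * G a b) := by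
  have := IsC.all (ι := ι) (κ := Fin 5 ⊕ Fin 5) (Q := fun v p => ¬ ((fun i => p (Sum.inl i) : E5) = 0) → ¬ ((fun i => p (Sum.inr i) : E5) = 0) →
    Zer (F v) (fun i => p (Sum.inl i)) (fun i => p (Sum.inr i)) (σ v) (fun a b => γ v * G a b) →
    NonDeg (F v) (fun i => p (Sum.inl i)) (fun i => p (Sum.inr i)) (σ v) (fun a b => γ v * G a b)) (by
    have hF2 : ∀ d, IsPoly fun z : ι ⊕ (Fin 5 ⊕ Fin 5) → ℂ => F (fun i => z (Sum.inl i)) d := fun d => (hF d).inl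
    have hp1 : ∀ i : Fin 5, IsPoly fun z : ι ⊕ (Fin 5 ⊕ Fin 5) → ℂ => z (Sum.inr (Sum.inl i)) := fun i => IsPoly.coord _
    have hp2 : ∀ i : Fin 5, IsPoly fun z : ι ⊕ (Fin 5 ⊕ Fin 5) → ℂ => z (Sum.inr (Sum.inr i)) := fun i => IsPoly.coord _
    refine IsC.imp (isC_zero_vec hp1).not (IsC.imp (isC_zero_vec hp2).not (IsC.imp ?_ ?_))
    · exact isC_zer hF2 hp1 hp2 hσ.inl hγ.inl hG
    · exact isC_nondeg hF2 hp1 hp2 hσ.inl hγ.inl hG)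
  refine this.congr fun v => ?_
  constructor
  · intro h p; exact h _ _
  · intro h s t; exact h (Sum.elim s t)

end Constr

theorem PolyG.contDiff {G : E5 → E5 → ℂ} (hG : PolyG G) : ContDiff ℂ 1 fun q : E5 × E5 => G q.1 q.2 := by
  obtain ⟨p, hp⟩ := hG
  have e : (fun q : E5 × E5 => G q.1 q.2) = fun q : E5 × E5 => eval (Sum.elim q.1 q.2) p := by
    funext q; exact hp (Sum.elim q.1 q.2)
  rw [e]
  clear hp e
  induction p using MvPolynomial.induction_on with
  | C a => simp only [eval_C]; exact contDiff_const
  | add p q h1 h2 =>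
    simp only [map_add]
    exact h1.add h2
  | mul_X p i h1 =>
    simp only [map_mul, eval_X]
    refine ContDiff.mul h1 ?_
    rcases i with i | i
    · exact contDiff_pi.1 contDiff_fst i
    · exact contDiff_pi.1 contDiff_snd i

/-- the number of zeros is constant in the pencil -/
theorem global_const {F F0 : Cub} {G : E5 → E5 → ℂ} (hG : PolyG G)
    (hh : ∀ (a b : ℂ) s t, G (a • s) (b • t) = a ^ 8 * b ^ 8 * G s t) 
    (h1 : GoodQ F 1 (fun _ _ => 0)) (h0 : GoodQ F0 0 G) :
    (Zset F 1 (fun _ _ => 0)).Finite ∧ (Zset F 1 (fun _ _ => 0)).ncard = (Zset F0 0 G).ncard := by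
  let A : Fam := 
    { F := fun τ => (1 - τ) • F + τ • F0
      σ := fun τ => 1 - τ
      g := fun τ a b => τ * G a b
      hF := by fun_prop
      hσ := by fun_prop
      hg := contDiff_fst.mul (hG.contDiff.comp contDiff_snd)
      hom := fun τ => ⟨8, fun a b s t => by simp only [hh]; ring, Or.inr rfl⟩ }
  have e0 : A.F 0 = F ∧ A.σ 0 = 1 ∧ A.g 0 = fun _ _ => 0 := by
    refine ⟨by simp [A], by simp [A], by simp [A]⟩
  have e1 : A.F 1 = F0 ∧ A.σ 1 = 0 ∧ A.g 1 = G := by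
    refine ⟨by simp [A], by simp [A], by simp [A]⟩
  let S : Set ℂ := {τ | GoodQ (A.F τ) (A.σ τ) (A.g τ)}
  have hS0 : (0 : ℂ) ∈ S := by simp only [S, Set.mem_ofPred_eq, e0]; exact h1
  have hS1 : (1 : ℂ) ∈ S := by simp only [S, Set.mem_ofPred_eq, e1]; exact h0
  have hC : IsC fun v : Unit → ℂ => v () ∈ S := by
    refine isC_good (F := fun v => (1 - v ()) • F + v () • F0) (σ := fun v => 1 - v ()) (γ := fun v => v ()) (G := G) ?_ ?_ ?_ hG
    · intro d
      exact (((IsPoly.const 1).sub (IsPoly.coord _)).mul (IsPoly.const _)).add ((IsPoly.coord _).mul (IsPoly.const _))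
    · exact (IsPoly.const 1).sub (IsPoly.coord _)
    · exact IsPoly.coord _
  have hopen : IsOpen S := isOpen_iff_mem_nhds.2 fun τ hτ => A.good_open τ hτ
  have hfin : Sᶜ.Finite := by
    obtain ⟨p, hp, h⟩ := hC.dichotomy
    have hz : {τ : ℂ | eval (fun _ : Unit => τ) p = 0}.Finite := by
      let q := MvPolynomial.uniqueAlgEquiv ℂ Unit p
      have hq : q ≠ 0 := (map_ne_zero_iff _ (MvPolynomial.uniqueAlgEquiv ℂ Unit).injective).2 hp
      refine (Polynomial.finite_setOfPred_isRoot hq).subset fun τ hτ => ?_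
      have h2 : (Polynomial.evalRingHom τ).comp (MvPolynomial.uniqueAlgEquiv ℂ Unit).toRingEquiv.toRingHom = 
          (eval (fun _ : Unit => τ) : MvPolynomial Unit ℂ →+* ℂ) := by
        ext i
        · simp
        · simp
      have h3 := RingHom.congr_fun h2 p
      change Polynomial.eval τ q = 0
      rw [Set.mem_ofPred_eq] at hτ
      rw [← hτ, ← h3]; rfl
    rcases h with h | h
    · exfalso
      have : S.Finite := hz.subset fun τ hτ => h (fun _ => τ) hτ
      have hinf : S.Infinite := infinite_of_mem_nhds 0 (hopen.mem_nhds hS0)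
      exact hinf this
    · exact hz.subset fun τ hτ => h (fun _ => τ) hτ
  have hconn : IsPreconnected S := by
    have := hfin.countable.isPathConnected_compl_of_one_lt_rank (by rw [Complex.rank_real_complex]; norm_num)
    rw [compl_compl] at this
    exact this.isConnected.isPreconnected
  have hcont : ContinuousOn (fun τ => (Zset (A.F τ) (A.σ τ) (A.g τ)).ncard) S := by
    intro τ hτ
    refine ContinuousAt.continuousWithinAt ?_
    have := (A.local_const τ hτ).2
    refine ContinuousAt.congr (f := fun _ => (Zset (A.F τ) (A.σ τ) (A.g τ)).ncard) continuousAt_const ?_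
    filter_upwards [this] with τ' h'
    exact h'.2.symm
  have hc := hconn.constant hcont hS0 hS1
  have hf := (A.local_const 0 hS0).1
  simp only [e0, e1] at hc hf
  exact ⟨hf, hc⟩

end CT

namespace CT

open Filter Topology

/-! ### the systems with `σ = 0` -/

theorem zer_zero {F : Cub} {s t : E5} {g : E5 → E5 → ℂ} (hS : Smooth3 F) (hs : s ≠ 0) (ht : t ≠ 0) :
    Zer F s t 0 g ↔ Gam F s t ∧ g s t = 0 := by
  constructor
  · rintro ⟨h, h2⟩
    refine ⟨h, ?_⟩
    obtain ⟨k, hk, hk2⟩ := h.exists_frame hS hs ht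
    have := h2 (fun i => bv (k i)) 0
    rw [Eqn, zero_mul, zero_add] at this
    by_contra hne
    exact (mul_ne_zero hk (mul_ne_zero (mul_ne_zero (pow_ne_zero 7 hk) hne) hk2)) this
  · rintro ⟨h, h2⟩
    refine ⟨h, fun K j => ?_⟩
    rw [Eqn, h2]; ring

/-- nondegeneracy for `σ = 0` -/
def NDg (F : Cub) (s t : E5) (g : E5 → E5 → ℂ) : Prop := ∀ s' t', Tan F s t s' t' →
    deriv (fun ε : ℂ => g (s + ε • s') (t + ε • t')) 0 = 0 → ∃ a b : ℂ, s' = a • s ∧ t' = b • t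

theorem PolyG.diff {G : E5 → E5 → ℂ} (hG : PolyG G) (s t s' t' : E5) :
    DifferentiableAt ℂ (fun ε : ℂ => G (s + ε • s') (t + ε • t')) 0 := by
  have h : ContDiff ℂ 1 (fun ε : ℂ => G (s + ε • s') (t + ε • t')) :=
    hG.contDiff.comp (f := fun ε : ℂ => (s + ε • s', t + ε • t')) (by fun_prop)
  exact h.differentiable (by norm_num) 0

theorem deriv_Eqn_zero {F : Cub} {s t : E5} {g : E5 → E5 → ℂ} (hg : PolyG g) (h0 : g s t = 0) (K : Fin 3 → E5) (j : Fin 3)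
    (s' t' : E5) : deriv (fun ε : ℂ => Eqn F (s + ε • s') (t + ε • t') K 0 g j) 0 =
      fdet (fr s t K) ^ 7 * deriv (fun ε : ℂ => g (s + ε • s') (t + ε • t')) 0 * hc F s t K j := by
  have hF : ContDiff ℂ 1 (fun _ : ℂ => F) := contDiff_const
  have hs : ContDiff ℂ 1 (fun ε : ℂ => s + ε • s') := by fun_prop
  have ht : ContDiff ℂ 1 (fun ε : ℂ => t + ε • t') := by fun_prop
  have hK : ∀ i, ContDiff ℂ 1 fun _ : ℂ => K i := fun i => contDiff_const
  have h1 := ((((ContDiff_fr hF hs ht hK).pow 7).differentiable (by norm_num) 0).hasDerivAt.fun_mul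
    (hg.diff s t s' t').hasDerivAt).fun_mul
    (((ContDiff_hc hF hs ht hK j).differentiable (by norm_num) 0).hasDerivAt)
  have h2 : (fun ε : ℂ => Eqn F (s + ε • s') (t + ε • t') K 0 g j) = fun ε : ℂ =>
      fdet (fr (s + ε • s') (t + ε • t') K) ^ 7 * g (s + ε • s') (t + ε • t') * hc F (s + ε • s') (t + ε • t') K j := by
    funext ε; rw [Eqn, zero_mul, zero_add]
  rw [h2, h1.deriv]
  simp [h0]

theorem nondeg_zero {F : Cub} {s t : E5} {g : E5 → E5 → ℂ} (hg : PolyG g) (hS : Smooth3 F) (hs : s ≠ 0) (ht : t ≠ 0)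
    (h : Gam F s t) (h0 : g s t = 0) : NonDeg F s t 0 g ↔ NDg F s t g := by
  constructor
  · rintro ⟨K, j, hd, hj, hn⟩ s' t' hT hD
    refine hn s' t' hT ?_
    rw [deriv_Eqn_zero hg h0, hD]; ring
  · intro hn
    obtain ⟨k, hk, hk2⟩ := h.exists_frame hS hs ht
    refine ⟨_, 0, hk, hk2, fun s' t' hT hD => hn s' t' hT ?_⟩
    rw [deriv_Eqn_zero hg h0] at hD
    simpa [hk, hk2] using hD

theorem goodQ_zero {F : Cub} {g : E5 → E5 → ℂ} (hg : PolyG g) (hS : Smooth3 F) :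
    GoodQ F 0 g ↔ ∀ s t, s ≠ 0 → t ≠ 0 → Gam F s t → g s t = 0 → NDg F s t g := by
  constructor
  · intro h s t hs ht hG h0
    exact (nondeg_zero hg hS hs ht hG h0).1 (h s t hs ht ((zer_zero hS hs ht).2 ⟨hG, h0⟩))
  · intro h s t hs ht hZ
    obtain ⟨hG, h0⟩ := (zer_zero hS hs ht).1 hZ
    exact (nondeg_zero hg hS hs ht hG h0).2 (h s t hs ht hG h0)

/-! ### the special cubic -/

/-- the six linear forms with sum zero -/
def lam (s : E5) : Fin 6 → ℂ := ![s 0, s 1, s 2, s 3, s 4, -(s 0 + s 1 + s 2 + s 3 + s 4)]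

def unlam (S : Fin 6 → ℂ) : E5 := fun i => S i.castSucc

theorem unlam_lam (s : E5) : unlam (lam s) = s := by
  funext i; fin_cases i <;> rfl

theorem sum_lam (s : E5) : ∑ i, lam s i = 0 := by
  simp [lam, Fin.sum_univ_succ]

theorem lam_unlam {S : Fin 6 → ℂ} (h : ∑ i, S i = 0) : lam (unlam S) = S := by
  funext i
  simp only [Fin.sum_univ_six] at h
  fin_cases i <;> try rfl
  simp [lam, unlam]
  linear_combination -h

theorem lam_add (s t : E5) (i : Fin 6) : lam (s + t) i = lam s i + lam t i := by
  fin_cases i <;> simp [lam]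
  ring

theorem lam_smul (a : ℂ) (s : E5) (i : Fin 6) : lam (a • s) i = a * lam s i := by
  fin_cases i <;> simp [lam]
  ring

theorem lam_inj {s t : E5} (h : lam s = lam t) : s = t := by
  rw [← unlam_lam s, h, unlam_lam]

theorem lam_eq_sum (s : E5) (l : Fin 6) : lam s l = ∑ i, s i * lam (bv i) l := by
  fin_cases l <;> simp [lam, bv, Fin.sum_univ_five, Pi.single_apply]
  ring

def cc (i : Fin 6) : ℂ := 1 / 4 ^ (i : ℕ)

theorem cc_ne (i : Fin 6) : cc i ≠ 0 := by simp [cc]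

theorem cc_inj {i j : Fin 6} (h : cc i = cc j) : i = j := by
  simp only [cc, one_div, inv_inj] at h
  have h2 : (4:ℕ) ^ (i:ℕ) = 4 ^ (j:ℕ) := by exact_mod_cast h
  exact Fin.ext (Nat.pow_right_injective (by norm_num) h2)

def F0 : Cub := fun d => ∑ l, cc l * (d.1.map (fun k => lam (bv k) l)).prod

theorem F0_mk3 (i j k : Fin 5) : F0 (mk3 i j k) = ∑ l, cc l * (lam (bv i) l * lam (bv j) l * lam (bv k) l) := by
  have e : (mk3 i j k).1 = i ::ₘ j ::ₘ k ::ₘ 0 := rfl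
  unfold F0
  rw [e]
  simp [mul_assoc]

theorem tri_F0 (x y z : E5) : tri F0 x y z = ∑ l, cc l * lam x l * lam y l * lam z l := by
  unfold tri
  simp only [F0_mk3]
  have : ∀ l, cc l * lam x l * lam y l * lam z l = ∑ i, ∑ j, ∑ k, cc l * (lam (bv i) l * lam (bv j) l * lam (bv k) l) *
      x i * y j * z k := by
    intro l
    rw [lam_eq_sum x, lam_eq_sum y, lam_eq_sum z]
    rw [mul_assoc, Finset.sum_mul_sum, mul_assoc, Finset.sum_mul_sum, Finset.mul_sum]
    refine Finset.sum_congr rfl fun i _ => ?_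
    rw [Finset.mul_sum]
    refine Finset.sum_congr rfl fun j _ => ?_
    rw [Finset.mul_sum, Finset.mul_sum]
    refine Finset.sum_congr rfl fun k _ => ?_
    ring
  simp only [this, Finset.sum_mul]
  symm
  rw [Finset.sum_comm]
  refine Finset.sum_congr rfl fun i _ => ?_
  rw [Finset.sum_comm]
  refine Finset.sum_congr rfl fun j _ => ?_
  rw [Finset.sum_comm]

theorem sgn {S : Fin 6 → ℂ} {m : ℂ} (h : ∀ i, S i = 0 ∨ cc i * S i ^ 2 = m) (h0 : ∑ i, S i = 0) : S = 0 := by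
  obtain ⟨κ, hκ⟩ := IsAlgClosed.exists_pow_nat_eq m (n := 2) (by norm_num)
  have h1 : ∀ i, ∃ e : ℤ, (e = 0 ∨ e = 1 ∨ e = -1) ∧ S i = κ * (e * 2 ^ (i : ℕ)) := by
    intro i
    rcases h i with h | h
    · exact ⟨0, by simp, by simp [h]⟩
    · have h2 : S i ^ 2 = (κ * 2 ^ (i : ℕ)) ^ 2 := by
        rw [cc] at h
        field_simp at h
        rw [h, ← hκ, mul_pow, ← pow_mul, mul_comm (i:ℕ) 2, pow_mul]; norm_num; ring
      rcases sq_eq_sq_iff_eq_or_eq_neg.1 h2 with h3 | h3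
      · exact ⟨1, by simp, by rw [h3]; push_cast; ring⟩
      · exact ⟨-1, by simp, by rw [h3]; push_cast; ring⟩
  choose e he hS using h1
  by_cases hk : κ = 0
  · funext i; rw [hS i, hk]; simp
  have h2 : κ * ((∑ i, e i * 2 ^ (i : ℕ) : ℤ) : ℂ) = 0 := by
    rw [← h0]; push_cast; rw [Finset.mul_sum]
    exact Finset.sum_congr rfl fun i _ => (hS i).symm
  have h3 : (∑ i, e i * 2 ^ (i : ℕ) : ℤ) = 0 := by
    exact_mod_cast (mul_eq_zero.1 h2).resolve_left hk
  simp only [Fin.sum_univ_six] at h3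
  norm_num at h3
  have g0 := he 0
  have g1 := he 1
  have g2 := he 2
  have g3 := he 3
  have g4 := he 4
  have g5 := he 5
  have hall : ∀ i, e i = 0 := by
    intro i
    fin_cases i <;> simp <;> omega
  funext i; rw [hS i, hall i]; simp

theorem tri_F0_zero {x y : E5} (h : ∀ z, tri F0 x y z = 0) (i : Fin 6) :
    cc i * lam x i * lam y i = cc 5 * lam x 5 * lam y 5 := by
  have h1 : ∀ k : Fin 5, cc k.castSucc * lam x k.castSucc * lam y k.castSucc = cc 5 * lam x 5 * lam y 5 := by
    intro k
    have := h (bv k)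
    rw [tri_F0, Fin.sum_univ_six] at this
    fin_cases k <;> simp [lam, bv] at this ⊢ <;> linear_combination this
  refine Fin.lastCases rfl (fun k => h1 k) i

theorem smooth_F0 : Smooth3 F0 := by
  intro p hp
  have h := tri_F0_zero hp
  apply lam_inj
  rw [sgn (S := lam p) (m := cc 5 * lam p 5 ^ 2) (fun i => Or.inr (by linear_combination h i)) (sum_lam p)]
  funext i; fin_cases i <;> simp [lam]

/-- support -/
def supp (s : E5) : Finset (Fin 6) := Finset.univ.filter fun i => lam s i ≠ 0

theorem mem_supp {s : E5} {i : Fin 6} : i ∈ supp s ↔ lam s i ≠ 0 := by simp [supp]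

theorem sum_of_supp {f : Fin 6 → ℂ} {A : Finset (Fin 6)} (h : ∀ i ∉ A, f i = 0) : ∑ i, f i = ∑ i ∈ A, f i := by
  symm
  exact Finset.sum_subset (Finset.subset_univ _) fun i _ hi => h i hi

theorem supp_card {s : E5} (hs : s ≠ 0) (h : tri F0 s s s = 0) : 3 ≤ (supp s).card := by
  by_contra hlt
  have hz : ∀ i ∉ supp s, lam s i = 0 := fun i hi => by simpa [mem_supp] using hi
  have h1 := sum_lam s
  rw [sum_of_supp hz] at h1
  rw [tri_F0, sum_of_supp (A := supp s) (fun i hi => by rw [hz i hi]; ring)] at h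
  have hcase : (supp s).card = 0 ∨ (supp s).card = 1 ∨ (supp s).card = 2 := by omega
  rcases hcase with hc | hc | hc
  · rw [Finset.card_eq_zero] at hc
    apply hs; apply lam_inj
    funext i
    rw [hz i (by simp [hc])]
    fin_cases i <;> simp [lam]
  · obtain ⟨a, ha⟩ := Finset.card_eq_one.1 hc
    rw [ha, Finset.sum_singleton] at h1
    have : a ∈ supp s := by simp [ha]
    exact mem_supp.1 this h1
  · obtain ⟨a, b, hab, ha⟩ := Finset.card_eq_two.1 hc
    rw [ha, Finset.sum_pair hab] at h1 h
    have hb : a ∈ supp s := by simp [ha]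
    rw [mem_supp] at hb
    apply hab
    apply cc_inj
    have : lam s b = - lam s a := by linear_combination h1
    rw [this] at h
    have h3 : (cc a - cc b) * lam s a ^ 3 = 0 := by linear_combination h
    have := (mul_eq_zero.1 h3).resolve_right (pow_ne_zero 3 hb)
    linear_combination this

theorem gam_supp {s t : E5} (hs : s ≠ 0) (ht : t ≠ 0) (h : Gam F0 s t) (h5 : lam s 5 * lam t 5 = 0) :
    (supp s).card = 3 ∧ supp t = (supp s)ᶜ := by
  have h1 : ∀ i, lam s i * lam t i = 0 := by
    intro i
    have := tri_F0_zero h.1 i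
    rw [mul_assoc, mul_assoc, h5, mul_zero] at this
    exact (mul_eq_zero.1 this).resolve_left (cc_ne i)
  have hsub : supp t ⊆ (supp s)ᶜ := by
    intro i hi
    simp only [Finset.mem_compl, mem_supp] at hi ⊢
    have := (mul_eq_zero.1 (h1 i)).resolve_right hi
    simpa using this
  have hA := supp_card hs h.2.1
  have hB := supp_card ht h.2.2
  have hC := Finset.card_le_card hsub
  rw [Finset.card_compl, Fintype.card_fin] at hC
  refine ⟨by omega, Finset.eq_of_subset_of_card_le hsub ?_⟩
  rw [Finset.card_compl, Fintype.card_fin]; omega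

theorem prop_of_tan {s s' : E5} (hs : s ≠ 0) (hA : (supp s).card = 3) (hF : tri F0 s s s = 0)
    (h : tri F0 s s s' = 0) (h' : ∀ i ∉ supp s, lam s' i = 0) : ∃ a : ℂ, s' = a • s := by
  obtain ⟨a, b, c, hab, hac, hbc, hA⟩ := Finset.card_eq_three.1 hA
  have hz : ∀ i ∉ supp s, lam s i = 0 := fun i hi => by simpa [mem_supp] using hi
  have h1 := sum_lam s
  have h2 := sum_lam s'
  rw [sum_of_supp hz, hA, Finset.sum_insert (by simp [hab, hac]), Finset.sum_pair hbc] at h1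
  rw [sum_of_supp h', hA, Finset.sum_insert (by simp [hab, hac]), Finset.sum_pair hbc] at h2
  rw [tri_F0, sum_of_supp (A := supp s) (fun i hi => by rw [hz i hi]; ring), hA,
    Finset.sum_insert (by simp [hab, hac]), Finset.sum_pair hbc] at h hF
  have e1 : lam s c = - lam s a - lam s b := by linear_combination h1
  have e2 : lam s' c = - lam s' a - lam s' b := by linear_combination h2
  set q : Fin 6 → ℂ := fun i => cc i * lam s i ^ 2 with hq
  have f1 : (q a - q c) * lam s a + (q b - q c) * lam s b = 0 := by
    simp only [hq]; linear_combination hF - cc c * lam s c ^ 2 * h1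
  have f2 : (q a - q c) * lam s' a + (q b - q c) * lam s' b = 0 := by
    simp only [hq]; linear_combination h - cc c * lam s c ^ 2 * h2
  have k0 : lam s a * lam s' b - lam s b * lam s' a = 0 := by
    by_contra hk
    have g1 : (q a - q c) * (lam s a * lam s' b - lam s b * lam s' a) = 0 := by
      linear_combination lam s' b * f1 - lam s b * f2
    have g2 : (q b - q c) * (lam s a * lam s' b - lam s b * lam s' a) = 0 := by
      linear_combination lam s a * f2 - lam s' a * f1
    have g1 := (mul_eq_zero.1 g1).resolve_right hk
    have g2 := (mul_eq_zero.1 g2).resolve_right hk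
    apply hs; apply lam_inj
    rw [sgn (S := lam s) (m := q c) ?_ (sum_lam s)]
    · funext i; fin_cases i <;> simp [lam]
    · intro i
      by_cases hi : i ∈ supp s
      · right
        rw [hA] at hi
        simp only [Finset.mem_insert, Finset.mem_singleton] at hi
        rcases hi with rfl | rfl | rfl
        · linear_combination g1
        · linear_combination g2
        · rfl
      · left; exact hz i hi
  have ha : lam s a ≠ 0 := mem_supp.1 (by simp [hA])
  refine ⟨lam s' a / lam s a, lam_inj ?_⟩
  funext i
  rw [lam_smul]
  by_cases hi : i ∈ supp s
  · rw [hA] at hi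
    simp only [Finset.mem_insert, Finset.mem_singleton] at hi
    field_simp
    rcases hi with rfl | rfl | rfl
    · ring
    · linear_combination k0
    · rw [e1, e2]; linear_combination -k0
  · rw [h' i hi, hz i hi]; ring

def E0 (s t : E5) : ℂ := lam s 5 * lam t 5

theorem polyG_E0 : PolyG E0 := by
  unfold PolyG E0 lam
  simp only [Matrix.cons_val]
  have h : ∀ (i : Fin 5 ⊕ Fin 5), IsPoly fun z : Fin 5 ⊕ Fin 5 → ℂ => z i := fun i => IsPoly.coord i
  exact (((((h _).add (h _)).add (h _)).add (h _)).add (h _)).neg.mul (((((h _).add (h _)).add (h _)).add (h _)).add (h _)).neg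

theorem E0_smul (a b : ℂ) (s t : E5) : E0 (a • s) (b • t) = a * b * E0 s t := by
  simp only [E0, lam_smul]; ring

theorem good_E0 : GoodQ F0 0 E0 := by
  rw [goodQ_zero polyG_E0 smooth_F0]
  intro s t hs ht hG h0 s' t' hT hD
  have hder : deriv (fun ε : ℂ => E0 (s + ε • s') (t + ε • t')) 0 = lam s' 5 * lam t 5 + lam s 5 * lam t' 5 := by
    have h1 : HasDerivAt (fun ε : ℂ => lam s 5 + ε * lam s' 5) (lam s' 5) 0 := by
      simpa using ((hasDerivAt_id (0:ℂ)).mul_const (lam s' 5)).const_add (lam s 5)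
    have h2 : HasDerivAt (fun ε : ℂ => lam t 5 + ε * lam t' 5) (lam t' 5) 0 := by
      simpa using ((hasDerivAt_id (0:ℂ)).mul_const (lam t' 5)).const_add (lam t 5)
    have h3 := (h1.fun_mul h2).deriv
    simp only [E0, lam_add, lam_smul]
    rw [h3]; ring
  rw [hder] at hD
  obtain ⟨hA, hB⟩ := gam_supp hs ht hG h0
  have hx : ∀ i, lam s' i * lam t i + lam s i * lam t' i = 0 := by
    intro i
    have key : ∀ k : Fin 5, cc k.castSucc * (lam s' k.castSucc * lam t k.castSucc + lam s k.castSucc * lam t' k.castSucc)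
        = 0 := by
      intro k
      have h := hT.1 (bv k)
      rw [tri_F0, tri_F0, Fin.sum_univ_six, Fin.sum_univ_six] at h
      have e5 : lam (bv k) 5 = -1 := by fin_cases k <;> simp [lam, bv]
      have e6 : ∀ f : Fin 6 → ℂ, f 0 * lam (bv k) 0 + f 1 * lam (bv k) 1 + f 2 * lam (bv k) 2 + f 3 * lam (bv k) 3
          + f 4 * lam (bv k) 4 = f k.castSucc := by
        intro f
        fin_cases k <;> simp [lam, bv]
      have e7 := e6 (fun i => cc i * lam s' i * lam t i + cc i * lam s i * lam t' i)
      linear_combination h - e7 - (cc 5 * lam s' 5 * lam t 5 + cc 5 * lam s 5 * lam t' 5) * e5 + cc 5 * hD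
    refine Fin.lastCases hD (fun k => ?_) i
    exact (mul_eq_zero.1 (key k)).resolve_left (cc_ne _)
  have hBc : (supp t).card = 3 := by rw [hB, Finset.card_compl, hA]; rfl
  obtain ⟨a, ha⟩ := prop_of_tan hs hA hG.2.1 hT.2.1 (fun i hi => by
    have h1 : i ∈ supp t := by rw [hB]; simpa using hi
    have h2 : lam s i = 0 := by simpa [mem_supp] using hi
    have := hx i
    rw [h2, zero_mul, add_zero] at this
    exact (mul_eq_zero.1 this).resolve_right (mem_supp.1 h1))
  obtain ⟨b, hb⟩ := prop_of_tan ht hBc hG.2.2 hT.2.2 (fun i hi => by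
    have h1 : i ∈ supp s := by rw [hB] at hi; simpa using hi
    have h2 : lam t i = 0 := by simpa [mem_supp] using hi
    have := hx i
    rw [h2, mul_zero, zero_add] at this
    exact (mul_eq_zero.1 this).resolve_left (mem_supp.1 h1))
  exact ⟨a, b, ha, hb⟩

end CT

namespace CT

open Filter Topology

/-! ### counting the zeros of the start system -/

def Lset (A : Finset (Fin 6)) : Set (Fin 5 → Fin 5 → ℂ) :=
  {P | ∃ s : E5, s ≠ 0 ∧ supp s ⊆ A ∧ tri F0 s s s = 0 ∧ P = prj s}

/-- the vector with three nonzero coordinates -/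
def v3 (a b c : Fin 6) (x : ℂ) : Fin 6 → ℂ := fun i => if i = a then 1 else if i = b then x else if i = c then -1 - x else 0

theorem v3_sum {a b c : Fin 6} (hab : a ≠ b) (hac : a ≠ c) (hbc : b ≠ c) (x : ℂ) : ∑ i, v3 a b c x i = 0 := by
  rw [sum_of_supp (A := {a, b, c}), Finset.sum_insert (by simp [hab, hac]), Finset.sum_pair hbc]
  · simp [v3, hab.symm, hac.symm, hbc.symm]
  · intro i hi
    simp only [Finset.mem_insert, Finset.mem_singleton, not_or] at hi
    simp [v3, hi]

theorem F0_v3 {a b c : Fin 6} (hab : a ≠ b) (hac : a ≠ c) (hbc : b ≠ c) {s : E5} (hs : ∀ i ∉ ({a, b, c} : Finset (Fin 6)), lam s i = 0) :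
    tri F0 s s s = cc a * lam s a ^ 3 + cc b * lam s b ^ 3 + cc c * lam s c ^ 3 := by
  rw [tri_F0, sum_of_supp (A := {a, b, c}), Finset.sum_insert (by simp [hab, hac]), Finset.sum_pair hbc]
  · ring
  · intro i hi
    rw [hs i hi]; ring

def cubq (a b c : Fin 6) : Polynomial ℂ :=
  Polynomial.C (cc b - cc c) * Polynomial.X ^ 3 + Polynomial.C (-3 * cc c) * Polynomial.X ^ 2 +
    Polynomial.C (-3 * cc c) * Polynomial.X + Polynomial.C (cc a - cc c)

theorem cubq_eval (a b c : Fin 6) (x : ℂ) : (cubq a b c).eval x = cc a + cc b * x ^ 3 + cc c * (-1 - x) ^ 3 := by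
  simp [cubq]; ring

theorem cubq_der_eval (a b c : Fin 6) (x : ℂ) : (Polynomial.derivative (cubq a b c)).eval x = 3 * (cc b * x ^ 2 - cc c * (-1 - x) ^ 2) := by
  simp [cubq, Polynomial.derivative_pow]; ring

theorem cubq_deg {a b c : Fin 6} (hbc : b ≠ c) : (cubq a b c).natDegree = 3 :=
  Polynomial.natDegree_cubic (sub_ne_zero.2 fun h => hbc (cc_inj h))

theorem cubq_nodup {a b c : Fin 6} (hab : a ≠ b) (hac : a ≠ c) (hbc : b ≠ c) : (cubq a b c).roots.Nodup := by
  have hq : cubq a b c ≠ 0 := fun h => by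
    have := cubq_deg (a := a) hbc
    rw [h] at this; simp at this
  rw [Multiset.nodup_iff_count_le_one]
  intro x
  rw [Polynomial.count_roots]
  by_contra hlt
  rw [not_le, Polynomial.one_lt_rootMultiplicity_iff_isRoot hq] at hlt
  obtain ⟨h1, h2⟩ := hlt
  rw [Polynomial.IsRoot, cubq_eval] at h1
  rw [Polynomial.IsRoot, cubq_der_eval] at h2
  have h3 : cc b * x ^ 2 = cc c * (-1 - x) ^ 2 := by linear_combination (1/3) * h2
  have h4 : cc a = cc c * (-1 - x) ^ 2 := by linear_combination h1 - x * h3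
  have := sgn (S := v3 a b c x) (m := cc a) ?_ (v3_sum hab hac hbc x)
  · have := congrFun this a
    simp [v3] at this
  · intro i
    by_cases ha : i = a
    · right; subst ha; simp [v3]
    by_cases hb : i = b
    · right; subst hb; simp [v3, ha]; rw [h3, h4]
    by_cases hc : i = c
    · right; subst hc; simp [v3, ha, hb]; rw [h4]
    left; simp [v3, ha, hb, hc]

theorem lset_ncard {A : Finset (Fin 6)} (hA : A.card = 3) : (Lset A).Finite ∧ (Lset A).ncard = 3 := by
  obtain ⟨a, b, c, hab, hac, hbc, hA'⟩ := Finset.card_eq_three.1 hA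
  have hl : ∀ x, lam (unlam (v3 a b c x)) = v3 a b c x := fun x => lam_unlam (v3_sum hab hac hbc x)
  have hq : cubq a b c ≠ 0 := fun h => by
    have := cubq_deg (a := a) hbc
    rw [h] at this; simp at this
  have hne : ∀ x, unlam (v3 a b c x) ≠ 0 := by
    intro x h
    have := congrFun (hl x) a
    rw [h] at this
    simp [v3] at this
    fin_cases a <;> simp [lam] at this
  have himg : Lset A = (fun x => prj (unlam (v3 a b c x))) '' ((cubq a b c).roots.toFinset : Set ℂ) := by
    ext P
    constructor
    · rintro ⟨s, hs, hsub, hF, rfl⟩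
      have hsA : supp s = A := Finset.eq_of_subset_of_card_le hsub (by rw [hA]; exact supp_card hs hF)
      have ha : lam s a ≠ 0 := mem_supp.1 (by rw [hsA, hA']; simp)
      have hz : ∀ i ∉ ({a, b, c} : Finset (Fin 6)), lam s i = 0 := fun i hi => by
        rw [← hA', ← hsA] at hi; simpa [mem_supp] using hi
      have h1 := sum_lam s
      rw [sum_of_supp hz, Finset.sum_insert (by simp [hab, hac]), Finset.sum_pair hbc] at h1
      rw [F0_v3 hab hac hbc hz] at hF
      have ec : lam s c = - lam s a - lam s b := by linear_combination h1
      refine ⟨lam s b / lam s a, ?_, ?_⟩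
      · simp only [Finset.mem_coe, Multiset.mem_toFinset, Polynomial.mem_roots hq, Polynomial.IsRoot, cubq_eval]
        rw [ec] at hF
        field_simp
        linear_combination hF
      · have : s = lam s a • unlam (v3 a b c (lam s b / lam s a)) := by
          apply lam_inj
          funext i
          rw [lam_smul, hl]
          by_cases ha' : i = a
          · subst ha'; simp [v3]
          by_cases hb : i = b
          · subst hb; simp [v3, ha']; field_simp
          by_cases hc : i = c
          · subst hc; simp [v3, ha', hb]; rw [ec]; field_simp
          rw [hz i (by simp [ha', hb, hc])]; simp [v3, ha', hb, hc]
        conv_rhs => rw [this]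
        rw [prj_smul ha]
    · rintro ⟨x, hx, rfl⟩
      simp only [Finset.mem_coe, Multiset.mem_toFinset, Polynomial.mem_roots hq, Polynomial.IsRoot, cubq_eval] at hx
      have hz : ∀ i ∉ ({a, b, c} : Finset (Fin 6)), lam (unlam (v3 a b c x)) i = 0 := by
        intro i hi
        simp only [Finset.mem_insert, Finset.mem_singleton, not_or] at hi
        rw [hl]; simp [v3, hi]
      refine ⟨_, hne x, ?_, ?_, rfl⟩
      · intro i hi
        rw [mem_supp] at hi
        by_contra h
        rw [hA'] at h
        exact hi (hz i h)
      · rw [F0_v3 hab hac hbc hz, hl]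
        simp [v3, hab.symm, hac.symm, hbc.symm]
        linear_combination hx
  have hinj : Function.Injective (fun x => prj (unlam (v3 a b c x))) := by
    intro x y hxy
    obtain ⟨r, hr, h⟩ := prj_eq (hne x) (hne y) hxy
    have h1 := congrArg (fun s => lam s a) h
    have h2 := congrArg (fun s => lam s b) h
    simp only [lam_smul, hl] at h1 h2
    simp [v3, hab.symm] at h1 h2
    rw [← h1, one_mul] at h2
    exact h2.symm
  rw [himg]
  refine ⟨(Finset.finite_toSet _).image _, ?_⟩
  rw [Set.ncard_image_of_injective _ hinj, Set.ncard_coe_finset, Multiset.toFinset_card_of_nodup (cubq_nodup hab hac hbc),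
    Polynomial.splits_iff_card_roots.1 (IsAlgClosed.splits (cubq a b c)), cubq_deg (a := a) hbc]

/-- cardinality of a finite disjoint union -/
theorem ncard_biUnion {α β : Type*} [DecidableEq α] (I : Finset α) (f : α → Set β) (n : ℕ) (hf : ∀ a ∈ I, (f a).Finite ∧ (f a).ncard = n)
    (hd : ∀ a ∈ I, ∀ b ∈ I, a ≠ b → Disjoint (f a) (f b)) :
    (⋃ a ∈ I, f a).Finite ∧ (⋃ a ∈ I, f a).ncard = I.card * n := by
  induction I using Finset.induction_on with
  | empty => simp
  | insert a I ha ih =>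
    obtain ⟨h1, h2⟩ := ih (fun b hb => hf b (Finset.mem_insert_of_mem hb))
      (fun b hb c hc => hd b (Finset.mem_insert_of_mem hb) c (Finset.mem_insert_of_mem hc))
    obtain ⟨h3, h4⟩ := hf a (Finset.mem_insert_self a I)
    have e : (⋃ b ∈ insert a I, f b) = f a ∪ ⋃ b ∈ I, f b := by
      rw [Finset.set_biUnion_insert]
    rw [e]
    refine ⟨h3.union h1, ?_⟩
    rw [Set.ncard_union_eq ?_ h3 h1, h2, h4, Finset.card_insert_of_notMem ha]
    · ring
    · rw [Set.disjoint_iUnion₂_right]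
      intro b hb
      exact hd a (Finset.mem_insert_self a I) b (Finset.mem_insert_of_mem hb) (fun h => ha (h ▸ hb))

theorem zset_E0 : (Zset F0 0 E0).Finite ∧ (Zset F0 0 E0).ncard = 180 := by
  have e : Zset F0 0 E0 = ⋃ A ∈ Finset.powersetCard 3 (Finset.univ : Finset (Fin 6)), Lset A ×ˢ Lset Aᶜ := by
    ext ⟨P, Q⟩
    simp only [Set.mem_iUnion, Finset.mem_powersetCard, Set.mem_prod]
    constructor
    · rintro ⟨s, t, hs, ht, hZ, hPQ⟩
      obtain ⟨hG, h0⟩ := (zer_zero smooth_F0 hs ht).1 hZ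
      obtain ⟨h1, h2⟩ := gam_supp hs ht hG h0
      simp only [Prod.mk.injEq] at hPQ
      exact ⟨supp s, ⟨Finset.subset_univ _, h1⟩, ⟨s, hs, subset_rfl, hG.2.1, hPQ.1⟩, ⟨t, ht, h2.subset, hG.2.2, hPQ.2⟩⟩
    · rintro ⟨A, ⟨-, hA⟩, ⟨s, hs, h1, h2, rfl⟩, ⟨t, ht, h3, h4, rfl⟩⟩
      have hm : ∀ i, lam s i * lam t i = 0 := by
        intro i
        by_cases hi : i ∈ A
        · have : i ∉ supp t := fun h => by simpa [hi] using h3 h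
          have : lam t i = 0 := by simpa [mem_supp] using this
          rw [this, mul_zero]
        · have : i ∉ supp s := fun h => hi (h1 h)
          have : lam s i = 0 := by simpa [mem_supp] using this
          rw [this, zero_mul]
      refine ⟨s, t, hs, ht, (zer_zero smooth_F0 hs ht).2 ⟨⟨fun x => ?_, h2, h4⟩, hm 5⟩, rfl⟩
      rw [tri_F0]
      refine Finset.sum_eq_zero fun i _ => ?_
      rw [mul_assoc (cc i), hm i]; ring
  rw [e]
  have := ncard_biUnion (Finset.powersetCard 3 (Finset.univ : Finset (Fin 6))) (fun A => Lset A ×ˢ Lset Aᶜ) 9 ?_ ?_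
  · refine ⟨this.1, this.2.trans ?_⟩
    rw [Finset.card_powersetCard]; rfl
  · intro A hA
    rw [Finset.mem_powersetCard] at hA
    have hA' : Aᶜ.card = 3 := by rw [Finset.card_compl, hA.2]; rfl
    obtain ⟨h1, h2⟩ := lset_ncard hA.2
    obtain ⟨h3, h4⟩ := lset_ncard hA'
    refine ⟨h1.prod h3, ?_⟩
    rw [Set.ncard_prod, h2, h4]
  · intro A hA B hB hAB
    rw [Finset.mem_powersetCard] at hA hB
    rw [Set.disjoint_left]
    rintro ⟨P, Q⟩ ⟨⟨s, hs, h1, h2, h3⟩, -⟩ ⟨⟨s', hs', h1', h2', h3'⟩, -⟩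
    apply hAB
    have e1 : supp s = A := Finset.eq_of_subset_of_card_le h1 (by rw [hA.2]; exact supp_card hs h2)
    have e2 : supp s' = B := Finset.eq_of_subset_of_card_le h1' (by rw [hB.2]; exact supp_card hs' h2')
    obtain ⟨r, hr, h⟩ := prj_eq hs hs' (h3.symm.trans h3')
    rw [← e1, ← e2]
    ext i
    rw [mem_supp, mem_supp, h, lam_smul]
    simp [hr]

end CT

namespace CT

open Filter Topology

/-! ### the start system of degree eight -/

theorem exists_dual : ∃ l : Module.Dual ℂ E5, ∀ s t, s ≠ 0 → t ≠ 0 → Gam F0 s t → E0 s t = 0 → l s ≠ 0 ∧ l t ≠ 0 := by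
  have hf := zset_E0.1
  have hfin : Finite (Zset F0 0 E0) := hf
  have hch : ∀ z : Zset F0 0 E0, ∃ s t, s ≠ 0 ∧ t ≠ 0 ∧ z.1 = (prj s, prj t) := by
    rintro ⟨z, s, t, hs, ht, -, h⟩
    exact ⟨s, t, hs, ht, h⟩
  choose a b ha hb hab using hch
  obtain ⟨l, hl⟩ := Module.exists_dual_forall_apply_ne_zero (K := ℂ) (M := E5) (Sum.elim a b) (by
    rintro (i | i)
    · exact ha i
    · exact hb i)
  refine ⟨l, fun s t hs ht hG h0 => ?_⟩
  let z : Zset F0 0 E0 := ⟨(prj s, prj t), s, t, hs, ht, (zer_zero smooth_F0 hs ht).2 ⟨hG, h0⟩, rfl⟩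
  have h1 := hab z
  simp only [z, Prod.mk.injEq] at h1
  obtain ⟨r, hr, h2⟩ := prj_eq (ha z) hs h1.1.symm
  obtain ⟨r', hr', h2'⟩ := prj_eq (hb z) ht h1.2.symm
  have h3 := hl (Sum.inl z)
  have h4 := hl (Sum.inr z)
  rw [h2, h2']
  simp only [map_smul, smul_eq_mul]
  exact ⟨mul_ne_zero hr h3, mul_ne_zero hr' h4⟩

def gl (l : Module.Dual ℂ E5) (τ : ℂ) (s t : E5) : ℂ := E0 s t + τ * (l s * l t)

theorem polyG_lin (l : Module.Dual ℂ E5) : (PolyG fun s _ => l s) ∧ (PolyG fun _ t => l t) := by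
  have h : ∀ s : E5, l s = ∑ i, s i * l (bv i) := by
    intro s
    conv_lhs => rw [vec_eq_sum s]
    simp
  unfold PolyG
  constructor
  · have e : (fun z : Fin 5 ⊕ Fin 5 → ℂ => l (fun i => z (Sum.inl i))) = fun z => ∑ i, z (Sum.inl i) * l (bv i) := by
      funext z; exact h _
    rw [e]
    exact IsPoly.sum fun i => (IsPoly.coord _).mul (IsPoly.const _)
  · have e : (fun z : Fin 5 ⊕ Fin 5 → ℂ => l (fun i => z (Sum.inr i))) = fun z => ∑ i, z (Sum.inr i) * l (bv i) := by
      funext z; exact h _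
    rw [e]
    exact IsPoly.sum fun i => (IsPoly.coord _).mul (IsPoly.const _)

theorem polyG_gl (l : Module.Dual ℂ E5) (τ : ℂ) : PolyG (gl l τ) :=
  IsPoly.add polyG_E0 ((IsPoly.const τ).mul ((polyG_lin l).1.mul (polyG_lin l).2))

theorem gl_smul (l : Module.Dual ℂ E5) (τ a b : ℂ) (s t : E5) : gl l τ (a • s) (b • t) = a * b * gl l τ s t := by
  simp only [gl, E0_smul, map_smul, smul_eq_mul]; ring

def glFam (l : Module.Dual ℂ E5) : Fam where
  F := fun _ => F0
  σ := fun _ => 0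
  g := gl l
  hF := contDiff_const
  hσ := contDiff_const
  hg := (polyG_E0.contDiff.comp contDiff_snd).add (contDiff_fst.mul
    (((polyG_lin l).1.contDiff.comp contDiff_snd).mul ((polyG_lin l).2.contDiff.comp contDiff_snd)))
  hom := fun τ => ⟨1, fun a b s t => by rw [gl_smul]; ring, Or.inl rfl⟩

def G0 (l : Module.Dual ℂ E5) (T : Finset ℂ) (s t : E5) : ℂ := ∏ τ ∈ T, gl l τ s t

theorem start_system : ∃ G : E5 → E5 → ℂ, PolyG G ∧ (∀ (a b : ℂ) s t, G (a • s) (b • t) = a ^ 8 * b ^ 8 * G s t) ∧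
    GoodQ F0 0 G ∧ (Zset F0 0 G).ncard = 1440 := by
  obtain ⟨l, hl⟩ := exists_dual
  have e0 : gl l 0 = E0 := by funext s t; simp [gl]
  have hg0 : GoodQ ((glFam l).F 0) ((glFam l).σ 0) ((glFam l).g 0) := by
    show GoodQ F0 0 (gl l 0)
    rw [e0]; exact good_E0
  have h1 := ((glFam l).local_const 0 hg0).2
  have h2 := (glFam l).good_open 0 hg0
  have h3 : {τ : ℂ | GoodQ F0 0 (gl l τ) ∧ (Zset F0 0 (gl l τ)).Finite ∧ (Zset F0 0 (gl l τ)).ncard = 180} ∈ 𝓝 (0 : ℂ) := by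
    filter_upwards [h1, h2] with τ k1 k2
    refine ⟨k2, k1.1, k1.2.trans ?_⟩
    show (Zset F0 0 (gl l 0)).ncard = 180
    rw [e0]; exact zset_E0.2
  obtain ⟨T, hT, hT8⟩ := (infinite_of_mem_nhds (0 : ℂ) h3).exists_subset_card_eq 8
  have hdis : ∀ s t, s ≠ 0 → t ≠ 0 → Gam F0 s t → ∀ τ τ', τ ≠ τ' → gl l τ s t = 0 → gl l τ' s t ≠ 0 := by
    intro s t hs ht hG τ τ' hne k1 k2
    have k3 : (τ - τ') * (l s * l t) = 0 := by
      unfold gl at k1 k2; linear_combination k1 - k2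
    have k4 := (mul_eq_zero.1 k3).resolve_left (sub_ne_zero.2 hne)
    have k5 : E0 s t = 0 := by unfold gl at k1; rw [k4] at k1; linear_combination k1
    obtain ⟨k6, k7⟩ := hl s t hs ht hG k5
    exact mul_ne_zero k6 k7 k4
  have hP : ∀ T' : Finset ℂ, PolyG (G0 l T') := fun T' => IsPoly.prod fun τ => polyG_gl l τ
  refine ⟨G0 l T, hP T, ?_, ?_, ?_⟩
  · intro a b s t
    simp only [G0, gl_smul]
    rw [Finset.prod_mul_distrib, Finset.prod_const, hT8]; ring
  · rw [goodQ_zero (hP T) smooth_F0]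
    intro s t hs ht hG h0 s' t' hTan hD
    obtain ⟨τ, hτ, hz⟩ := Finset.prod_eq_zero_iff.1 h0
    have hgood := (goodQ_zero (polyG_gl l τ) smooth_F0).1 (hT hτ).1 s t hs ht hG hz
    refine hgood s' t' hTan ?_
    have e : (fun ε : ℂ => G0 l T (s + ε • s') (t + ε • t')) = fun ε : ℂ => gl l τ (s + ε • s') (t + ε • t') *
        G0 l (T.erase τ) (s + ε • s') (t + ε • t') := by
      funext ε
      exact (Finset.mul_prod_erase T (fun τ => gl l τ (s + ε • s') (t + ε • t')) hτ).symm
    have hder := (((polyG_gl l τ).diff s t s' t').hasDerivAt.fun_mul ((hP (T.erase τ)).diff s t s' t').hasDerivAt).deriv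
    rw [e, hder] at hD
    simp only [zero_smul, add_zero, hz, zero_mul] at hD
    refine (mul_eq_zero.1 hD).resolve_right ?_
    refine Finset.prod_ne_zero_iff.2 fun τ' hτ' => ?_
    exact hdis s t hs ht hG τ τ' (Finset.ne_of_mem_erase hτ').symm hz
  · have e : Zset F0 0 (G0 l T) = ⋃ τ ∈ T, Zset F0 0 (gl l τ) := by
      ext z
      simp only [Set.mem_iUnion]
      constructor
      · rintro ⟨s, t, hs, ht, hZ, hz⟩
        obtain ⟨hG, h0⟩ := (zer_zero smooth_F0 hs ht).1 hZ
        obtain ⟨τ, hτ, h0⟩ := Finset.prod_eq_zero_iff.1 h0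
        exact ⟨τ, hτ, s, t, hs, ht, (zer_zero smooth_F0 hs ht).2 ⟨hG, h0⟩, hz⟩
      · rintro ⟨τ, hτ, s, t, hs, ht, hZ, hz⟩
        obtain ⟨hG, h0⟩ := (zer_zero smooth_F0 hs ht).1 hZ
        exact ⟨s, t, hs, ht, (zer_zero smooth_F0 hs ht).2 ⟨hG, Finset.prod_eq_zero hτ h0⟩, hz⟩
    rw [e]
    have := ncard_biUnion T (fun τ => Zset F0 0 (gl l τ)) 180 (fun τ hτ => (hT hτ).2) ?_
    · rw [this.2, hT8]
    · intro τ hτ τ' hτ' hne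
      rw [Set.disjoint_left]
      rintro z ⟨s, t, hs, ht, hZ, hz⟩ ⟨s', t', hs', ht', hZ', hz'⟩
      obtain ⟨hG, h0⟩ := (zer_zero smooth_F0 hs ht).1 hZ
      obtain ⟨hG', h0'⟩ := (zer_zero smooth_F0 hs' ht').1 hZ'
      rw [hz] at hz'
      simp only [Prod.mk.injEq] at hz'
      obtain ⟨a, ha, ea⟩ := prj_eq hs hs' hz'.1
      obtain ⟨b, hb, eb⟩ := prj_eq ht ht' hz'.2
      rw [ea, eb, gl_smul] at h0'
      exact hdis s t hs ht hG τ τ' hne h0 ((mul_eq_zero.1 h0').resolve_left (mul_ne_zero ha hb))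

theorem zset_1440 {F : Cub} (h : GoodQ F 1 (fun _ _ => 0)) :
    (Zset F 1 (fun _ _ => 0)).Finite ∧ (Zset F 1 (fun _ _ => 0)).ncard = 1440 := by
  obtain ⟨G, h1, h2, h3, h4⟩ := start_system
  have := global_const h1 h2 h h3
  exact ⟨this.1, this.2.trans h4⟩

end CT

namespace CT

open Filter Topology

theorem exists_vanish {ι κ : Type} [Fintype ι] [Fintype κ] (f : κ → MvPolynomial ι ℂ) (h : Fintype.card ι < Fintype.card κ) :
    ∃ P : MvPolynomial κ ℂ, P ≠ 0 ∧ ∀ x : ι → ℂ, eval (fun k => eval x (f k)) P = 0 := by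
  have hn : ¬ AlgebraicIndependent ℂ f := by
    intro hf
    have := hf.lift_cardinalMk_le_trdeg
    rw [MvPolynomial.trdeg_of_isDomain] at this
    simp at this
    omega
  rw [AlgebraicIndependent, injective_iff_map_eq_zero] at hn
  push Not at hn
  obtain ⟨P, hP, hP0⟩ := hn
  refine ⟨P, hP0, fun x => ?_⟩
  have h2 : (eval x).comp (aeval f : MvPolynomial κ ℂ →ₐ[ℂ] MvPolynomial ι ℂ).toRingHom = eval (fun k => eval x (f k)) := by
    ext i
    · simp
    · simp
  rw [← h2]
  show eval x (aeval f P) = 0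
  rw [hP, map_zero]

/-- properties that fail for the general cubic -/
def Thin (Q : Cub → Prop) : Prop := ∃ P : MvPolynomial (Sym (Fin 5) 3) ℂ, P ≠ 0 ∧ ∀ F, Q F → eval F P = 0

theorem Thin.mono {Q Q' : Cub → Prop} (h : Thin Q) (h' : ∀ F, Q' F → Q F) : Thin Q' := by
  obtain ⟨P, h1, h2⟩ := h
  exact ⟨P, h1, fun F hF => h2 F (h' F hF)⟩

theorem Thin.or {Q Q' : Cub → Prop} (h : Thin Q) (h' : Thin Q') : Thin fun F => Q F ∨ Q' F := by
  obtain ⟨P, h1, h2⟩ := h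
  obtain ⟨P', h1', h2'⟩ := h'
  refine ⟨P * P', mul_ne_zero h1 h1', fun F hF => ?_⟩
  rcases hF with hF | hF
  · simp [h2 F hF]
  · simp [h2' F hF]

theorem Thin.ex {α : Type*} [Fintype α] {Q : α → Cub → Prop} (h : ∀ a, Thin (Q a)) : Thin fun F => ∃ a, Q a F := by
  choose P h1 h2 using h
  refine ⟨∏ a, P a, Finset.prod_ne_zero_iff.2 fun a _ => h1 a, ?_⟩
  rintro F ⟨a, ha⟩
  rw [map_prod]
  exact Finset.prod_eq_zero (Finset.mem_univ a) (h2 a F ha)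

theorem pull_smul (n : Fin 5 → E5) (c : ℂ) (a : Cub) : pull n (c • a) = c • pull n a := by
  funext d
  simp [pull, tri_cub_smul]

theorem pull_adj (n : Fin 5 → E5) (F : Cub) :
    pull (fun i => (Matrix.of n).adjugate i) (pull n F) = (fdet n) ^ 3 • F := by
  apply tri_ext
  intro x y z
  have key : ∀ x : E5, (∑ j, (∑ i, x i • (Matrix.of n).adjugate i) j • n j) = fdet n • x := by
    intro x
    have h := Matrix.adjugate_mul (Matrix.of n)
    funext k
    have h2 : ∀ i, ∑ j, (Matrix.of n).adjugate i j * n j k = if i = k then fdet n else 0 := by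
      intro i
      have := congrFun (congrFun h i) k
      rw [Matrix.mul_apply] at this
      simp only [Matrix.of_apply] at this
      rw [this]
      simp [Matrix.one_apply, fdet]
    simp only [Finset.sum_apply, Pi.smul_apply, smul_eq_mul, Finset.sum_mul]
    rw [Finset.sum_comm]
    simp only [mul_assoc, ← Finset.mul_sum, h2]
    simp [mul_comm]
  rw [tri_pull, tri_pull, key, key, key, tri_smul1, tri_smul2, tri_smul3, tri_cub_smul]
  ring

theorem pull_inv {n : Fin 5 → E5} (hn : fdet n ≠ 0) (F : Cub) :
    F = pull (fun i => (Matrix.of n).adjugate i) ((fdet n ^ 3)⁻¹ • pull n F) := by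
  rw [pull_smul, pull_adj, smul_smul, inv_mul_cancel₀ (pow_ne_zero 3 hn), one_smul]

theorem IsPoly.adj {ι : Type} {n : (ι → ℂ) → Fin 5 → E5} (hn : ∀ i k, IsPoly fun v => n v i k) (i k : Fin 5) :
    IsPoly fun v => (Matrix.of (n v)).adjugate i k := by
  simp only [Matrix.adjugate_apply]
  refine IsPoly.fdet (m := fun v => Matrix.updateRow (Matrix.of (n v)) k (Pi.single i 1)) ?_
  intro a b
  by_cases h : a = k
  · subst h; simp only [Matrix.updateRow_self]; exact IsPoly.const _
  · simp only [Matrix.updateRow_ne h]; exact hn a b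

theorem nullfam {ι : Type} [Fintype ι] {n : (ι → ℂ) → Fin 5 → E5} (hn : ∀ i k, IsPoly fun v => n v i k)
    (I : Finset (Sym (Fin 5) 3)) (hI : Fintype.card ι < I.card) :
    Thin fun F => ∃ y, fdet (n y) ≠ 0 ∧ ∀ d ∈ I, pull (n y) F d = 0 := by
  let κ := {d : Sym (Fin 5) 3 // d ∉ I}
  let a : (ι ⊕ κ → ℂ) → Cub := fun v d => if h : d ∈ I then 0 else v (Sum.inr ⟨d, h⟩)
  have ha : ∀ d, IsPoly fun v => a v d := by
    intro d
    by_cases h : d ∈ I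
    · simp only [a, h, dif_pos]; exact IsPoly.const _
    · simp only [a, h, dif_neg, not_false_iff]; exact IsPoly.coord _
  have hm : ∀ i k, IsPoly fun v : ι ⊕ κ → ℂ => (Matrix.of (n fun i => v (Sum.inl i))).adjugate i k :=
    IsPoly.adj (n := fun v : ι ⊕ κ → ℂ => n fun i => v (Sum.inl i)) fun i k => (hn i k).inl
  have hp : ∀ d, IsPoly fun v : ι ⊕ κ → ℂ => pull (fun i => (Matrix.of (n fun i => v (Sum.inl i))).adjugate i) (a v) d := by
    intro d
    exact IsPoly.tri ha (hm _) (hm _) (hm _)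
  choose p hp using hp
  have hcard : Fintype.card (ι ⊕ κ) < Fintype.card (Sym (Fin 5) 3) := by
    have h1 : Fintype.card κ = Fintype.card (Sym (Fin 5) 3) - I.card := by
      simp only [κ]
      rw [Fintype.card_subtype_compl (fun d => d ∈ I)]
      simp
    have h2 : I.card ≤ Fintype.card (Sym (Fin 5) 3) := Finset.card_le_univ I
    rw [Fintype.card_sum, h1]; omega
  obtain ⟨P, hP, hP2⟩ := exists_vanish p hcard
  refine ⟨P, hP, ?_⟩
  rintro F ⟨y, hy, hF⟩
  let v : ι ⊕ κ → ℂ := Sum.elim y fun d => (fdet (n y) ^ 3)⁻¹ * pull (n y) F d.1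
  have hv : F = fun d => eval v (p d) := by
    funext d
    rw [← hp]
    have e : a v = (fdet (n y) ^ 3)⁻¹ • pull (n y) F := by
      funext d
      by_cases h : d ∈ I
      · simp [a, h, hF d h]
      · simp [a, h, v]
    show F d = pull (fun i => (Matrix.of (n y)).adjugate i) (a v) d
    rw [e, ← pull_inv hy]
  rw [hv]
  exact hP2 v

end CT

namespace CT

/-! ### families of special cubics -/

abbrev UIdx (r : ℕ) : Type := {p : Fin 5 × Fin 5 // p.1.1 < r ∧ p.1 < p.2}

theorem nullpat (SL : Finset (Fin 5 × Fin 5)) (hSL : ∀ p ∈ SL, p.2 < p.1) (r : ℕ) (T : Finset (Fin 5 × Fin 5 × Fin 5))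
    (hT : SL.card + Fintype.card (UIdx r) < (T.image fun q => mk3 q.1 q.2.1 q.2.2).card) :
    Thin fun F => ∃ (π : Equiv.Perm (Fin 5)) (L U : Fin 5 → Fin 5 → ℂ), (∀ i, L i i = 1) ∧
      (∀ i j, i ≠ j → (i, j) ∉ SL → L i j = 0) ∧
      ∀ q ∈ T, tri F (fam π L (upr fun i k => if i.1 < r then U i k else 0) q.1)
        (fam π L (upr fun i k => if i.1 < r then U i k else 0) q.2.1)
        (fam π L (upr fun i k => if i.1 < r then U i k else 0) q.2.2) = 0 := by
  refine Thin.ex fun π => ?_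
  let LL : (SL ⊕ UIdx r → ℂ) → Fin 5 → Fin 5 → ℂ := fun y i j => if i = j then 1 else if h : (i, j) ∈ SL then y (Sum.inl ⟨(i, j), h⟩) else 0
  let UU : (SL ⊕ UIdx r → ℂ) → Fin 5 → Fin 5 → ℂ := fun y i j => if h : i.1 < r ∧ i < j then y (Sum.inr ⟨(i, j), h⟩) else 0
  have hL : ∀ i j, IsPoly fun y => LL y i j := by
    intro i j
    simp only [LL]
    split_ifs
    · exact IsPoly.const _
    · exact IsPoly.coord _
    · exact IsPoly.const _
  have hU : ∀ i j, IsPoly fun y => upr (UU y) i j := by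
    intro i j
    simp only [UU, upr]
    split_ifs
    · exact IsPoly.const _
    · exact IsPoly.coord _
    · exact IsPoly.const _
    · exact IsPoly.const _
  have hn : ∀ i k, IsPoly fun y => fam π (LL y) (upr (UU y)) i k := by
    intro i k
    simp only [fam, Finset.sum_apply, Pi.smul_apply, smul_eq_mul]
    exact IsPoly.sum fun j => (hL i j).mul (IsPoly.sum fun l => (hU j l).mul (IsPoly.const _))
  refine (nullfam hn (T.image fun q => mk3 q.1 q.2.1 q.2.2) ?_).mono ?_
  · rw [Fintype.card_sum]; simpa using hT
  · rintro F ⟨L, U, h1, h2, h3⟩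
    let y : SL ⊕ UIdx r → ℂ := Sum.elim (fun p => L p.1.1 p.1.2) (fun p => U p.1.1 p.1.2)
    have e1 : LL y = L := by
      funext i j
      by_cases hij : i = j
      · subst hij; simp [LL, h1]
      · by_cases h : (i, j) ∈ SL
        · simp [LL, hij, h, y]
        · simp [LL, hij, h, h2]
    have e2 : upr (UU y) = upr fun i k => if i.1 < r then U i k else 0 := by
      funext i j
      unfold upr
      by_cases a : i = j
      · simp [a]
      by_cases b : i < j
      · by_cases c : i.1 < r
        · simp [a, UU, b, c, y]
        · simp [a, UU, c]
      · simp [a, b]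
    refine ⟨y, ?_, ?_⟩
    · refine fdet_fam π (UU y) ?_ ?_
      · intro i; simp [LL]
      · intro i j hij
        have : (i, j) ∉ SL := fun h => absurd (hSL _ h) (not_lt.2 hij.le)
        simp [LL, hij.ne, this]
    · intro d hd
      obtain ⟨q, hq, rfl⟩ := Finset.mem_image.1 hd
      rw [pull_mk3, e1, e2]
      exact h3 q hq

def T7 : Finset (Fin 5 × Fin 5 × Fin 5) := {(0,0,0), (1,1,1), (0,0,1), (0,1,1), (0,1,2), (0,1,3), (0,1,4)}

/-- rows of the triangular factor -/
def wr (π : Equiv.Perm (Fin 5)) (U : Fin 5 → Fin 5 → ℂ) (j : Fin 5) : E5 := ∑ k, upr U j k • bv (π k)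

theorem fam_eq (π : Equiv.Perm (Fin 5)) (L U : Fin 5 → Fin 5 → ℂ) (i : Fin 5) : fam π L (upr U) i = ∑ j, L i j • wr π U j := rfl

theorem wr_trunc (π : Equiv.Perm (Fin 5)) (U : Fin 5 → Fin 5 → ℂ) (r : ℕ) (j : Fin 5) (hj : j.1 < r) :
    wr π (fun i k => if i.1 < r then U i k else 0) j = wr π U j := by
  unfold wr
  refine Finset.sum_congr rfl fun k _ => ?_
  simp [upr, hj]

/-- conditions on `F` expressed by a frame -/
def Sing (F : Cub) : Prop := ∃ p : E5, p ≠ 0 ∧ ∀ x, tri F p p x = 0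
def Triple (F : Cub) : Prop := ∃ s t c : E5, LinearIndependent ℂ ![s, t, c] ∧ Gam F s t ∧ tri F s s c = 0 ∧ tri F t t c = 0 ∧
  tri F s c c = 0 ∧ tri F t c c = 0
def Bad4a (F : Cub) : Prop := ∃ o a b d : E5, LinearIndependent ℂ ![o, a, b, d] ∧ Gam F o a ∧ tri F o o b = 0 ∧ tri F o o d = 0 ∧
  tri F o b b = 0 ∧ tri F a b b = 0 ∧ tri F b b b = 0 ∧ tri F o d d = 0 ∧ tri F a d d = 0 ∧ tri F d d d = 0
def Bad4b (F : Cub) : Prop := ∃ o a b d : E5, LinearIndependent ℂ ![o, a, b, d] ∧ Gam F o a ∧ tri F o o b = 0 ∧ tri F a a d = 0 ∧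
  tri F o b b = 0 ∧ tri F a b b = 0 ∧ tri F b b b = 0 ∧ tri F o d d = 0 ∧ tri F a d d = 0 ∧ tri F d d d = 0
def Bad5 (F : Cub) : Prop := ∃ s t c d : E5, LinearIndependent ℂ ![s, t, c, d] ∧ Gam F s t ∧ tri F s s c = 0 ∧ tri F t t c = 0 ∧
  tri F s c c = 0 ∧ tri F s s d = 0 ∧ tri F s c d = 0

theorem frame_w {n : Fin 5 → E5} (hn : LinearIndependent ℂ n) : ∃ (π : Equiv.Perm (Fin 5)) (L U : Fin 5 → Fin 5 → ℂ),
    (∀ i, L i i ≠ 0) ∧ n 0 = L 0 0 • wr π U 0 ∧ n 1 = L 1 0 • wr π U 0 + L 1 1 • wr π U 1 ∧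
    n 2 = L 2 0 • wr π U 0 + L 2 1 • wr π U 1 + L 2 2 • wr π U 2 ∧
    n 3 = L 3 0 • wr π U 0 + L 3 1 • wr π U 1 + L 3 2 • wr π U 2 + L 3 3 • wr π U 3 := by
  obtain ⟨π, L, U, h1, h2, h3⟩ := lup hn
  refine ⟨π, L, U, h1, ?_, ?_, ?_, ?_⟩ <;> rw [h3, fam_eq, Fin.sum_univ_five]
  · rw [h2 0 1 (by decide), h2 0 2 (by decide), h2 0 3 (by decide), h2 0 4 (by decide)]; simp
  · rw [h2 1 2 (by decide), h2 1 3 (by decide), h2 1 4 (by decide)]; simp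
  · rw [h2 2 3 (by decide), h2 2 4 (by decide)]; simp
  · rw [h2 3 4 (by decide)]; simp

theorem smul_solve {a : ℂ} (ha : a ≠ 0) {x y z : E5} (h : x = y + a • z) : z = a⁻¹ • (x - y) := by
  rw [h, add_sub_cancel_left, smul_smul, inv_mul_cancel₀ ha, one_smul]

theorem thin_sing : Thin Sing := by
  refine (nullpat ∅ (by simp) 1 {(0,0,0), (0,0,1), (0,0,2), (0,0,3), (0,0,4)} (by decide +kernel)).mono ?_
  rintro F ⟨p, hp, hx⟩
  obtain ⟨b, c, d, e, hli⟩ := extend1 hp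
  obtain ⟨π, L, U, hL, h0, -⟩ := frame_w hli
  simp only [Matrix.cons_val_zero] at h0
  refine ⟨π, fun i j => if i = j then 1 else 0, U, by simp, by simp +contextual, ?_⟩
  have k0 : fam π (fun i j => if i = j then 1 else 0) (upr fun i k => if i.1 < 1 then U i k else 0) 0 = (L 0 0)⁻¹ • p := by
    rw [fam_eq]
    simp only [ite_smul, one_smul, zero_smul, Finset.sum_ite_eq, Finset.mem_univ, if_true]
    rw [wr_trunc _ _ _ _ (by decide), h0, smul_smul, inv_mul_cancel₀ (hL 0), one_smul]
  intro q hq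
  simp only [Finset.mem_insert, Finset.mem_singleton] at hq
  rcases hq with rfl | rfl | rfl | rfl | rfl <;> simp only [k0, tri_smul1, tri_smul2, hx, mul_zero]

/-- the seven standard conditions -/
theorem t7_zero {F : Cub} {n : Fin 5 → E5} (h : Gam F (n 0) (n 1)) : ∀ q ∈ T7, tri F (n q.1) (n q.2.1) (n q.2.2) = 0 := by
  intro q hq
  simp only [T7, Finset.mem_insert, Finset.mem_singleton] at hq
  rcases hq with rfl | rfl | rfl | rfl | rfl | rfl | rfl
  · exact h.2.1
  · exact h.2.2
  · exact h.sst
  · exact h.1 _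
  · exact h.1 _
  · exact h.1 _
  · exact h.1 _

/-- all permutations of a vanishing value -/
theorem perm6 {F : Cub} {x y z : E5} (h : tri F x y z = 0) : tri F x y z = 0 ∧ tri F x z y = 0 ∧ tri F y x z = 0 ∧
    tri F y z x = 0 ∧ tri F z x y = 0 ∧ tri F z y x = 0 := by
  refine ⟨h, ?_, ?_, ?_, ?_, ?_⟩
  · rw [tri_comm23]; exact h
  · rw [tri_comm12]; exact h
  · rw [tri_comm23, tri_comm12]; exact h
  · rw [tri_comm12, tri_comm23]; exact h
  · rw [tri_comm13]; exact h

theorem gam6 {F : Cub} {s t : E5} (h : Gam F s t) : (∀ x, tri F s t x = 0) ∧ (∀ x, tri F t s x = 0) ∧ (∀ x, tri F s x t = 0) ∧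
    (∀ x, tri F t x s = 0) ∧ (∀ x, tri F x s t = 0) ∧ (∀ x, tri F x t s = 0) ∧ tri F s s s = 0 ∧ tri F t t t = 0 :=
  ⟨fun x => (perm6 (h.1 x)).1, fun x => (perm6 (h.1 x)).2.2.1, fun x => (perm6 (h.1 x)).2.1,
    fun x => (perm6 (h.1 x)).2.2.2.1, fun x => (perm6 (h.1 x)).2.2.2.2.1, fun x => (perm6 (h.1 x)).2.2.2.2.2, h.2.1, h.2.2⟩

/-- normalised frames with prescribed sparsity of the lower triangular factor -/
theorem frame_m {n : Fin 5 → E5} (hn : LinearIndependent ℂ n) : ∃ (π : Equiv.Perm (Fin 5)) (L U : Fin 5 → Fin 5 → ℂ),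
    (∀ i, L i i ≠ 0) ∧ wr π U 0 = (L 0 0)⁻¹ • n 0 ∧ (L 1 0 / L 1 1) • wr π U 0 + wr π U 1 = (L 1 1)⁻¹ • n 1 ∧
    (L 2 1 / L 2 2) • wr π U 1 + wr π U 2 = (L 2 2)⁻¹ • n 2 - (L 2 0 / L 2 2) • wr π U 0 ∧
    (L 3 0 / L 3 3) • wr π U 0 + (L 3 1 / L 3 3) • wr π U 1 + (L 3 2 / L 3 3) • wr π U 2 + wr π U 3 = (L 3 3)⁻¹ • n 3 ∧
    (∃ x y z : ℂ, wr π U 2 = x • n 0 + y • n 1 + z • n 2) ∧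
    (∃ x y z w : ℂ, wr π U 3 = x • n 0 + y • n 1 + z • n 2 + w • n 3) := by
  obtain ⟨π, L, U, hL, k0, k1, k2, k3⟩ := frame_w hn
  have g0 : wr π U 0 = (L 0 0)⁻¹ • n 0 := by rw [k0, smul_smul, inv_mul_cancel₀ (hL 0), one_smul]
  have g1 := smul_solve (hL 1) k1
  have g2 := smul_solve (hL 2) k2
  have g3 := smul_solve (hL 3) k3
  have f2 : ∃ x y z : ℂ, wr π U 2 = x • n 0 + y • n 1 + z • n 2 := by
    refine ⟨-(L 2 2)⁻¹ * (L 2 0 * (L 0 0)⁻¹ - L 2 1 * (L 1 1)⁻¹ * L 1 0 * (L 0 0)⁻¹), -(L 2 2)⁻¹ * L 2 1 * (L 1 1)⁻¹, (L 2 2)⁻¹, ?_⟩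
    rw [g2, g1, g0]
    module
  refine ⟨π, L, U, hL, g0, ?_, ?_, ?_, f2, ?_⟩
  · rw [g1]; simp only [div_eq_mul_inv]; module
  · rw [g2]; simp only [div_eq_mul_inv]; module
  · rw [g3]; simp only [div_eq_mul_inv]; module
  · obtain ⟨x, y, z, h⟩ := f2
    refine ⟨-(L 3 3)⁻¹ * (L 3 0 * (L 0 0)⁻¹ - L 3 1 * (L 1 1)⁻¹ * L 1 0 * (L 0 0)⁻¹ + L 3 2 * x),
      -(L 3 3)⁻¹ * (L 3 1 * (L 1 1)⁻¹ + L 3 2 * y), -(L 3 3)⁻¹ * L 3 2 * z, (L 3 3)⁻¹, ?_⟩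
    rw [g3, h, g1, g0]
    module

theorem Gam.smul2 {F : Cub} {s t : E5} (h : Gam F s t) (a b : ℂ) : Gam F (a • s) (b • t) :=
  ⟨fun x => by simp [tri_smul1, tri_smul2, h.1], by simp [tri_smul1, tri_smul2, tri_smul3, h.2.1],
    by simp [tri_smul1, tri_smul2, tri_smul3, h.2.2]⟩

theorem thin_triple : Thin Triple := by
  refine (nullpat {(1,0)} (by decide) 3 (T7 ∪ {(0,0,2), (1,1,2), (0,2,2), (1,2,2)}) (by decide +kernel)).mono ?_
  rintro F ⟨s, t, c, hli, hG, h1, h2, h3, h4⟩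
  obtain ⟨d, e, hli⟩ := extend3 hli
  obtain ⟨π, L, U, hL, k0, k1, -, -, ⟨x, y, z, k2⟩, -⟩ := frame_m hli
  simp only [Matrix.cons_val_zero, Matrix.cons_val_one, Matrix.cons_val] at k0 k1 k2
  refine ⟨π, fun i j => if i = j then 1 else if i = 1 ∧ j = 0 then L 1 0 / L 1 1 else 0, U, by simp, ?_, ?_⟩
  · intro i j hij hne
    simp only [Finset.mem_singleton, Prod.mk.injEq] at hne
    simp [hij, hne]
  set n := fam π (fun i j => if i = j then 1 else if i = 1 ∧ j = 0 then L 1 0 / L 1 1 else 0)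
    (upr fun i k => if i.1 < 3 then U i k else 0) with hn
  have e0 : n 0 = (L 0 0)⁻¹ • s := by rw [hn, fam_eq, Fin.sum_univ_five]; simp [wr_trunc, k0]
  have e1 : n 1 = (L 1 1)⁻¹ • t := by rw [hn, fam_eq, Fin.sum_univ_five]; simp [wr_trunc, k1]
  have e2 : n 2 = x • s + y • t + z • c := by rw [hn, fam_eq, Fin.sum_univ_five]; simp [wr_trunc, k2]
  intro q hq
  rcases Finset.mem_union.1 hq with hq | hq
  · exact t7_zero (by rw [e0, e1]; exact hG.smul2 _ _) q hq
  · simp only [Finset.mem_insert, Finset.mem_singleton] at hq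
    rcases hq with rfl | rfl | rfl | rfl <;>
    simp only [e0, e1, e2, tri_add1, tri_add2, tri_add3, tri_smul1, tri_smul2, tri_smul3, gam6 hG, perm6 h1, perm6 h2,
      perm6 h3, perm6 h4, mul_zero, add_zero]

theorem thin_bad5 : Thin Bad5 := by
  refine (nullpat {(1,0)} (by decide) 4 (T7 ∪ {(0,0,2), (1,1,2), (0,2,2), (0,0,3), (0,2,3)}) (by decide +kernel)).mono ?_
  rintro F ⟨s, t, c, d, hli, hG, h1, h2, h3, h4, h5⟩
  obtain ⟨e, hli⟩ := extend4 hli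
  obtain ⟨π, L, U, hL, k0, k1, -, -, ⟨x, y, z, k2⟩, ⟨x', y', z', w', k3⟩⟩ := frame_m hli
  simp only [Matrix.cons_val_zero, Matrix.cons_val_one, Matrix.cons_val] at k0 k1 k2 k3
  refine ⟨π, fun i j => if i = j then 1 else if i = 1 ∧ j = 0 then L 1 0 / L 1 1 else 0, U, by simp, ?_, ?_⟩
  · intro i j hij hne
    simp only [Finset.mem_singleton, Prod.mk.injEq] at hne
    simp [hij, hne]
  set n := fam π (fun i j => if i = j then 1 else if i = 1 ∧ j = 0 then L 1 0 / L 1 1 else 0)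
    (upr fun i k => if i.1 < 4 then U i k else 0) with hn
  have e0 : n 0 = (L 0 0)⁻¹ • s := by rw [hn, fam_eq, Fin.sum_univ_five]; simp [wr_trunc, k0]
  have e1 : n 1 = (L 1 1)⁻¹ • t := by rw [hn, fam_eq, Fin.sum_univ_five]; simp [wr_trunc, k1]
  have e2 : n 2 = x • s + y • t + z • c := by rw [hn, fam_eq, Fin.sum_univ_five]; simp [wr_trunc, k2]
  have e3 : n 3 = x' • s + y' • t + z' • c + w' • d := by rw [hn, fam_eq, Fin.sum_univ_five]; simp [wr_trunc, k3]
  intro q hq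
  rcases Finset.mem_union.1 hq with hq | hq
  · exact t7_zero (by rw [e0, e1]; exact hG.smul2 _ _) q hq
  · simp only [Finset.mem_insert, Finset.mem_singleton] at hq
    rcases hq with rfl | rfl | rfl | rfl | rfl <;>
    simp only [e0, e1, e2, e3, tri_add1, tri_add2, tri_add3, tri_smul1, tri_smul2, tri_smul3, gam6 hG, perm6 h1, perm6 h2,
      perm6 h3, perm6 h4, perm6 h5, mul_zero, add_zero]

/-- entries of a pattern matrix -/
def pat (SL : Finset (Fin 5 × Fin 5)) (M : Fin 5 → Fin 5 → ℂ) (i j : Fin 5) : ℂ :=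
  if i = j then 1 else if (i, j) ∈ SL then M i j else 0

theorem thin_bad4a : Thin Bad4a := by
  refine (nullpat {(1,0), (2,1), (3,1), (3,2)} (by decide) 4
    (T7 ∪ {(0,0,2), (0,0,3), (0,2,2), (1,2,2), (2,2,2), (0,3,3), (1,3,3), (3,3,3)}) (by decide +kernel)).mono ?_
  rintro F ⟨o, a, b, d, hli, hG, h1, h2, h3, h4, h5, h6, h7, h8⟩
  obtain ⟨e, hli⟩ := extend4 hli
  obtain ⟨π, L, U, hL, k0, k1, k2, k3, -, -⟩ := frame_m hli
  simp only [Matrix.cons_val_zero, Matrix.cons_val_one, Matrix.cons_val] at k0 k1 k2 k3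
  refine ⟨π, pat {(1,0), (2,1), (3,1), (3,2)} fun i j => L i j / L i i, U, by simp [pat], ?_, ?_⟩
  · intro i j hij hne
    simp only [pat, if_neg hij, if_neg hne]
  set n := fam π (pat {(1,0), (2,1), (3,1), (3,2)} fun i j => L i j / L i i)
    (upr fun i k => if i.1 < 4 then U i k else 0) with hn
  have e0 : n 0 = (L 0 0)⁻¹ • o := by rw [hn, fam_eq, Fin.sum_univ_five]; simp [wr_trunc, pat, k0]
  have e1 : n 1 = (L 1 1)⁻¹ • a := by rw [hn, fam_eq, Fin.sum_univ_five]; simp [wr_trunc, pat, k1]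
  have e2 : n 2 = (L 2 2)⁻¹ • b - (L 2 0 / L 2 2 * (L 0 0)⁻¹) • o := by
    rw [hn, fam_eq, Fin.sum_univ_five]; simp [wr_trunc, pat, k2]; rw [k0, smul_smul]
  have e3 : n 3 = (L 3 3)⁻¹ • d - (L 3 0 / L 3 3 * (L 0 0)⁻¹) • o := by
    rw [hn, fam_eq, Fin.sum_univ_five]; simp [wr_trunc, pat]; rw [← k3, mul_smul, ← k0]; module
  intro q hq
  rcases Finset.mem_union.1 hq with hq | hq
  · exact t7_zero (by rw [e0, e1]; exact hG.smul2 _ _) q hq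
  · simp only [Finset.mem_insert, Finset.mem_singleton] at hq
    rcases hq with rfl | rfl | rfl | rfl | rfl | rfl | rfl | rfl <;>
    simp only [e0, e1, e2, e3, tri_sub1, tri_sub2, tri_sub3, tri_smul1, tri_smul2, tri_smul3, gam6 hG, perm6 h1, perm6 h2,
      perm6 h3, perm6 h4, perm6 h5, perm6 h6, perm6 h7, perm6 h8, mul_zero, sub_zero]

theorem thin_bad4b : Thin Bad4b := by
  refine (nullpat {(1,0), (2,1), (3,0), (3,2)} (by decide) 4
    (T7 ∪ {(0,0,2), (1,1,3), (0,2,2), (1,2,2), (2,2,2), (0,3,3), (1,3,3), (3,3,3)}) (by decide +kernel)).mono ?_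
  rintro F ⟨o, a, b, d, hli, hG, h1, h2, h3, h4, h5, h6, h7, h8⟩
  obtain ⟨e, hli⟩ := extend4 hli
  obtain ⟨π, L, U, hL, k0, k1, k2, k3, -, -⟩ := frame_m hli
  simp only [Matrix.cons_val_zero, Matrix.cons_val_one, Matrix.cons_val] at k0 k1 k2 k3
  set M : Fin 5 → Fin 5 → ℂ := fun i j => if i = 3 ∧ j = 0 then (L 3 0 - L 3 1 * L 1 0 / L 1 1) / L 3 3 else L i j / L i i with hM
  refine ⟨π, pat {(1,0), (2,1), (3,0), (3,2)} M, U, by simp [pat], ?_, ?_⟩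
  · intro i j hij hne
    simp only [pat, if_neg hij, if_neg hne]
  set n := fam π (pat {(1,0), (2,1), (3,0), (3,2)} M)
    (upr fun i k => if i.1 < 4 then U i k else 0) with hn
  have e0 : n 0 = (L 0 0)⁻¹ • o := by rw [hn, fam_eq, Fin.sum_univ_five]; simp [wr_trunc, pat, k0]
  have e1 : n 1 = (L 1 1)⁻¹ • a := by rw [hn, fam_eq, Fin.sum_univ_five]; simp [wr_trunc, pat, hM, k1]
  have e2 : n 2 = (L 2 2)⁻¹ • b - (L 2 0 / L 2 2 * (L 0 0)⁻¹) • o := by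
    rw [hn, fam_eq, Fin.sum_univ_five]; simp [wr_trunc, pat, hM, k2]; rw [k0, smul_smul]
  have e3 : n 3 = (L 3 3)⁻¹ • d - (L 3 1 / L 3 3 * (L 1 1)⁻¹) • a := by
    rw [hn, fam_eq, Fin.sum_univ_five]; simp [wr_trunc, pat, hM]; rw [← k3, mul_smul, ← k1]
    simp only [div_eq_mul_inv]; module
  intro q hq
  rcases Finset.mem_union.1 hq with hq | hq
  · exact t7_zero (by rw [e0, e1]; exact hG.smul2 _ _) q hq
  · simp only [Finset.mem_insert, Finset.mem_singleton] at hq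
    rcases hq with rfl | rfl | rfl | rfl | rfl | rfl | rfl | rfl <;>
    simp only [e0, e1, e2, e3, tri_sub1, tri_sub2, tri_sub3, tri_smul1, tri_smul2, tri_smul3, gam6 hG, perm6 h1, perm6 h2,
      perm6 h3, perm6 h4, perm6 h5, perm6 h6, perm6 h7, perm6 h8, mul_zero, sub_zero]

end CT

namespace CT
open Filter Topology

/-! ### the generic case -/

def K0 : Fin 3 → E5 := ![bv 2, bv 3, bv 4]

def cfr (n : Fin 5 → E5) : Fin 3 → E5 := ![n 2, n 3, n 4]

theorem lift_bv (n : Fin 5 → E5) (k : Fin 5) : ∑ i, bv k i • n i = n k := by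
  simp [bv, Pi.single_apply]

theorem lift_K0 (n : Fin 5 → E5) (j : Fin 3) : ∑ i, K0 j i • n i = cfr n j := by
  fin_cases j <;> exact lift_bv n _

theorem hA_pull (n : Fin 5 → E5) (F : Cub) (k : Fin 5) (i : Fin 3) : hA (pull n F) (bv k) K0 i = hA F (n k) (cfr n) i := by
  simp only [hA, tri_pull, lift_bv, lift_K0]

theorem hc_pull (n : Fin 5 → E5) (F : Cub) (i : Fin 3) : hc (pull n F) (bv 0) (bv 1) K0 i = hc F (n 0) (n 1) (cfr n) i := by
  have h0 : hA (pull n F) (bv 0) K0 = hA F (n 0) (cfr n) := funext fun i => hA_pull _ _ _ _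
  have h1 : hA (pull n F) (bv 1) K0 = hA F (n 1) (cfr n) := funext fun i => hA_pull _ _ _ _
  rw [hc, hc, h0, h1]

theorem lift_cK (n : Fin 5 → E5) (F : Cub) : ∑ i, cK (pull n F) (bv 0) (bv 1) K0 i • n i = cK F (n 0) (n 1) (cfr n) := by
  simp only [cK, hc_pull, Finset.sum_apply, Pi.smul_apply, smul_eq_mul, Finset.sum_smul]
  rw [Finset.sum_comm]
  refine Finset.sum_congr rfl fun j _ => ?_
  rw [← lift_K0, Finset.smul_sum]
  refine Finset.sum_congr rfl fun i _ => ?_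
  rw [mul_smul]

theorem uK_pull (n : Fin 5 → E5) (F : Cub) : uK (pull n F) (bv 0) (bv 1) K0 = uK F (n 0) (n 1) (cfr n) := by
  simp only [uK, tri_pull, lift_bv, lift_cK]
theorem wK_pull (n : Fin 5 → E5) (F : Cub) : wK (pull n F) (bv 0) (bv 1) K0 = wK F (n 0) (n 1) (cfr n) := by
  simp only [wK, tri_pull, lift_bv, lift_cK]

theorem RK_pull (n : Fin 5 → E5) (F : Cub) (j : Fin 3) : RK (pull n F) (bv 0) (bv 1) K0 j = RK F (n 0) (n 1) (cfr n) j := by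
  have h1 : eK (pull n F) (bv 0) (bv 1) K0 = eK F (n 0) (n 1) (cfr n) := by
    funext i
    simp only [eK, uK_pull, wK_pull, tri_pull, lift_bv, lift_cK, lift_K0]
  have h2 : mK (pull n F) (bv 0) (bv 1) K0 = mK F (n 0) (n 1) (cfr n) := by
    funext i
    simp only [mK, uK_pull, wK_pull, hA_pull]
  have h3 : tK (pull n F) (bv 0) (bv 1) K0 = tK F (n 0) (n 1) (cfr n) := by
    simp only [tK, tri_pull, lift_cK]
  rw [RK, RK, h1, h2, h3, uK_pull, wK_pull, hc_pull]

def d222 : Sym (Fin 5) 3 := mk3 2 2 2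

/-- setting one coefficient -/
def setc (a : Cub) (z : ℂ) : Cub := fun d => if d = d222 then z else a d

theorem setc_self (a : Cub) : setc a (a d222) = a := by
  funext d; unfold setc; split_ifs with h
  · rw [h]
  · rfl
theorem setc_setc (a : Cub) (z z' : ℂ) : setc (setc a z) z' = setc a z' := by
  funext d; unfold setc; split_ifs <;> rfl
theorem setc_apply (a : Cub) (z : ℂ) : setc a z d222 = z := by simp [setc]

theorem setc_eq (a : Cub) (z : ℂ) : setc a z = setc a 0 + z • setc 0 1 := by
  funext d; simp only [setc, Pi.add_apply, Pi.smul_apply, smul_eq_mul, Pi.zero_apply]; split_ifs <;> simp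

theorem tri_e (x y z : E5) : tri (setc 0 1) x y z = x 2 * y 2 * z 2 := by
  have h : ∀ i j k : Fin 5, mk3 i j k = d222 ↔ i = 2 ∧ j = 2 ∧ k = 2 := by decide +kernel
  simp only [tri, setc, h, Pi.zero_apply]
  rw [Finset.sum_eq_single 2, Finset.sum_eq_single 2, Finset.sum_eq_single 2]
  · simp
  · intro b _ hb; simp [hb]
  · simp
  · intro b _ hb; simp [hb]
  · simp
  · intro b _ hb; simp [hb]
  · simp

theorem tri_setc (a : Cub) (z : ℂ) (x y t : E5) : tri (setc a z) x y t = tri (setc a 0) x y t + z * (x 2 * y 2 * t 2) := by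
  rw [setc_eq, tri_cub_add, tri_cub_smul, tri_e]

theorem bv0_2 : bv 0 2 = 0 := by simp [bv]
theorem bv1_2 : bv 1 2 = 0 := by simp [bv]

theorem hc_setc (a : Cub) (z : ℂ) : hc (setc a z) (bv 0) (bv 1) K0 = hc (setc a 0) (bv 0) (bv 1) K0 := by
  have h0 : hA (setc a z) (bv 0) K0 = hA (setc a 0) (bv 0) K0 := by
    funext i; simp only [hA]; rw [tri_setc, bv0_2]; ring
  have h1 : hA (setc a z) (bv 1) K0 = hA (setc a 0) (bv 1) K0 := by
    funext i; simp only [hA]; rw [tri_setc, bv1_2]; ring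
  rw [hc, hc, h0, h1]
theorem cK_setc (a : Cub) (z : ℂ) : cK (setc a z) (bv 0) (bv 1) K0 = cK (setc a 0) (bv 0) (bv 1) K0 := by
  simp only [cK, hc_setc a z]
theorem uK_setc (a : Cub) (z : ℂ) : uK (setc a z) (bv 0) (bv 1) K0 = uK (setc a 0) (bv 0) (bv 1) K0 := by
  rw [uK, uK, cK_setc a z, tri_setc, bv0_2]; ring
theorem wK_setc (a : Cub) (z : ℂ) : wK (setc a z) (bv 0) (bv 1) K0 = wK (setc a 0) (bv 0) (bv 1) K0 := by
  rw [wK, wK, cK_setc a z, tri_setc, bv1_2]; ring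

/-- the coefficient -/
def C0 (a : Cub) : ℂ := -(1/3) * uK a (bv 0) (bv 1) K0 * wK a (bv 0) (bv 1) K0 * hc a (bv 0) (bv 1) K0 0 ^ 4
def R0 (a : Cub) : ℂ := RK a (bv 0) (bv 1) K0 0

theorem C0_setc (a : Cub) (z : ℂ) : C0 (setc a z) = C0 (setc a 0) := by
  rw [C0, C0, uK_setc, wK_setc, hc_setc]

theorem cK_2 (a : Cub) : cK a (bv 0) (bv 1) K0 2 = hc a (bv 0) (bv 1) K0 0 := by
  simp [cK, Fin.sum_univ_three, K0, bv]

theorem R0_setc (a : Cub) (z : ℂ) : R0 (setc a z) = C0 (setc a 0) * z + R0 (setc a 0) := by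
  have h1 : eK (setc a z) (bv 0) (bv 1) K0 = eK (setc a 0) (bv 0) (bv 1) K0 := by
    funext i
    simp only [eK, uK_setc a z, wK_setc a z, cK_setc a z]
    rw [tri_setc a z, tri_setc a z (bv 1), bv0_2, bv1_2]; ring
  have h2 : mK (setc a z) (bv 0) (bv 1) K0 = mK (setc a 0) (bv 0) (bv 1) K0 := by
    funext i
    simp only [mK, uK_setc a z, wK_setc a z, hA]
    rw [tri_setc a z, tri_setc a z (bv 0), bv0_2, bv1_2]; ring
  have h3 : tK (setc a z) (bv 0) (bv 1) K0 = tK (setc a 0) (bv 0) (bv 1) K0 + z * hc (setc a 0) (bv 0) (bv 1) K0 0 ^ 3 := by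
    simp only [tK, cK_setc a z]
    rw [tri_setc, cK_2]; ring
  simp only [R0, RK, h1, h2, h3, uK_setc a z, wK_setc a z, hc_setc a z, C0]
  ring

def fwd (n : Fin 5 → E5) (F : Cub) : Cub := setc (pull n F) (R0 (pull n F))

def bwd (q : (Fin 5 → E5) × Cub) : Cub :=
  pull (fun i => (Matrix.of q.1).adjugate i) ((fdet q.1 ^ 3)⁻¹ • setc q.2 ((q.2 d222 - R0 (setc q.2 0)) / C0 (setc q.2 0)))

theorem bwd_fwd {n : Fin 5 → E5} {F : Cub} (hn : fdet n ≠ 0) (hC : C0 (pull n F) ≠ 0) : bwd (n, fwd n F) = F := by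
  unfold bwd
  simp only [fwd]
  have e : C0 (setc (pull n F) 0) = C0 (pull n F) := by
    rw [← C0_setc _ (pull n F d222), setc_self]
  have h : R0 (pull n F) = C0 (setc (pull n F) 0) * pull n F d222 + R0 (setc (pull n F) 0) := by
    conv_lhs => rw [← setc_self (pull n F)]
    exact R0_setc _ _
  rw [setc_apply, setc_setc, setc_setc, h, add_sub_cancel_right, mul_div_cancel_left₀ _ (by rw [e]; exact hC), setc_self]
  exact (pull_inv hn F).symm

end CT

namespace CT
open Filter Topology

theorem cd_coord {n : WithTop ℕ∞} {ι : Type} [Fintype ι] (d : ι) : ContDiff ℂ n fun a : ι → ℂ => a d := contDiff_apply _ _ d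

theorem cd_pull {V : Type*} [NormedAddCommGroup V] [NormedSpace ℂ V] {n : V → Fin 5 → E5} {a : V → Cub}
    (hn : ∀ i, ContDiff ℂ 1 fun v => n v i) (ha : ContDiff ℂ 1 a) : ContDiff ℂ 1 fun v => pull (n v) (a v) :=
  contDiff_pi.2 fun d => ContDiff_tri ha (hn _) (hn _) (hn _)

theorem cd_setc {V : Type*} [NormedAddCommGroup V] [NormedSpace ℂ V] {a : V → Cub} {z : V → ℂ}
    (ha : ContDiff ℂ 1 a) (hz : ContDiff ℂ 1 z) : ContDiff ℂ 1 fun v => setc (a v) (z v) := by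
  refine contDiff_pi.2 fun d => ?_
  simp only [setc]
  split_ifs
  · exact hz
  · exact contDiff_pi.1 ha d

theorem cd_R0 {V : Type*} [NormedAddCommGroup V] [NormedSpace ℂ V] {a : V → Cub} (ha : ContDiff ℂ 1 a) :
    ContDiff ℂ 1 fun v => R0 (a v) :=
  ContDiff_RK ha contDiff_const contDiff_const (K := fun _ => K0) (fun i => contDiff_const) 0

theorem cd_C0 {V : Type*} [NormedAddCommGroup V] [NormedSpace ℂ V] {a : V → Cub} (ha : ContDiff ℂ 1 a) :
    ContDiff ℂ 1 fun v => C0 (a v) :=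
  ((contDiff_const.mul (ContDiff_uK ha contDiff_const contDiff_const (K := fun _ => K0) (fun i => contDiff_const))).mul
    (ContDiff_wK ha contDiff_const contDiff_const (K := fun _ => K0) (fun i => contDiff_const))).mul
    ((ContDiff_hc ha contDiff_const contDiff_const (K := fun _ => K0) (fun i => contDiff_const) 0).pow 4)

theorem cd_adj {V : Type*} [NormedAddCommGroup V] [NormedSpace ℂ V] {n : V → Fin 5 → E5}
    (hn : ∀ i, ContDiff ℂ 1 fun v => n v i) (i : Fin 5) : ContDiff ℂ 1 fun v => ((Matrix.of (n v)).adjugate i : E5) := by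
  refine contDiff_pi.2 fun k => ?_
  simp only [Matrix.adjugate_apply]
  refine ContDiff_fdet (m := fun v => Matrix.updateRow (Matrix.of (n v)) k (Pi.single i 1)) ?_
  intro a
  by_cases h : a = k
  · subst h; simp only [Matrix.updateRow_self]; exact contDiff_const
  · simp only [Matrix.updateRow_ne h]; exact hn a

theorem bwd_eq (q : (Fin 5 → E5) × Cub) : bwd q = (fdet q.1 ^ 3)⁻¹ •
    pull (fun i => (Matrix.of q.1).adjugate i) (setc q.2 0) +
    ((fdet q.1 ^ 3)⁻¹ * ((q.2 d222 - R0 (setc q.2 0)) / C0 (setc q.2 0))) •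
      pull (fun i => (Matrix.of q.1).adjugate i) (setc 0 1) := by
  rw [bwd, pull_smul, setc_eq, mul_smul, ← smul_add]
  congr 1
  funext d
  simp only [pull, tri_cub_add, tri_cub_smul, Pi.add_apply, Pi.smul_apply, smul_eq_mul]

theorem diff_bwd {q : (Fin 5 → E5) × Cub} (hn : fdet q.1 ≠ 0) (hC : C0 (setc q.2 0) ≠ 0) : DifferentiableAt ℂ bwd q := by
  have e : bwd = fun q => (fdet q.1 ^ 3)⁻¹ •
    pull (fun i => (Matrix.of q.1).adjugate i) (setc q.2 0) +
    ((fdet q.1 ^ 3)⁻¹ * ((q.2 d222 - R0 (setc q.2 0)) / C0 (setc q.2 0))) •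
      pull (fun i => (Matrix.of q.1).adjugate i) (setc 0 1) := funext bwd_eq
  rw [e]
  have hn1 : ∀ i, ContDiff ℂ 1 fun q : (Fin 5 → E5) × Cub => q.1 i := fun i => (contDiff_pi.1 contDiff_fst i)
  have h2 : ContDiff ℂ 1 fun q : (Fin 5 → E5) × Cub => q.2 := contDiff_snd
  have h20 : ContDiff ℂ 1 fun q : (Fin 5 → E5) × Cub => setc q.2 0 := cd_setc h2 contDiff_const
  have one : (1 : WithTop ℕ∞) ≠ 0 := one_ne_zero
  have D1 : DifferentiableAt ℂ (fun q : (Fin 5 → E5) × Cub => (fdet q.1 ^ 3)⁻¹) q :=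
    ((((ContDiff_fdet hn1).differentiable one) q).pow 3).inv (pow_ne_zero 3 hn)
  have D2a : DifferentiableAt ℂ (fun q : (Fin 5 → E5) × Cub => q.2 d222 - R0 (setc q.2 0)) q :=
    (((contDiff_pi.1 h2 d222).sub (cd_R0 h20)).differentiable one) q
  have D2b : DifferentiableAt ℂ (fun q : (Fin 5 → E5) × Cub => C0 (setc q.2 0)) q := ((cd_C0 h20).differentiable one) q
  have D2 : DifferentiableAt ℂ (fun q : (Fin 5 → E5) × Cub => (q.2 d222 - R0 (setc q.2 0)) / C0 (setc q.2 0)) q :=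
    by simp only [div_eq_mul_inv]; exact D2a.mul (DifferentiableAt.fun_inv D2b hC)
  have D3 := ((cd_pull (cd_adj hn1) h20).differentiable one) q
  have D4 := ((cd_pull (cd_adj hn1) (contDiff_const (c := setc 0 1))).differentiable one) q
  exact (D1.smul D3).add ((D1.mul D2).smul D4)

/-- Sard -/
theorem sard (f : Cub → Cub) : MeasureTheory.volume
    (f '' {x | DifferentiableAt ℂ f x ∧ ∃ v, v ≠ 0 ∧ fderiv ℂ f x v = 0}) = 0 := by
  refine MeasureTheory.addHaar_image_eq_zero_of_det_fderivWithin_eq_zero MeasureTheory.volume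
    (f' := fun x => (fderiv ℂ f x).restrictScalars ℝ) ?_ ?_
  · rintro x ⟨hx, -⟩
    exact (hx.hasFDerivAt.restrictScalars ℝ).hasFDerivWithinAt
  · rintro x ⟨-, v, hv, h⟩
    by_contra hdet
    apply hv
    have hu : IsUnit (LinearMap.det ((fderiv ℂ f x).restrictScalars ℝ : Cub →ₗ[ℝ] Cub)) := isUnit_iff_ne_zero.2 hdet
    have hk := LinearMap.ker_eq_bot.1 (LinearMap.isUnit_iff_ker_eq_bot _ |>.1 ((LinearMap.isUnit_iff_isUnit_det _).2 hu))
    apply hk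
    rw [map_zero]
    exact h

def d8 : Fin 8 → Sym (Fin 5) 3 := ![mk3 0 0 0, mk3 1 1 1, mk3 0 0 1, mk3 0 1 1, mk3 0 1 2, mk3 0 1 3, mk3 0 1 4, d222]

theorem d8_inj : Function.Injective d8 := by decide +kernel

def chS (i : Fin 5) (x : Cub) : E5 := i.insertNth (1 : ℂ) (fun m : Fin 4 => x (d8 (Fin.castAdd 4 m)))
def chT (j : Fin 5) (x : Cub) : E5 := j.insertNth (1 : ℂ) (fun m : Fin 4 => x (d8 (Fin.natAdd 4 m)))
def b0 (x : Cub) : Cub := fun d => if d ∈ Set.range d8 then 0 else x d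

def fmap (i j : Fin 5) (K : Fin 3 → E5) (x : Cub) : Cub := bwd (fr (chS i x) (chT j x) K, b0 x)

def Crit (i j : Fin 5) (K : Fin 3 → E5) : Set Cub :=
  fmap i j K '' {x | DifferentiableAt ℂ (fmap i j K) x ∧ ∃ v, v ≠ 0 ∧ fderiv ℂ (fmap i j K) x v = 0}

theorem cd_ins {V : Type*} [NormedAddCommGroup V] [NormedSpace ℂ V] (i : Fin 5) {f : V → Fin 4 → ℂ} (hf : ContDiff ℂ 1 f) :
    ContDiff ℂ 1 fun v => (i.insertNth (1 : ℂ) (f v) : E5) := by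
  refine contDiff_pi.2 fun k => ?_
  refine Fin.succAboveCases i ?_ (fun m => ?_) k
  · simp only [Fin.insertNth_apply_same]; exact contDiff_const
  · simp only [Fin.insertNth_apply_succAbove]; exact contDiff_pi.1 hf m

theorem cd_chS (i : Fin 5) : ContDiff ℂ 1 (chS i) := cd_ins i (contDiff_pi.2 fun m => cd_coord _)
theorem cd_chT (i : Fin 5) : ContDiff ℂ 1 (chT i) := cd_ins i (contDiff_pi.2 fun m => cd_coord _)
theorem cd_b0 : ContDiff ℂ 1 b0 := by
  classical
  refine contDiff_pi.2 fun d => ?_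
  simp only [b0]
  split_ifs
  · exact contDiff_const
  · exact cd_coord _

theorem cd_frame {V : Type*} [NormedAddCommGroup V] [NormedSpace ℂ V] {s t : V → E5} (hs : ContDiff ℂ 1 s) (ht : ContDiff ℂ 1 t)
    (K : Fin 3 → E5) : ContDiff ℂ 1 fun v => fr (s v) (t v) K := by
  refine contDiff_pi.2 fun i => ?_
  fin_cases i
  · exact hs
  · exact ht
  · exact contDiff_const
  · exact contDiff_const
  · exact contDiff_const

theorem cfr_fr (s t : E5) (K : Fin 3 → E5) : cfr (fr s t K) = K := by
  funext i; fin_cases i <;> rfl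

end CT

namespace CT
open Filter Topology

theorem ins_eq (i : Fin 5) (s : E5) (hs : s i = 1) : (i.insertNth (1 : ℂ) (fun m : Fin 4 => s (i.succAbove m)) : E5) = s := by
  funext k
  refine Fin.succAboveCases i ?_ (fun m => ?_) k
  · rw [Fin.insertNth_apply_same, hs]
  · rw [Fin.insertNth_apply_succAbove]

theorem Eqn_one (F : Cub) (s t : E5) (K : Fin 3 → E5) (j : Fin 3) : Eqn F s t K 1 (fun _ _ => 0) j = RK F s t K j := by
  simp [Eqn]

theorem fwd_d8 (F : Cub) (s t : E5) (K : Fin 3 → E5) : fwd (fr s t K) F (d8 0) = tri F s s s ∧ fwd (fr s t K) F (d8 1) = tri F t t t ∧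
    fwd (fr s t K) F (d8 2) = tri F s s t ∧ fwd (fr s t K) F (d8 3) = tri F s t t ∧ fwd (fr s t K) F (d8 4) = tri F s t (K 0) ∧
    fwd (fr s t K) F (d8 5) = tri F s t (K 1) ∧ fwd (fr s t K) F (d8 6) = tri F s t (K 2) ∧ fwd (fr s t K) F (d8 7) = RK F s t K 0 := by
  have h : ∀ l : Fin 8, l ≠ 7 → fwd (fr s t K) F (d8 l) = pull (fr s t K) F (d8 l) := by
    intro l hl
    have : d8 l ≠ d222 := fun h => hl (d8_inj (h.trans (by rfl : d222 = d8 7)))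
    simp [fwd, setc, this]
  refine ⟨?_, ?_, ?_, ?_, ?_, ?_, ?_, ?_⟩
  · rw [h 0 (by decide)]; exact pull_mk3 _ _ _ _ _
  · rw [h 1 (by decide)]; exact pull_mk3 _ _ _ _ _
  · rw [h 2 (by decide)]; exact pull_mk3 _ _ _ _ _
  · rw [h 3 (by decide)]; exact pull_mk3 _ _ _ _ _
  · rw [h 4 (by decide)]; exact pull_mk3 _ _ _ _ _
  · rw [h 5 (by decide)]; exact pull_mk3 _ _ _ _ _
  · rw [h 6 (by decide)]; exact pull_mk3 _ _ _ _ _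
  · have : d8 7 = d222 := rfl
    rw [this, fwd, setc_apply, R0, RK_pull, cfr_fr]
    rfl

theorem crit_mem {F : Cub} {s t s' t' : E5} {i j : Fin 5} {K : Fin 3 → E5} (hs : s i = 1) (ht : t j = 1) (hG : Gam F s t)
    (hR : RK F s t K 0 = 0) (hd : fdet (fr s t K) ≠ 0) (hc0 : hc F s t K 0 ≠ 0) (hu : uK F s t K ≠ 0) (hw : wK F s t K ≠ 0)
    (hs' : s' i = 0) (ht' : t' j = 0) (hne : (s', t') ≠ 0) (hT : Tan F s t s' t')
    (hD : HasDerivAt (fun ε : ℂ => RK F (s + ε • s') (t + ε • t') K 0) 0 0) : F ∈ Crit i j K := by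
  classical
  -- the curves
  let S : ℂ → E5 := fun ε => s + ε • s'
  let T : ℂ → E5 := fun ε => t + ε • t'
  have cS : ContDiff ℂ 1 S := by fun_prop
  have cT : ContDiff ℂ 1 T := by fun_prop
  have dS : HasDerivAt S s' 0 := Fam.hasDeriv_line s s'
  have dT : HasDerivAt T t' 0 := Fam.hasDeriv_line t t'
  have S0 : S 0 = s := by simp [S]
  have T0 : T 0 = t := by simp [T]
  let N : ℂ → Fin 5 → E5 := fun ε => fr (S ε) (T ε) K
  have cN : ContDiff ℂ 1 N := cd_frame cS cT K
  have N0 : N 0 = fr s t K := by simp only [N, S0, T0]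
  let b : ℂ → Cub := fun ε => fwd (N ε) F
  have cpull : ContDiff ℂ 1 fun ε => pull (N ε) F := cd_pull (fun i => contDiff_pi.1 cN i) contDiff_const
  have cb : ContDiff ℂ 1 b := cd_setc cpull (cd_R0 cpull)
  have one : (1 : WithTop ℕ∞) ≠ 0 := one_ne_zero
  have db : HasDerivAt b (deriv b 0) 0 := ((cb.differentiable one) 0).hasDerivAt
  have dN : HasDerivAt N (deriv N 0) 0 := ((cN.differentiable one) 0).hasDerivAt
  have hb := hasDerivAt_pi.1 db
  obtain ⟨v0, v1, v2, v3, v4, v5, v6, v7⟩ := fwd_d8 F s t K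
  have g6 := gam6 hG
  have b0v : ∀ l, b 0 (d8 l) = 0 := by
    intro l
    simp only [b, N0]
    fin_cases l
    · exact v0.trans hG.2.1
    · exact v1.trans hG.2.2
    · exact v2.trans hG.sst
    · exact v3.trans (hG.1 _)
    · exact v4.trans (hG.1 _)
    · exact v5.trans (hG.1 _)
    · exact v6.trans (hG.1 _)
    · exact v7.trans hR
  have b'v : ∀ l, deriv b 0 (d8 l) = 0 := by
    intro l
    have h := hb (d8 l)
    have key : HasDerivAt (fun ε => b ε (d8 l)) 0 0 := by
      have tan1 : ∀ x, tri F s' t x + tri F s t' x = 0 := hT.1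
      fin_cases l
      · have := hasDerivAt_tri F dS dS dS
        rw [S0] at this
        have e : tri F s' s s + tri F s s' s + tri F s s s' = 0 := by
          rw [tri_comm13 F s' s s, tri_comm23 F s s' s, hT.2.1]; ring
        rw [e] at this
        exact this.congr_of_eventuallyEq (Eventually.of_forall fun ε => (fwd_d8 F (S ε) (T ε) K).1)
      · have := hasDerivAt_tri F dT dT dT
        rw [T0] at this
        have e : tri F t' t t + tri F t t' t + tri F t t t' = 0 := by
          rw [tri_comm13 F t' t t, tri_comm23 F t t' t, hT.2.2]; ring
        rw [e] at this
        exact this.congr_of_eventuallyEq (Eventually.of_forall fun ε => (fwd_d8 F (S ε) (T ε) K).2.1)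
      · have := hasDerivAt_tri F dS dS dT
        rw [S0, T0] at this
        have e : tri F s' s t + tri F s s' t + tri F s s t' = 0 := by
          rw [tri_comm23 F s' s t, g6.2.2.1 s', tri_comm23 F s s t']; linear_combination tan1 s
        rw [e] at this
        exact this.congr_of_eventuallyEq (Eventually.of_forall fun ε => (fwd_d8 F (S ε) (T ε) K).2.2.1)
      · have := hasDerivAt_tri F dS dT dT
        rw [S0, T0] at this
        have e : tri F s' t t + tri F s t' t + tri F s t t' = 0 := by
          rw [g6.1 t']; linear_combination tan1 t
        rw [e] at this
        exact this.congr_of_eventuallyEq (Eventually.of_forall fun ε => (fwd_d8 F (S ε) (T ε) K).2.2.2.1)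
      · have := hasDerivAt_tri F dS dT (hasDerivAt_const (0:ℂ) (K 0))
        rw [S0, T0, tan1, tri_zero3, add_zero] at this
        exact this.congr_of_eventuallyEq (Eventually.of_forall fun ε => (fwd_d8 F (S ε) (T ε) K).2.2.2.2.1)
      · have := hasDerivAt_tri F dS dT (hasDerivAt_const (0:ℂ) (K 1))
        rw [S0, T0, tan1, tri_zero3, add_zero] at this
        exact this.congr_of_eventuallyEq (Eventually.of_forall fun ε => (fwd_d8 F (S ε) (T ε) K).2.2.2.2.2.1)
      · have := hasDerivAt_tri F dS dT (hasDerivAt_const (0:ℂ) (K 2))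
        rw [S0, T0, tan1, tri_zero3, add_zero] at this
        exact this.congr_of_eventuallyEq (Eventually.of_forall fun ε => (fwd_d8 F (S ε) (T ε) K).2.2.2.2.2.2.1)
      · exact hD.congr_of_eventuallyEq (Eventually.of_forall fun ε => (fwd_d8 F (S ε) (T ε) K).2.2.2.2.2.2.2)
    exact h.unique key
  -- the parameter curve
  let y : ℂ → Fin 8 → ℂ := fun ε => Fin.append (fun m : Fin 4 => S ε (i.succAbove m)) (fun m : Fin 4 => T ε (j.succAbove m))
  let y' : Fin 8 → ℂ := Fin.append (fun m : Fin 4 => s' (i.succAbove m)) (fun m : Fin 4 => t' (j.succAbove m))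
  let X : ℂ → Cub := fun ε => Function.extend d8 (y ε) (b ε)
  let X' : Cub := Function.extend d8 y' (deriv b 0)
  have dX : HasDerivAt X X' 0 := by
    refine hasDerivAt_pi.2 fun d => ?_
    by_cases h : ∃ l, d8 l = d
    · obtain ⟨l, rfl⟩ := h
      have e1 : (fun ε => X ε (d8 l)) = fun ε => y ε l := funext fun ε => d8_inj.extend_apply _ _ _
      have e2 : X' (d8 l) = y' l := d8_inj.extend_apply _ _ _
      rw [e1, e2]
      refine Fin.addCases (m := 4) (n := 4) (fun m => ?_) (fun m => ?_) l
      · simp only [y, y', Fin.append_left]; exact hasDerivAt_pi.1 dS _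
      · simp only [y, y', Fin.append_right]; exact hasDerivAt_pi.1 dT _
    · have e1 : (fun ε => X ε d) = fun ε => b ε d := funext fun ε => Function.extend_apply' _ _ _ h
      have e2 : X' d = deriv b 0 d := Function.extend_apply' _ _ _ h
      rw [e1, e2]; exact hb d
  have hX' : X' ≠ 0 := by
    intro h0
    have hy : ∀ l, y' l = 0 := fun l => by
      have := congrFun h0 (d8 l)
      rwa [show X' (d8 l) = y' l from d8_inj.extend_apply _ _ _] at this
    apply hne
    refine Prod.ext (funext fun k => ?_) (funext fun k => ?_)
    · refine Fin.succAboveCases i hs' (fun m => ?_) k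
      have := hy (Fin.castAdd 4 m)
      simp only [y', Fin.append_left] at this
      exact this
    · refine Fin.succAboveCases j ht' (fun m => ?_) k
      have := hy (Fin.natAdd 4 m)
      simp only [y', Fin.append_right] at this
      exact this
  have chX : ∀ ε, fr (chS i (X ε)) (chT j (X ε)) K = N ε := by
    intro ε
    have e1 : chS i (X ε) = S ε := by
      rw [← ins_eq i (S ε) (by simp [S, hs, hs']), chS]
      congr 1
      funext m
      rw [show X ε (d8 (Fin.castAdd 4 m)) = y ε (Fin.castAdd 4 m) from d8_inj.extend_apply _ _ _]
      simp only [y, Fin.append_left]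
    have e2 : chT j (X ε) = T ε := by
      rw [← ins_eq j (T ε) (by simp [T, ht, ht']), chT]
      congr 1
      funext m
      rw [show X ε (d8 (Fin.natAdd 4 m)) = y ε (Fin.natAdd 4 m) from d8_inj.extend_apply _ _ _]
      simp only [y, Fin.append_right]
    rw [e1, e2]
  have b0X : ∀ ε d, b0 (X ε) d = if d ∈ Set.range d8 then 0 else b ε d := by
    intro ε d
    simp only [b0]
    by_cases h : d ∈ Set.range d8
    · rw [if_pos h, if_pos h]
    · rw [if_neg h, if_neg h]; exact Function.extend_apply' _ _ _ h
  have b0X0 : b0 (X 0) = b 0 := by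
    funext d
    rw [b0X]
    by_cases h : d ∈ Set.range d8
    · rw [if_pos h]; obtain ⟨l, rfl⟩ := h; exact (b0v l).symm
    · rw [if_neg h]
  have dbX : HasDerivAt (fun ε => b0 (X ε)) (deriv b 0) 0 := by
    refine hasDerivAt_pi.2 fun d => ?_
    simp only [b0X]
    by_cases h : d ∈ Set.range d8
    · simp only [if_pos h]; obtain ⟨l, rfl⟩ := h; rw [b'v]; exact hasDerivAt_const _ _
    · simp only [if_neg h]; exact hb d
  -- nonvanishing
  have hC : C0 (pull (N 0) F) ≠ 0 := by
    rw [N0]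
    unfold C0
    rw [uK_pull, wK_pull, hc_pull, cfr_fr]
    exact mul_ne_zero (mul_ne_zero (mul_ne_zero (by norm_num) hu) hw) (pow_ne_zero 4 hc0)
  have hNd : fdet (N 0) ≠ 0 := by rw [N0]; exact hd
  have ev : ∀ᶠ ε in 𝓝 (0:ℂ), bwd (N ε, b ε) = F := by
    have c1 : ContinuousAt (fun ε => C0 (pull (N ε) F)) 0 := (cd_C0 cpull).continuous.continuousAt
    have c2 : ContinuousAt (fun ε => fdet (N ε)) 0 := (ContDiff_fdet (fun i => contDiff_pi.1 cN i)).continuous.continuousAt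
    filter_upwards [c1.eventually_ne hC, c2.eventually_ne hNd] with ε h1 h2
    exact bwd_fwd h2 h1
  have hC2 : C0 (setc (b 0) 0) ≠ 0 := by
    simp only [b, fwd, setc_setc]
    rw [← C0_setc _ (pull (N 0) F d222), setc_self]; exact hC
  have hdiff : DifferentiableAt ℂ bwd (N 0, b 0) := diff_bwd hNd hC2
  have d1 : HasDerivAt (fun ε => bwd (N ε, b ε)) (fderiv ℂ bwd (N 0, b 0) (deriv N 0, deriv b 0)) 0 :=
    HasFDerivAt.comp_hasDerivAt (f := fun ε => (N ε, b ε)) (0:ℂ) hdiff.hasFDerivAt (dN.prodMk db)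
  have d1' : HasDerivAt (fun ε => bwd (N ε, b ε)) 0 0 :=
    (hasDerivAt_const (0:ℂ) F).congr_of_eventuallyEq ev
  have z1 := d1.unique d1'
  have hdiff' : HasFDerivAt bwd (fderiv ℂ bwd (N 0, b 0)) (N 0, b0 (X 0)) := by rw [b0X0]; exact hdiff.hasFDerivAt
  have d2 : HasDerivAt (fun ε => bwd (N ε, b0 (X ε))) (fderiv ℂ bwd (N 0, b 0) (deriv N 0, deriv b 0)) 0 :=
    HasFDerivAt.comp_hasDerivAt (f := fun ε => (N ε, b0 (X ε))) (0:ℂ) hdiff' (dN.prodMk dbX)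
  rw [z1] at d2
  have e3 : (fun ε => bwd (N ε, b0 (X ε))) = fun ε => fmap i j K (X ε) := by
    funext ε; rw [fmap, chX]
  rw [e3] at d2
  have hq : DifferentiableAt ℂ (fun x => ((fr (chS i x) (chT j x) K, b0 x) : (Fin 5 → E5) × Cub)) (X 0) :=
    ((cd_frame (cd_chS i) (cd_chT j) K).prodMk cd_b0).differentiable one (X 0)
  have hf : DifferentiableAt ℂ (fmap i j K) (X 0) := by
    have h1 : DifferentiableAt ℂ bwd (fr (chS i (X 0)) (chT j (X 0)) K, b0 (X 0)) := by rw [chX, b0X0]; exact hdiff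
    exact h1.comp (X 0) hq
  have d3 := hf.hasFDerivAt.comp_hasDerivAt (0:ℂ) dX
  refine ⟨X 0, ⟨hf, X', hX', d3.unique d2⟩, ?_⟩
  rw [fmap, chX, b0X0]
  exact ev.self_of_nhds

end CT

namespace CT
open Filter Topology

/-- coordinates in a frame vanish -/
theorem fr_indep {s t : E5} {K : Fin 3 → E5} (hd : fdet (fr s t K) ≠ 0) {a b : ℂ} {z : Fin 3 → ℂ}
    (h : a • s + b • t + ∑ i, z i • K i = 0) : a = 0 ∧ b = 0 ∧ ∀ i, z i = 0 := by
  have hli := (fdet_ne_zero_iff _).1 hd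
  rw [Fintype.linearIndependent_iff] at hli
  have := hli ![a, b, z 0, z 1, z 2] (by
    rw [Fin.sum_univ_five]
    rw [Fin.sum_univ_three] at h
    simp only [fr, Matrix.cons_val_zero, Matrix.cons_val_one, Matrix.cons_val]
    rw [← h]; abel)
  refine ⟨this 0, this 1, fun i => ?_⟩
  fin_cases i
  · exact this 2
  · exact this 3
  · exact this 4

theorem bad5_of {F : Cub} {s t : E5} {K : Fin 3 → E5} (hd : fdet (fr s t K) ≠ 0) (hG : Gam F s t) {z : Fin 3 → ℂ} (hz : z 0 ≠ 0)
    (h1 : tri F s s (∑ i, z i • K i) = 0) (h2 : tri F t t (∑ i, z i • K i) = 0)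
    (h3 : tri F s (∑ i, z i • K i) (∑ i, z i • K i) = 0) (hA0 : hA F s K 1 ≠ 0 ∨ hA F s K 2 ≠ 0)
    (h4 : tri F s (∑ i, z i • K i) (K 1) * hA F s K 2 = tri F s (∑ i, z i • K i) (K 2) * hA F s K 1) : Bad5 F := by
  refine ⟨s, t, ∑ i, z i • K i, hA F s K 2 • K 1 - hA F s K 1 • K 2, ?_, hG, h1, h2, h3, ?_, ?_⟩
  · rw [Fintype.linearIndependent_iff]
    intro g hg
    rw [Fin.sum_univ_four] at hg
    simp only [Matrix.cons_val_zero, Matrix.cons_val_one, Matrix.cons_val] at hg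
    obtain ⟨e0, e1, e2⟩ := fr_indep hd (a := g 0) (b := g 1)
      (z := ![g 2 * z 0, g 2 * z 1 + g 3 * hA F s K 2, g 2 * z 2 - g 3 * hA F s K 1]) (by
      rw [← hg]
      simp only [Fin.sum_univ_three, Matrix.cons_val_zero, Matrix.cons_val_one, Matrix.cons_val]
      module)
    have g2 : g 2 = 0 := (mul_eq_zero.1 (e2 0)).resolve_right hz
    have e21 := e2 1
    have e22 := e2 2
    simp only [Matrix.cons_val_zero, Matrix.cons_val_one, Matrix.cons_val, g2, zero_mul, zero_add, zero_sub, neg_eq_zero, mul_eq_zero] at e21 e22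
    have g3 : g 3 = 0 := by
      rcases hA0 with h | h
      · exact e22.resolve_right h
      · exact e21.resolve_right h
    intro i; fin_cases i
    · exact e0
    · exact e1
    · exact g2
    · exact g3
  · rw [tri_sub3, tri_smul3, tri_smul3]; simp only [hA]; ring
  · rw [tri_sub3, tri_smul3, tri_smul3]; linear_combination h4

theorem uw_ne {F : Cub} {s t : E5} {K : Fin 3 → E5} (hd : fdet (fr s t K) ≠ 0) (hG : Gam F s t) (hz : hc F s t K 0 ≠ 0)
    (hR : RK F s t K 0 = 0) (n3 : ¬ Triple F) (n5 : ¬ Bad5 F) : uK F s t K ≠ 0 ∧ wK F s t K ≠ 0 := by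
  have hA : tri F s s (cK F s t K) = 0 := hG.A_cK
  have hB : tri F t t (cK F s t K) = 0 := hG.B_cK
  have notboth : ¬ (uK F s t K = 0 ∧ wK F s t K = 0) := by
    rintro ⟨hu, hw⟩
    refine n3 ⟨s, t, cK F s t K, ?_, hG, hA, hB, hu, hw⟩
    rw [Fintype.linearIndependent_iff]
    intro g hg
    rw [Fin.sum_univ_three] at hg
    simp only [Matrix.cons_val_zero, Matrix.cons_val_one, Matrix.cons_val] at hg
    obtain ⟨e0, e1, e2⟩ := fr_indep hd (a := g 0) (b := g 1) (z := fun i => g 2 * hc F s t K i) (by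
      rw [← hg]
      simp only [cK, Finset.smul_sum, mul_smul])
    intro i; fin_cases i
    · exact e0
    · exact e1
    · exact (mul_eq_zero.1 (e2 0)).resolve_right hz
  have hz' := hz
  simp only [hc, cross_0] at hz'
  constructor
  · intro hu
    have hw : wK F s t K ≠ 0 := fun h => notboth ⟨hu, h⟩
    refine n5 (bad5_of hd hG hz hA hB hu ?_ ?_)
    · by_contra hcon
      push Not at hcon
      rw [hcon.1, hcon.2] at hz'
      simp at hz'
    · simp only [RK, cross_0, eK, mK, hu] at hR
      have : wK F s t K ^ 3 * (tri F s (cK F s t K) (K 1) * CT.hA F s K 2 - tri F s (cK F s t K) (K 2) * CT.hA F s K 1) = 0 := by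
        linear_combination hR
      have := (mul_eq_zero.1 this).resolve_left (pow_ne_zero 3 hw)
      exact sub_eq_zero.1 this
  · intro hw
    have hu : uK F s t K ≠ 0 := fun h => notboth ⟨h, hw⟩
    have hd' : fdet (fr t s K) ≠ 0 := by rw [fdet_fr_swap]; exact neg_ne_zero.2 hd
    refine n5 (bad5_of hd' hG.symm hz hB hA hw ?_ ?_)
    · by_contra hcon
      push Not at hcon
      rw [hcon.1, hcon.2] at hz'
      simp at hz'
    · simp only [RK, cross_0, eK, mK, hw] at hR
      have : uK F s t K ^ 3 * (tri F t (cK F s t K) (K 1) * CT.hA F t K 2 - tri F t (cK F s t K) (K 2) * CT.hA F t K 1) = 0 := by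
        linear_combination -hR
      have := (mul_eq_zero.1 this).resolve_left (pow_ne_zero 3 hu)
      exact sub_eq_zero.1 this

theorem homG_zero : HomG 1 (fun _ _ => 0) := ⟨8, by simp, Or.inr rfl⟩

def constFam (F : Cub) : Fam where
  F := fun _ => F
  σ := fun _ => 1
  g := fun _ _ _ => 0
  hF := contDiff_const
  hσ := contDiff_const
  hg := contDiff_const
  hom := fun _ => homG_zero

theorem degenerate {F : Cub} (n1 : ¬ Sing F) (n3 : ¬ Triple F) (n5 : ¬ Bad5 F) (hg : ¬ GoodQ F 1 (fun _ _ => 0)) :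
    ∃ (i j : Fin 5) (k : Fin 3 → Fin 5), F ∈ Crit i j (fun m => bv (k m)) := by
  have hS : Smooth3 F := by
    intro p hp
    by_contra h
    exact n1 ⟨p, h, hp⟩
  unfold GoodQ at hg
  push Not at hg
  obtain ⟨s, t, hs, ht, hZ, hN⟩ := hg
  obtain ⟨i, hi⟩ := Function.ne_iff.1 hs
  obtain ⟨j, hj⟩ := Function.ne_iff.1 ht
  simp only [Pi.zero_apply] at hi hj
  have hZ' := hZ.smul homG_zero (s i)⁻¹ (t j)⁻¹
  have hN' : ¬ NonDeg F ((s i)⁻¹ • s) ((t j)⁻¹ • t) 1 (fun _ _ => 0) := fun h =>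
    hN (Fam.NonDeg_smul homG_zero (inv_ne_zero hi) (inv_ne_zero hj) h)
  have hi1 : ((s i)⁻¹ • s) i = 1 := by simp [hi]
  have hj1 : ((t j)⁻¹ • t) j = 1 := by simp [hj]
  generalize (s i)⁻¹ • s = S at *
  generalize (t j)⁻¹ • t = T at *
  have hG := hZ'.1
  have hS0 : S ≠ 0 := by rintro rfl; simp at hi1
  have hT0 : T ≠ 0 := by rintro rfl; simp at hj1
  obtain ⟨k, hd, hc0⟩ := hG.exists_frame hS hS0 hT0
  have hE : Eqn F S T (fun m => bv (k m)) 1 (fun _ _ => 0) 0 = 0 := (mul_eq_zero.1 (hZ'.2 _ 0)).resolve_left hd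
  have hR := hE
  rw [Eqn_one] at hR
  obtain ⟨hu, hw⟩ := uw_ne hd hG hc0 hR n3 n5
  refine ⟨i, j, k, ?_⟩
  by_contra hcrit
  refine hN' ⟨_, 0, hd, hc0, ?_⟩
  refine (constFam F).nondeg_of_inj (τ := 0) (i := i) (i' := j) (by rw [hi1]; exact one_ne_zero) (by rw [hj1]; exact one_ne_zero)
    hG hE 1 1 ?_
  rintro ⟨s', t'⟩ hv
  by_contra hne
  rw [Fam.fderiv_Phi] at hv
  simp only [Prod.mk_eq_zero] at hv
  obtain ⟨w1, w2, w3, w4, w5, w6⟩ := hv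
  apply hcrit
  have hT : Tan F S T s' t' := (Fam.tan_iff F S T s' t').2 ⟨fun k => congrFun w1 k,
    (mul_eq_zero.1 w2).resolve_left three_ne_zero, (mul_eq_zero.1 w3).resolve_left three_ne_zero⟩
  have hD := (constFam F).hasDeriv_Eq (fun m => bv (k m)) 0 0 S T s' t'
  rw [← hD.deriv] at hD
  rw [w4] at hD
  refine crit_mem hi1 hj1 hG hR hd hc0 hu hw w5 w6 hne hT ?_
  simpa only [constFam, Eqn_one] using hD

theorem thin_notgood : Thin fun F => ¬ GoodQ F 1 (fun _ _ => 0) := by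
  have hC : IsC fun v : Cub => GoodQ v 1 (fun _ _ => 0) := by
    have := isC_good (F := fun v : Cub => v) (σ := fun _ => 1) (γ := fun _ => 0) (G := fun _ _ => 0) (fun d => IsPoly.coord d)
      (IsPoly.const _) (IsPoly.const _) (IsPoly.const _)
    simpa only [zero_mul] using this
  obtain ⟨p, hp, h | h⟩ := hC.dichotomy
  swap
  · exact ⟨p, hp, h⟩
  exfalso
  obtain ⟨q, hq, hq2⟩ := (thin_sing.or thin_triple).or thin_bad5
  have hpq : p * q ≠ 0 := mul_ne_zero hp hq
  obtain ⟨x, hx⟩ : ∃ x : Cub, eval x (p * q) ≠ 0 := by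
    by_contra hcon
    push Not at hcon
    exact hpq (MvPolynomial.funext fun x => by rw [hcon x, map_zero])
  have hopen : IsOpen {x : Cub | eval x (p * q) ≠ 0} := isOpen_ne_fun (MvPolynomial.continuous_eval _) continuous_const
  have hpos := hopen.measure_pos MeasureTheory.volume ⟨x, hx⟩
  have hsub : {x : Cub | eval x (p * q) ≠ 0} ⊆ ⋃ (i : Fin 5) (j : Fin 5) (k : Fin 3 → Fin 5), Crit i j (fun m => bv (k m)) := by
    intro y hy
    have hy' : eval y p ≠ 0 ∧ eval y q ≠ 0 := by
      have : eval y (p * q) ≠ 0 := hy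
      rw [map_mul] at this
      exact mul_ne_zero_iff.1 this
    have n : ¬ ((Sing y ∨ Triple y) ∨ Bad5 y) := fun h => hy'.2 (hq2 y h)
    rw [not_or, not_or] at n
    obtain ⟨i, j, k, hk⟩ := degenerate n.1.1 n.1.2 n.2 (fun hg => hy'.1 (h y hg))
    simp only [Set.mem_iUnion]
    exact ⟨i, j, k, hk⟩
  have hzero : MeasureTheory.volume (⋃ (i : Fin 5) (j : Fin 5) (k : Fin 3 → Fin 5), Crit i j (fun m => bv (k m))) = 0 := by
    simp only [MeasureTheory.measure_iUnion_null_iff]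
    intro i j k
    exact sard _
  exact absurd (MeasureTheory.measure_mono_null hsub hzero) hpos.ne'

end CT

namespace CT
open Filter Topology

theorem li3 {o a b : E5} : LinearIndependent ℂ ![o, a, b] ↔
    ∀ x y z : ℂ, x • o + y • a + z • b = 0 → x = 0 ∧ y = 0 ∧ z = 0 := by
  rw [Fintype.linearIndependent_iff]
  constructor
  · intro h x y z hz
    have := h ![x, y, z] (by rw [Fin.sum_univ_three]; simpa using hz)
    exact ⟨this 0, this 1, this 2⟩
  · intro h g hg
    rw [Fin.sum_univ_three] at hg
    obtain ⟨h0, h1, h2⟩ := h (g 0) (g 1) (g 2) (by simpa using hg)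
    intro i; fin_cases i
    · exact h0
    · exact h1
    · exact h2

theorem li4 {o a b d : E5} : LinearIndependent ℂ ![o, a, b, d] ↔
    ∀ x y z w : ℂ, x • o + y • a + z • b + w • d = 0 → x = 0 ∧ y = 0 ∧ z = 0 ∧ w = 0 := by
  rw [Fintype.linearIndependent_iff]
  constructor
  · intro h x y z w hz
    have := h ![x, y, z, w] (by rw [Fin.sum_univ_four]; simpa using hz)
    exact ⟨this 0, this 1, this 2, this 3⟩
  · intro h g hg
    rw [Fin.sum_univ_four] at hg
    obtain ⟨h0, h1, h2, h3⟩ := h (g 0) (g 1) (g 2) (g 3) (by simpa using hg)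
    intro i; fin_cases i
    · exact h0
    · exact h1
    · exact h2
    · exact h3

theorem span_pair_le {o a : E5} {x y x' y' : ℂ} :
    Submodule.span ℂ {x • o + y • a, x' • o + y' • a} ≤ Submodule.span ℂ {o, a} := by
  rw [Submodule.span_le]
  rintro v (rfl | rfl)
  · exact Submodule.mem_span_pair.2 ⟨x, y, rfl⟩
  · exact Submodule.mem_span_pair.2 ⟨x', y', rfl⟩

theorem span_pair_eq {o a s t : E5} {x y x' y' : ℂ} (hs : s = x • o + y • a) (ht : t = x' • o + y' • a)
    (hd : x * y' - x' * y ≠ 0) : Submodule.span ℂ {s, t} = Submodule.span ℂ {o, a} := by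
  refine le_antisymm ?_ ?_
  · rw [hs, ht]; exact span_pair_le
  · obtain ⟨D, hD⟩ : ∃ D, D = x * y' - x' * y := ⟨_, rfl⟩
    rw [← hD] at hd
    have e1 : o = D⁻¹ • (y' • s + (-y) • t) := by
      rw [hs, ht, show y' • (x • o + y • a) + (-y) • (x' • o + y' • a) = (x * y' - x' * y) • o by module, ← hD, smul_smul,
        inv_mul_cancel₀ hd, one_smul]
    have e2 : a = D⁻¹ • ((-x') • s + x • t) := by
      rw [hs, ht, show (-x') • (x • o + y • a) + x • (x' • o + y' • a) = (x * y' - x' * y) • a by module, ← hD, smul_smul,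
        inv_mul_cancel₀ hd, one_smul]
    rw [smul_add, smul_smul, smul_smul] at e1 e2
    rw [Submodule.span_le]
    rintro v (rfl | rfl)
    · exact Submodule.mem_span_pair.2 ⟨_, _, e1.symm⟩
    · exact Submodule.mem_span_pair.2 ⟨_, _, e2.symm⟩

/-- special planes: `r = ⟨o, a⟩` double, `l = ⟨o, b⟩` residual -/
def P1 (F : Cub) (o a b : E5) : Prop := LinearIndependent ℂ ![o, a, b] ∧
  (tri F o o o = 0 ∧ tri F o o a = 0 ∧ tri F o a a = 0 ∧ tri F a a a = 0) ∧
  (tri F o o b = 0 ∧ tri F o a b = 0 ∧ tri F a a b = 0 ∧ tri F o b b = 0 ∧ tri F b b b = 0) ∧ tri F a b b ≠ 0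

def DD (F : Cub) (r l : Submodule ℂ E5) : Prop :=
  ∃ o a b, P1 F o a b ∧ r = Submodule.span ℂ {o, a} ∧ l = Submodule.span ℂ {o, b}

theorem pair_det {o a s t : E5} (hst : LinearIndependent ℂ ![s, t]) {x y x' y' : ℂ} (hs : s = x • o + y • a)
    (ht : t = x' • o + y' • a) : x * y' - x' * y ≠ 0 := by
  intro h0
  rw [LinearIndependent.pair_iff] at hst
  have h1 := hst y' (-y) (by
    rw [hs, ht]
    have : y' • (x • o + y • a) + (-y) • (x' • o + y' • a) = (x * y' - x' * y) • o := by module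
    rw [this, h0, zero_smul])
  have h2 := hst (-x') x (by
    rw [hs, ht]
    have : (-x') • (x • o + y • a) + x • (x' • o + y' • a) = (x * y' - x' * y) • a := by module
    rw [this, h0, zero_smul])
  have := hst 1 0 (by rw [hs, h2.2, neg_eq_zero.1 h1.2]; simp)
  exact one_ne_zero this.1

theorem span_coords {o a s t : E5} (h : Submodule.span ℂ {s, t} = Submodule.span ℂ {o, a}) :
    ∃ x y x' y' : ℂ, s = x • o + y • a ∧ t = x' • o + y' • a := by
  have h1 : s ∈ Submodule.span ℂ {o, a} := h ▸ Submodule.subset_span (by simp)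
  have h2 : t ∈ Submodule.span ℂ {o, a} := h ▸ Submodule.subset_span (by simp)
  obtain ⟨x, y, e⟩ := Submodule.mem_span_pair.1 h1
  obtain ⟨x', y', e'⟩ := Submodule.mem_span_pair.1 h2
  exact ⟨x, y, x', y', e.symm, e'.symm⟩

theorem li_of_li3 {o a b : E5} (h : LinearIndependent ℂ ![o, a, b]) :
    LinearIndependent ℂ ![o, a] ∧ LinearIndependent ℂ ![o, b] := by
  rw [li3] at h
  constructor
  · rw [LinearIndependent.pair_iff]
    intro x y hxy
    have := h x y 0 (by rw [hxy]; simp)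
    exact ⟨this.1, this.2.1⟩
  · rw [LinearIndependent.pair_iff]
    intro x y hxy
    have := h x 0 y (by rw [← hxy]; simp)
    exact ⟨this.1, this.2.2⟩

theorem ne_of_li {s t : E5} (h : LinearIndependent ℂ ![s, t]) : s ≠ 0 ∧ t ≠ 0 := by
  rw [LinearIndependent.pair_iff] at h
  constructor
  · rintro rfl; exact one_ne_zero (h 1 0 (by simp)).1
  · rintro rfl; exact one_ne_zero (h 0 1 (by simp)).2

/-- coordinates in a 5-frame -/
theorem coords5 {o a b p q : E5} (h : LinearIndependent ℂ ![o, a, b, p, q]) (v : E5) :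
    ∃ x y z u w : ℂ, v = x • o + y • a + z • b + u • p + w • q := by
  obtain ⟨z, hz⟩ := exists_coord ((fdet_ne_zero_iff _).2 h) v
  refine ⟨z 0, z 1, z 2, z 3, z 4, ?_⟩
  rw [hz, Fin.sum_univ_five]
  rfl

/-- a double line carries a Gam pair -/
theorem P1.gam {F : Cub} {o a b : E5} (hS : Smooth3 F) (h : P1 F o a b) :
    ∃ s t, s ≠ 0 ∧ t ≠ 0 ∧ Gam F s t ∧ Submodule.span ℂ {s, t} = Submodule.span ℂ {o, a} := by
  obtain ⟨hl, ⟨h1, h2, h3, h4⟩, ⟨h5, h6, h7, h8, h9⟩, h10⟩ := h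
  obtain ⟨hoa, -⟩ := li_of_li3 hl
  obtain ⟨ho, ha⟩ := ne_of_li hoa
  obtain ⟨p, q, hpq⟩ := extend3 hl
  have hdet : (!![tri F o o p, tri F o a p, tri F a a p; tri F o o q, tri F o a q, tri F a a q; 0, 0, 0] : Matrix (Fin 3) (Fin 3) ℂ).det = 0 := by
    rw [Matrix.det_fin_three]; simp
  obtain ⟨v, hv, hv2⟩ := Matrix.exists_mulVec_eq_zero_iff.2 hdet
  have e0 := congrFun hv2 0
  have e1 := congrFun hv2 1
  simp [Matrix.mulVec, dotProduct, Fin.sum_univ_three] at e0 e1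
  have p2 := perm6 h2
  have p3 := perm6 h3
  have key : ∀ x, v 0 * tri F o o x + v 1 * tri F o a x + v 2 * tri F a a x = 0 := by
    intro x
    obtain ⟨x1, x2, x3, x4, x5, rfl⟩ := coords5 hpq x
    simp only [tri_add3, tri_smul3, h1, h2, h5, h6, p2, p3, h4, h7]
    linear_combination x4 * e0 + x5 * e1
  have mk : ∀ {x y x' y' : ℂ}, x * y' - x' * y ≠ 0 → (∀ z, tri F (x • o + y • a) (x' • o + y' • a) z = 0) →
      ∃ s t, s ≠ 0 ∧ t ≠ 0 ∧ Gam F s t ∧ Submodule.span ℂ {s, t} = Submodule.span ℂ {o, a} := by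
    intro x y x' y' hd hz
    refine ⟨_, _, ?_, ?_, ⟨hz, ?_, ?_⟩, span_pair_eq rfl rfl hd⟩
    · intro h0
      obtain ⟨rfl, rfl⟩ := LinearIndependent.pair_iff.1 hoa _ _ h0
      simp at hd
    · intro h0
      obtain ⟨rfl, rfl⟩ := LinearIndependent.pair_iff.1 hoa _ _ h0
      simp at hd
    · simp only [tri_add1, tri_add2, tri_add3, tri_smul1, tri_smul2, tri_smul3, h1, h4, p2, p3, mul_zero, add_zero]
    · simp only [tri_add1, tri_add2, tri_add3, tri_smul1, tri_smul2, tri_smul3, h1, h4, p2, p3, mul_zero, add_zero]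
  by_cases hv0 : v 0 = 0
  · refine mk (x := 0) (y := 1) (x' := v 1) (y' := v 2) ?_ ?_
    · intro h0
      have hv1 : v 1 = 0 := by linear_combination -h0
      refine ha (hS a fun x => ?_)
      have hv3 : v 2 ≠ 0 := by
        intro h; apply hv; funext i; fin_cases i
        · exact hv0
        · exact hv1
        · exact h
      have := key x
      rw [hv0, hv1, zero_mul, zero_mul, zero_add, zero_add] at this
      exact (mul_eq_zero.1 this).resolve_left hv3
    · intro z
      simp only [tri_add1, tri_add2, tri_smul1, tri_smul2]
      have := key z
      rw [hv0, tri_comm12 F o a] at this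
      linear_combination this
  · obtain ⟨e, he⟩ := IsAlgClosed.exists_pow_nat_eq (v 1 ^ 2 - 4 * v 0 * v 2) (n := 2) (by norm_num)
    have hz : ∀ z, tri F ((2 * v 0) • o + (v 1 + e) • a) ((2 * v 0) • o + (v 1 - e) • a) z = 0 := by
      intro z
      simp only [tri_add1, tri_add2, tri_smul1, tri_smul2, tri_comm12 F a o]
      linear_combination 4 * v 0 * key z - tri F a a z * he
    refine mk (x := 2 * v 0) (y := v 1 + e) (x' := 2 * v 0) (y' := v 1 - e) ?_ hz
    intro h0
    have he0 : e = 0 := by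
      have : v 0 * e = 0 := by linear_combination -h0 / 4
      exact (mul_eq_zero.1 this).resolve_left hv0
    rw [he0] at hz
    simp only [add_zero, sub_zero] at hz
    have := LinearIndependent.pair_iff.1 hoa _ _ (hS _ hz)
    exact hv0 (by linear_combination this.1 / 2)

/-- the kernel of the two forms -/
theorem gam_ker {F : Cub} {s t b b' : E5} (hS : Smooth3 F) (hs : s ≠ 0) (ht : t ≠ 0) (h : Gam F s t)
    (hl : LinearIndependent ℂ ![s, t, b]) (h1 : tri F s s b = 0) (h2 : tri F t t b = 0)
    (h1' : tri F s s b' = 0) (h2' : tri F t t b' = 0) : ∃ x y z : ℂ, b' = x • s + y • t + z • b := by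
  obtain ⟨p, q, hpq⟩ := extend3 hl
  obtain ⟨x1, x2, x3, x4, x5, rfl⟩ := coords5 hpq b'
  have hdet : tri F s s p * tri F t t q - tri F s s q * tri F t t p ≠ 0 := by
    obtain ⟨j, hj⟩ := h.exists_hc hS hs ht (K := ![b, p, q]) ((fdet_ne_zero_iff _).2 hpq)
    fin_cases j
    · simpa [hc, hA] using hj
    · simp [hc, hA, h1, h2] at hj
    · simp [hc, hA, h1, h2] at hj
  simp only [tri_add3, tri_smul3, h1, h2, h.2.1, h.2.2, h.sst, h.tts, mul_zero, zero_add] at h1' h2'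
  have e4 : x4 = 0 := by
    have : x4 * (tri F s s p * tri F t t q - tri F s s q * tri F t t p) = 0 := by
      linear_combination tri F t t q * h1' - tri F s s q * h2'
    exact (mul_eq_zero.1 this).resolve_right hdet
  have e5 : x5 = 0 := by
    have : x5 * (tri F s s p * tri F t t q - tri F s s q * tri F t t p) = 0 := by
      linear_combination tri F s s p * h2' - tri F t t p * h1'
    exact (mul_eq_zero.1 this).resolve_right hdet
  exact ⟨x1, x2, x3, by rw [e4, e5]; simp⟩

theorem tri_span {F : Cub} {o a b : E5} (h1 : tri F o o b = 0) (h2 : tri F o a b = 0) (h3 : tri F a a b = 0)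
    (x y x' y' : ℂ) : tri F (x • o + y • a) (x' • o + y' • a) b = 0 := by
  simp only [tri_add1, tri_add2, tri_smul1, tri_smul2, h1, h2, h3, tri_comm12 F a o, mul_zero, add_zero]

theorem li3_change {o a b s t : E5} (hl : LinearIndependent ℂ ![o, a, b]) {x y x' y' : ℂ} (hs : s = x • o + y • a)
    (ht : t = x' • o + y' • a) (hd : x * y' - x' * y ≠ 0) : LinearIndependent ℂ ![s, t, b] := by
  rw [li3] at hl ⊢
  intro m n k hk
  rw [hs, ht] at hk
  obtain ⟨a1, a2, a3⟩ := hl (m * x + n * x') (m * y + n * y') k (by rw [← hk]; module)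
  refine ⟨?_, ?_, a3⟩
  · have : m * (x * y' - x' * y) = 0 := by linear_combination y' * a1 - x' * a2
    exact (mul_eq_zero.1 this).resolve_right hd
  · have : n * (x * y' - x' * y) = 0 := by linear_combination x * a2 - y * a1
    exact (mul_eq_zero.1 this).resolve_right hd

theorem finrank_pair {o a : E5} (h : LinearIndependent ℂ ![o, a]) : Module.finrank ℂ (Submodule.span ℂ {o, a}) = 2 := by
  have := finrank_span_eq_card h
  rwa [Matrix.range_cons, Matrix.range_cons, Matrix.range_empty, Set.union_empty, Set.singleton_union] at this

theorem DD.unique {F : Cub} (hS : Smooth3 F) {r l l' : Submodule ℂ E5} (h : DD F r l) (h' : DD F r l') : l = l' := by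
  obtain ⟨o, a, b, hp, rfl, rfl⟩ := h
  obtain ⟨o', a', b', hp', hr, rfl⟩ := h'
  obtain ⟨s, t, hs, ht, hG, hsp⟩ := hp.gam hS
  have hst := hG.li hS hs ht
  obtain ⟨hl, ⟨h1, h2, h3, h4⟩, ⟨h5, h6, h7, h8, h9⟩, h10⟩ := hp
  obtain ⟨hl', ⟨h1', h2', h3', h4'⟩, ⟨h5', h6', h7', h8', h9'⟩, h10'⟩ := hp'
  obtain ⟨x, y, x', y', e1, e2⟩ := span_coords hsp
  have hd := pair_det hst e1 e2
  have hsp' : Submodule.span ℂ {s, t} = Submodule.span ℂ {o', a'} := hsp.trans hr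
  obtain ⟨m, n, m', n', e3, e4⟩ := span_coords hsp'
  obtain ⟨k1, k2, k3, hb⟩ := gam_ker (b := b) (b' := b') hS hs ht hG (li3_change hl e1 e2 hd)
    (by rw [e1]; exact tri_span h5 h6 h7 ..) (by rw [e2]; exact tri_span h5 h6 h7 ..)
    (by rw [e3]; exact tri_span h5' h6' h7' ..) (by rw [e4]; exact tri_span h5' h6' h7' ..)
  obtain ⟨z1, z2, hb2⟩ : ∃ z1 z2 : ℂ, b' = z1 • o + z2 • a + k3 • b :=
    ⟨k1 * x + k2 * x', k1 * y + k2 * y', by rw [hb, e1, e2]; module⟩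
  obtain ⟨w1, w2, v1, v2, f1, f2⟩ := span_coords hr.symm
  have hk3 : k3 ≠ 0 := by
    rintro rfl
    apply h10'
    rw [f2, hb2]
    simp only [tri_add1, tri_add2, tri_add3, tri_smul1, tri_smul2, tri_smul3, h1, h4, perm6 h2, perm6 h3, mul_zero, zero_mul, add_zero]
  have hw2 : w2 = 0 := by
    rw [f1, hb2] at h8'
    simp only [tri_add1, tri_add2, tri_add3, tri_smul1, tri_smul2, tri_smul3, h1, h4, h9, perm6 h2, perm6 h3, perm6 h5, perm6 h6, perm6 h7, perm6 h8, mul_zero, zero_mul, add_zero, zero_add] at h8'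
    simpa [hk3, h10] using h8'
  have hz2 : z2 = 0 := by
    rw [hb2] at h9'
    simp only [tri_add1, tri_add2, tri_add3, tri_smul1, tri_smul2, tri_smul3, h1, h4, h9, perm6 h2, perm6 h3, perm6 h5, perm6 h6, perm6 h7, perm6 h8, mul_zero, zero_mul, add_zero, zero_add,
      tri_comm12 F b a, tri_comm13 F b b a] at h9'
    have : z2 * (3 * k3 ^ 2 * tri F a b b) = 0 := by linear_combination h9'
    exact (mul_eq_zero.1 this).resolve_right (by simp [hk3, h10])
  symm
  refine Submodule.eq_of_le_of_finrank_eq ?_ ?_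
  · rw [f1, hb2, hw2, hz2]
    have : z1 • o + (0:ℂ) • a + k3 • b = z1 • o + k3 • b := by simp
    rw [this, show w1 • o + (0:ℂ) • a = w1 • o + (0:ℂ) • b by simp]
    exact span_pair_le
  · rw [finrank_pair (li_of_li3 hl).2, finrank_pair (li_of_li3 hl').2]

end CT

namespace CT
open Filter Topology

/-- a double line whose residual line is `⟨o, a⟩`, meeting it in `o` -/
def Res (F : Cub) (o a : E5) (r : Submodule ℂ E5) : Prop :=
  ∃ d, LinearIndependent ℂ ![o, a, d] ∧ r = Submodule.span ℂ {o, d} ∧ tri F o o d = 0 ∧ tri F o d d = 0 ∧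
    tri F a d d = 0 ∧ tri F d d d = 0 ∧ tri F a a d ≠ 0

theorem Res.congr {F : Cub} {o a o1 a1 d : E5} {m x y : ℂ} (hG : Gam F o a) (ho : o1 = m • o)
    (ha : a1 = x • o + y • a) (h : P1 F o1 d a1) : Res F o a (Submodule.span ℂ {o1, d}) := by
  obtain ⟨hl, ⟨h1, h2, h3, h4⟩, ⟨h5, h6, h7, h8, h9⟩, h10⟩ := h
  have hm : m ≠ 0 := by
    rintro rfl
    rw [zero_smul] at ho
    exact (ne_of_li (li_of_li3 hl).1).1 ho
  have hy : y ≠ 0 := by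
    rintro rfl
    have := (li3.1 hl) x 0 (-m) (by rw [ho, ha]; module)
    exact hm (neg_eq_zero.1 this.2.2)
  subst ho ha
  simp only [tri_add1, tri_add2, tri_add3, tri_smul1, tri_smul2, tri_smul3] at h2 h3 h6 h7 h10
  have c1 : tri F o o d = 0 := by simpa [hm] using h2
  have c2 : tri F o d d = 0 := by simpa [hm] using h3
  have c3 : tri F a d d = 0 := by
    rw [perm6 c2 |>.2.2.2.1, tri_comm13] at h7
    simpa [hy] using h7
  refine ⟨d, ?_, ?_, c1, c2, c3, h4, ?_⟩
  · rw [li3] at hl ⊢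
    intro α β γ hz
    obtain ⟨q1, q2, q3⟩ := hl ((α - β / y * x) / m) γ (β / y) (by
      rw [← hz, smul_smul, div_mul_cancel₀ _ hm, smul_add, smul_smul, smul_smul, div_mul_cancel₀ _ hy]
      module)
    have hb : β = 0 := by simpa [hy] using q3
    refine ⟨?_, hb, q2⟩
    rw [hb] at q1
    simpa [hm] using q1
  · refine span_pair_eq (x := m) (y := 0) (x' := 0) (y' := 1) (by simp) (by simp) (by simpa using hm)
  · intro h0
    apply h10
    simp only [perm6 c1, gam6 hG, perm6 h0, mul_zero, add_zero]

theorem DD.res {F : Cub} {o a : E5} {r l : Submodule ℂ E5} (hG : Gam F o a)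
    (hl : l = Submodule.span ℂ {o, a}) (h : DD F r l) : Res F o a r ∨ Res F a o r := by
  obtain ⟨o1, d, a1, hp, rfl, e⟩ := h
  obtain ⟨x, y, x', y', e1, e2⟩ := span_coords (e.symm.trans hl)
  have hd := pair_det (li_of_li3 hp.1).2 e1 e2
  have hp' := hp
  obtain ⟨hl, ⟨h1, h2, h3, h4⟩, ⟨h5, h6, h7, h8, h9⟩, h10⟩ := hp'
  rw [tri_comm23] at h6
  rw [e1] at h2
  rw [e1, e2] at h6
  rw [e2] at h10
  simp only [tri_add1, tri_add2, tri_add3, tri_smul1, tri_smul2, tri_smul3, gam6 hG, mul_zero, add_zero, zero_add] at h2 h6 h10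
  have k1 : x * tri F o o d = 0 := by
    have : (x * y' - x' * y) * (x * tri F o o d) = 0 := by linear_combination y' * h2 - y * h6
    exact (mul_eq_zero.1 this).resolve_left hd
  have k2 : y * tri F a a d = 0 := by
    have : (x * y' - x' * y) * (y * tri F a a d) = 0 := by linear_combination -x' * h2 + x * h6
    exact (mul_eq_zero.1 this).resolve_left hd
  rcases mul_eq_zero.1 k2 with hy | hy
  · left
    exact Res.congr (m := x) (x := x') (y := y') hG (by rw [e1, hy]; simp) e2 hp
  · right
    rcases mul_eq_zero.1 k1 with hx | hx
    · exact Res.congr (m := y) (x := y') (y := x') hG.symm (by rw [e1, hx]; simp) (by rw [e2]; abel) hp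
    · exfalso; apply h10
      rw [perm6 hx |>.2.2.2.2.1, perm6 hy |>.2.2.2.2.1]; simp

theorem Res.uniq {F : Cub} {o a : E5} {r r' : Submodule ℂ E5} (hG : Gam F o a) (n4 : ¬ Bad4a F)
    (h : Res F o a r) (h' : Res F o a r') : r = r' := by
  obtain ⟨b, hl, rfl, h1, h2, h3, h4, h5⟩ := h
  obtain ⟨d, hl', rfl, h1', h2', h3', h4', h5'⟩ := h'
  have : ¬ LinearIndependent ℂ ![o, a, b, d] := fun hli => n4 ⟨o, a, b, d, hli, hG, h1, h1', h2, h3, h4, h2', h3', h4'⟩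
  rw [li4] at this
  push Not at this
  obtain ⟨x, y, z, w, hz, hne⟩ := this
  rw [li3] at hl hl'
  have hw : w ≠ 0 := by
    rintro rfl
    obtain ⟨rfl, rfl, rfl⟩ := hl x y z (by rw [← hz]; simp)
    exact hne rfl rfl rfl rfl
  have hd : d = (-x / w) • o + (-y / w) • a + (-z / w) • b := by
    have : d = w⁻¹ • (w • d) := by rw [smul_smul, inv_mul_cancel₀ hw, one_smul]
    rw [this, show w • d = -(x • o + y • a + z • b) by rw [eq_neg_iff_add_eq_zero, ← hz]; abel]
    match_scalars <;> field_simp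
  have hz0 : z ≠ 0 := by
    rintro rfl
    have := hl' x y w (by rw [← hz]; simp)
    exact hw this.2.2
  generalize -x / w = α at hd
  generalize -y / w = β at hd
  have hγ : -z / w ≠ 0 := div_ne_zero (neg_ne_zero.2 hz0) hw
  generalize -z / w = γ at hd hγ
  have hβ : β = 0 := by
    rw [hd] at h3'
    simp only [tri_add1, tri_add2, tri_add3, tri_smul1, tri_smul2, tri_smul3, gam6 hG, perm6 h1, perm6 h2, perm6 h3, mul_zero, zero_add, add_zero,
      tri_comm23 F a b a] at h3'
    have : β * (2 * γ * tri F a a b) = 0 := by linear_combination h3'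
    exact (mul_eq_zero.1 this).resolve_right (by simp [hγ, h5])
  symm
  refine span_pair_eq (x := 1) (y := 0) (x' := α) (y' := γ) (by simp) (by rw [hd, hβ]; simp) (by simpa using hγ)

theorem Res.mixed {F : Cub} {o a : E5} {r r' : Submodule ℂ E5} (hG : Gam F o a) (n4 : ¬ Bad4b F)
    (h : Res F o a r) (h' : Res F a o r') : False := by
  obtain ⟨b, hl, rfl, h1, h2, h3, h4, h5⟩ := h
  obtain ⟨d, hl', rfl, h1', h2', h3', h4', h5'⟩ := h'
  have : ¬ LinearIndependent ℂ ![o, a, b, d] := fun hli => n4 ⟨o, a, b, d, hli, hG, h1, h1', h2, h3, h4, h3', h2', h4'⟩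
  rw [li4] at this
  push Not at this
  obtain ⟨x, y, z, w, hz, hne⟩ := this
  rw [li3] at hl hl'
  have hw : w ≠ 0 := by
    rintro rfl
    obtain ⟨rfl, rfl, rfl⟩ := hl x y z (by rw [← hz]; simp)
    exact hne rfl rfl rfl rfl
  have hz0 : z ≠ 0 := by
    rintro rfl
    have := hl' y x w (by rw [← hz]; simp; abel)
    exact hw this.2.2
  have e : tri F a a (x • o + y • a + z • b + w • d) = 0 := by rw [hz, tri_zero3]
  simp only [tri_add3, tri_smul3, gam6 hG, h1', mul_zero, zero_add, add_zero] at e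
  exact (mul_ne_zero hz0 h5) e

theorem DD.inj {F : Cub} {o a : E5} {r r' l : Submodule ℂ E5} (hG : Gam F o a) (n4 : ¬ Bad4a F) (n4' : ¬ Bad4b F)
    (hl : l = Submodule.span ℂ {o, a}) (h : DD F r l) (h' : DD F r' l) : r = r' := by
  rcases h.res hG hl with h | h <;> rcases h'.res hG hl with h' | h'
  · exact h.uniq hG n4 h'
  · exact (h.mixed hG n4' h').elim
  · exact (h'.mixed hG n4' h).elim
  · exact h.uniq hG.symm n4 h'

/-- T2 -/
theorem zer_of_res {F : Cub} {o a s t : E5} {r : Submodule ℂ E5} (hS : Smooth3 F) (hG : Gam F o a) (h : Res F o a r)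
    (hs : s ≠ 0) (ht : t ≠ 0) (hst : Gam F s t) (hr : r = Submodule.span ℂ {s, t}) : Zer F s t 1 (fun _ _ => 0) := by
  obtain ⟨d, hl, e, h1, h2, h3, h4, h5⟩ := h
  obtain ⟨x, y, x', y', e1, e2⟩ := span_coords (hr.symm.trans e)
  obtain ⟨m, n, m', n', e3, e4⟩ := span_coords (e.symm.trans hr)
  have hd := pair_det (hst.li hS hs ht) e1 e2
  have hl2 : LinearIndependent ℂ ![o, d, a] := by
    rw [li3] at hl ⊢
    intro p q r hz
    have := hl p r q (by rw [← hz]; abel)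
    exact ⟨this.1, this.2.2, this.2.1⟩
  have hl3 := li3_change hl2 e1 e2 hd
  obtain ⟨p, q, hpq⟩ := extend3 hl3
  have hf : fdet (fr s t ![a, p, q]) ≠ 0 := (fdet_ne_zero_iff _).2 hpq
  have ssa : tri F s s a = 0 := by
    rw [e1]; exact tri_span (perm6 (hG.1 o)).2.1 (perm6 (hG.1 d)).2.1 (by rw [tri_comm13]; exact h3) ..
  have tta : tri F t t a = 0 := by
    rw [e2]; exact tri_span (perm6 (hG.1 o)).2.1 (perm6 (hG.1 d)).2.1 (by rw [tri_comm13]; exact h3) ..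
  obtain ⟨j, hj⟩ := hst.exists_hc hS hs ht hf
  have z1 : hc F s t ![a, p, q] 1 = 0 := by simp [hc, hA, ssa, tta]
  have z2 : hc F s t ![a, p, q] 2 = 0 := by simp [hc, hA, ssa, tta]
  have hj0 : hc F s t ![a, p, q] 0 ≠ 0 := by
    fin_cases j
    · exact hj
    · exact absurd z1 hj
    · exact absurd z2 hj
  have hcK : cK F s t ![a, p, q] = hc F s t ![a, p, q] 0 • a := by
    simp [cK, Fin.sum_univ_three, z1, z2]
  refine zer_of_frame hst hf hj0 ?_
  rw [Eqn_one]
  have rel : ∀ v, m * tri F s a v + n * tri F t a v = 0 := by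
    intro v
    have := hG.1 v
    rw [e3] at this
    simpa only [tri_add1, tri_smul1] using this
  have hmn : m ≠ 0 ∨ n ≠ 0 := by
    by_contra hcon
    push Not at hcon
    rw [hcon.1, hcon.2] at e3
    simp at e3
    exact (ne_of_li (li_of_li3 hl).1).1 e3
  have hE : ∀ v, tri F t a a * tri F s a v - tri F s a a * tri F t a v = 0 := by
    intro v
    have r1 := rel v
    have r2 := rel a
    rcases hmn with hm | hm
    · have : m * (tri F t a a * tri F s a v - tri F s a a * tri F t a v) = 0 := by
        linear_combination tri F t a a * r1 - tri F t a v * r2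
      exact (mul_eq_zero.1 this).resolve_left hm
    · have : n * (tri F t a a * tri F s a v - tri F s a a * tri F t a v) = 0 := by
        linear_combination -tri F s a a * r1 + tri F s a v * r2
      exact (mul_eq_zero.1 this).resolve_left hm
  have he : ∀ i, eK F s t ![a, p, q] i = 0 := by
    intro i
    simp only [eK, wK, uK, hcK, tri_smul2, tri_smul3]
    linear_combination hc F s t ![a, p, q] 0 ^ 3 * hE (![a, p, q] i)
  simp only [RK, cross_0, he, tK, hcK, tri_smul1, tri_smul2, tri_smul3, hG.2.2]
  ring

/-- L0 -/
theorem exists_tri {F : Cub} {s t : E5} (hS : Smooth3 F) (n3 : ¬ Triple F) (hs : s ≠ 0) (ht : t ≠ 0) (hG : Gam F s t) :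
    ∃ a, LinearIndependent ℂ ![s, t, a] ∧ tri F s s a = 0 ∧ tri F t t a = 0 ∧ tri F a a a = 0 ∧
      (tri F s a a ≠ 0 ∨ tri F t a a ≠ 0) := by
  obtain ⟨k, hd, hz⟩ := hG.exists_frame hS hs ht
  generalize (fun i => bv (k i)) = K at hd hz
  have hli : LinearIndependent ℂ ![s, t, cK F s t K] := by
    rw [li3]
    intro x y z hxyz
    obtain ⟨e0, e1, e2⟩ := fr_indep hd (a := x) (b := y) (z := fun i => z * hc F s t K i) (by
      rw [← hxyz]
      simp only [cK, Finset.smul_sum, mul_smul])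
    exact ⟨e0, e1, (mul_eq_zero.1 (e2 0)).resolve_right hz⟩
  have hA : tri F s s (cK F s t K) = 0 := hG.A_cK
  have hB : tri F t t (cK F s t K) = 0 := hG.B_cK
  generalize cK F s t K = c at hli hA hB
  have main : ∀ x y : ℂ, tri F c c c + 3 * (x * tri F s c c + y * tri F t c c) = 0 →
      (tri F s c c ≠ 0 ∨ tri F t c c ≠ 0) →
      ∃ a, LinearIndependent ℂ ![s, t, a] ∧ tri F s s a = 0 ∧ tri F t t a = 0 ∧ tri F a a a = 0 ∧
      (tri F s a a ≠ 0 ∨ tri F t a a ≠ 0) := by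
    intro x y hxy hne
    refine ⟨c + x • s + y • t, ?_, ?_, ?_, ?_, ?_⟩
    · rw [li3] at hli ⊢
      intro α β γ h
      obtain ⟨q1, q2, q3⟩ := hli (α + γ * x) (β + γ * y) γ (by rw [← h]; module)
      rw [q3] at q1 q2
      exact ⟨by simpa using q1, by simpa using q2, q3⟩
    · simp only [tri_add3, tri_smul3, gam6 hG, hA, mul_zero, add_zero]
    · simp only [tri_add3, tri_smul3, gam6 hG, hB, mul_zero, add_zero]
    · simp only [tri_add1, tri_add2, tri_add3, tri_smul1, tri_smul2, tri_smul3, gam6 hG, perm6 hA, perm6 hB, mul_zero, add_zero, zero_add,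
        tri_comm12 F c s, tri_comm13 F c c s, tri_comm12 F c t, tri_comm13 F c c t]
      linear_combination hxy
    · simpa only [tri_add1, tri_add2, tri_add3, tri_smul1, tri_smul2, tri_smul3, gam6 hG, perm6 hA, perm6 hB, mul_zero, add_zero, zero_add] using hne
  by_cases hu : tri F s c c = 0
  · by_cases hw : tri F t c c = 0
    · exact absurd ⟨s, t, c, hli, hG, hA, hB, hu, hw⟩ n3
    · exact main 0 (-tri F c c c / (3 * tri F t c c)) (by field_simp; ring) (Or.inr hw)
  · exact main (-tri F c c c / (3 * tri F s c c)) 0 (by field_simp; ring) (Or.inl hu)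

theorem dd_of_tri {F : Cub} {s t a : E5} (hG : Gam F s t) (hli : LinearIndependent ℂ ![s, t, a]) (h1 : tri F s s a = 0)
    (h2 : tri F t t a = 0) (h3 : tri F a a a = 0) (hne : tri F s a a ≠ 0 ∨ tri F t a a ≠ 0) :
    DD F (Submodule.span ℂ {s, t}) (Submodule.span ℂ {tri F t a a • s - tri F s a a • t, a}) := by
  have hli' := li3.1 hli
  rcases hne with hu | hu
  · refine ⟨tri F t a a • s - tri F s a a • t, s, a, ⟨?_, ⟨?_, ?_, ?_, ?_⟩, ⟨?_, ?_, ?_, ?_, ?_⟩, hu⟩, ?_, rfl⟩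
    · rw [li3]
      intro α β γ h
      obtain ⟨q1, q2, q3⟩ := hli' (α * tri F t a a + β) (-α * tri F s a a) γ (by rw [← h]; module)
      have hα : α = 0 := by simpa [hu] using q2
      rw [hα] at q1
      exact ⟨hα, by simpa using q1, q3⟩
    any_goals simp only [tri_sub1, tri_sub2, tri_sub3, tri_smul1, tri_smul2, tri_smul3, gam6 hG, perm6 h1, perm6 h2, h3, mul_zero, sub_zero]
    · ring
    · symm
      exact span_pair_eq (x := tri F t a a) (y := -tri F s a a) (x' := 1) (y' := 0) (by module) (by module) (by simpa using hu)
  · refine ⟨tri F t a a • s - tri F s a a • t, t, a, ⟨?_, ⟨?_, ?_, ?_, ?_⟩, ⟨?_, ?_, ?_, ?_, ?_⟩, hu⟩, ?_, rfl⟩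
    · rw [li3]
      intro α β γ h
      obtain ⟨q1, q2, q3⟩ := hli' (α * tri F t a a) (β - α * tri F s a a) γ (by rw [← h]; module)
      have hα : α = 0 := by simpa [hu] using q1
      rw [hα] at q2
      exact ⟨hα, by simpa using q2, q3⟩
    any_goals simp only [tri_sub1, tri_sub2, tri_sub3, tri_smul1, tri_smul2, tri_smul3, gam6 hG, perm6 h1, perm6 h2, h3, mul_zero, sub_zero]
    · ring
    · symm
      exact span_pair_eq (x := tri F t a a) (y := -tri F s a a) (x' := 0) (y' := 1) (by module) (by module) (by simpa using hu)

/-- T1 -/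
theorem zer_dd {F : Cub} {s t : E5} (hS : Smooth3 F) (n3 : ¬ Triple F) (hs : s ≠ 0) (ht : t ≠ 0)
    (hZ : Zer F s t 1 (fun _ _ => 0)) : ∃ l r, DD F (Submodule.span ℂ {s, t}) l ∧ DD F l r := by
  have hG := hZ.1
  obtain ⟨a, hli, h1, h2, h3, hne⟩ := exists_tri hS n3 hs ht hG
  have hD := dd_of_tri hG hli h1 h2 h3 hne
  have hli' := li3.1 hli
  obtain ⟨p, q, hpq⟩ := extend3 hli
  have hf : fdet (fr s t ![a, p, q]) ≠ 0 := (fdet_ne_zero_iff _).2 hpq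
  obtain ⟨j, hj⟩ := hG.exists_hc hS hs ht hf
  have z1 : hc F s t ![a, p, q] 1 = 0 := by simp [hc, hA, h1, h2]
  have z2 : hc F s t ![a, p, q] 2 = 0 := by simp [hc, hA, h1, h2]
  have hj0 : hc F s t ![a, p, q] 0 ≠ 0 := by
    fin_cases j
    · exact hj
    · exact absurd z1 hj
    · exact absurd z2 hj
  have hcK : cK F s t ![a, p, q] = hc F s t ![a, p, q] 0 • a := by
    simp [cK, Fin.sum_univ_three, z1, z2]
  have hR := (mul_eq_zero.1 (hZ.2 ![a, p, q] 0)).resolve_left hf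
  rw [Eqn_one] at hR
  generalize hc F s t ![a, p, q] 0 = h at hj0 hcK hR
  simp only [RK, cross_0, eK, mK, uK, wK, tK, hcK, hA, tri_smul1, tri_smul2, tri_smul3, h3, Matrix.cons_val_one, Matrix.cons_val] at hR
  obtain ⟨o, ho⟩ : ∃ o, o = tri F t a a • s - tri F s a a • t := ⟨_, rfl⟩
  have oo : ∀ x, tri F o o x = tri F t a a ^ 2 * tri F s s x + tri F s a a ^ 2 * tri F t t x := by
    intro x
    rw [ho]
    simp only [tri_sub1, tri_sub2, tri_smul1, tri_smul2, gam6 hG]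
    ring
  have oa : ∀ x, tri F o a x = tri F t a a * tri F s a x - tri F s a a * tri F t a x := by
    intro x
    rw [ho]
    simp only [tri_sub1, tri_smul1]
  have hcr : tri F o a p * tri F o o q = tri F o a q * tri F o o p := by
    have : h ^ 7 * (tri F o a p * tri F o o q - tri F o a q * tri F o o p) = 0 := by
      rw [oo, oo, oa, oa]; linear_combination hR
    exact sub_eq_zero.1 ((mul_eq_zero.1 this).resolve_left (pow_ne_zero 7 hj0))
  have ho0 : o ≠ 0 := by
    intro h0
    rw [h0] at ho
    obtain ⟨q1, q2, -⟩ := hli' (tri F t a a) (-tri F s a a) 0 (by rw [zero_smul, add_zero, neg_smul, ← sub_eq_add_neg]; exact ho.symm)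
    rcases hne with h | h
    · exact h (neg_eq_zero.1 q2)
    · exact h q1
  have os : tri F o o s = 0 := by rw [oo, hG.2.1, hG.tts]; ring
  have ot : tri F o o t = 0 := by rw [oo, hG.2.2, hG.sst]; ring
  have ooa : tri F o o a = 0 := by rw [oo, h1, h2]; ring
  have oas : tri F o a s = 0 := by rw [oa, perm6 h1 |>.2.1, gam6 hG |>.2.2.2.1]; ring
  have oat : tri F o a t = 0 := by rw [oa, perm6 h2 |>.2.1, gam6 hG |>.2.2.1]; ring
  have oaa : tri F o a a = 0 := by rw [oa]; ring
  have ooo : tri F o o o = 0 := by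
    nth_rewrite 3 [ho]
    rw [tri_sub3, tri_smul3, tri_smul3, os, ot]; ring
  obtain ⟨μ, hμp, hμq⟩ : ∃ μ, tri F o a p = μ * tri F o o p ∧ tri F o a q = μ * tri F o o q := by
    by_cases hp : tri F o o p = 0
    · have hq : tri F o o q ≠ 0 := by
        intro hq
        refine ho0 (hS o fun x => ?_)
        obtain ⟨x1, x2, x3, x4, x5, rfl⟩ := coords5 hpq x
        simp only [tri_add3, tri_smul3, os, ot, ooa, hp, hq, mul_zero, add_zero]
      refine ⟨tri F o a q / tri F o o q, ?_, ?_⟩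
      · rw [hp, mul_zero]
        rw [hp, mul_zero] at hcr
        exact (mul_eq_zero.1 hcr).resolve_right hq
      · field_simp
    · refine ⟨tri F o a p / tri F o o p, ?_, ?_⟩
      · field_simp
      · field_simp
        linear_combination -hcr
  have hμ : ∀ x, tri F o a x = μ * tri F o o x := by
    intro x
    obtain ⟨x1, x2, x3, x4, x5, rfl⟩ := coords5 hpq x
    simp only [tri_add3, tri_smul3, os, ot, ooa, oas, oat, oaa, hμp, hμq, mul_zero, add_zero, zero_add]
    ring
  have hG' : Gam F o (a - μ • o) := by
    refine ⟨fun x => ?_, ooo, ?_⟩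
    · rw [tri_sub2, tri_smul2, hμ]; ring
    · simp only [tri_sub1, tri_sub2, tri_sub3, tri_smul1, tri_smul2, tri_smul3, ooo, perm6 ooa, perm6 oaa, h3, mul_zero, sub_zero]
  have hsp : Submodule.span ℂ {o, a - μ • o} = Submodule.span ℂ {o, a} :=
    span_pair_eq (x := 1) (y := 0) (x' := -μ) (y' := 1) (by module) (by module) (by simp)
  have ha' : a - μ • o ≠ 0 := by
    intro h0
    obtain ⟨-, -, q3⟩ := hli' (-μ * tri F t a a) (μ * tri F s a a) 1 (by rw [← h0, ho]; module)
    exact one_ne_zero q3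
  obtain ⟨a2, hli2, k1, k2, k3, kne⟩ := exists_tri hS n3 ho0 ha' hG'
  rw [← ho] at hD
  exact ⟨_, _, hD, hsp ▸ dd_of_tri hG' hli2 k1 k2 k3 kne⟩

end CT

namespace CT
open Filter Topology

/-- the good cubics -/
structure Good (F : Cub) : Prop where
  q : GoodQ F 1 (fun _ _ => 0)
  t : ¬ Triple F
  a : ¬ Bad4a F
  b : ¬ Bad4b F

def SS (F : Cub) : Set (Submodule ℂ E5) := {l | ∃ r r', DD F r l ∧ DD F l r'}

def Rel (F : Cub) (z : (Fin 5 → Fin 5 → ℂ) × (Fin 5 → Fin 5 → ℂ)) (l : Submodule ℂ E5) : Prop :=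
  ∃ s t, s ≠ 0 ∧ t ≠ 0 ∧ Zer F s t 1 (fun _ _ => 0) ∧ z = (prj s, prj t) ∧ DD F (Submodule.span ℂ {s, t}) l

theorem rel_ex {F : Cub} (hF : Good F) {z} (hz : z ∈ Zset F 1 (fun _ _ => 0)) : ∃ l ∈ SS F, Rel F z l := by
  obtain ⟨s, t, hs, ht, hZ, rfl⟩ := hz
  obtain ⟨l, r, h1, h2⟩ := zer_dd hF.q.smooth hF.t hs ht hZ
  exact ⟨l, ⟨_, _, h1, h2⟩, s, t, hs, ht, hZ, rfl, h1⟩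

theorem rel_uniq {F : Cub} (hF : Good F) {z} {l l' : Submodule ℂ E5} (h : Rel F z l) (h' : Rel F z l') : l = l' := by
  obtain ⟨s, t, hs, ht, hZ, rfl, h1⟩ := h
  obtain ⟨s', t', hs', ht', hZ', e, h1'⟩ := h'
  rw [Prod.mk.injEq] at e
  obtain ⟨x, hx, rfl⟩ := prj_eq hs hs' e.1
  obtain ⟨y, hy, rfl⟩ := prj_eq ht ht' e.2
  have : Submodule.span ℂ {x • s, y • t} = Submodule.span ℂ {s, t} :=
    span_pair_eq (x := x) (y := 0) (x' := 0) (y' := y) (by simp) (by simp) (by simp [hx, hy])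
  rw [this] at h1'
  exact h1.unique hF.q.smooth h1'

theorem rel_two {F : Cub} (hF : Good F) {l : Submodule ℂ E5} (hl : l ∈ SS F) :
    ∃ z1 z2, z1 ≠ z2 ∧ ∀ z, Rel F z l ↔ z = z1 ∨ z = z2 := by
  obtain ⟨r, r', h1, h2⟩ := hl
  have hS := hF.q.smooth
  obtain ⟨o1, a1, b1, hp, rfl, -⟩ := id h2
  obtain ⟨o, a, ho, ha, hG, hoa⟩ := hp.gam hS
  obtain ⟨o2, a2, b2, hp2, hr2, -⟩ := id h1
  obtain ⟨s, t, hs, ht, hst, hsp⟩ := hp2.gam hS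
  rw [← hsp] at hr2
  subst hr2
  have hZ : Zer F s t 1 (fun _ _ => 0) := by
    rcases h1.res hG hoa.symm with h | h
    · exact zer_of_res hS hG h hs ht hst rfl
    · exact zer_of_res hS hG.symm h hs ht hst rfl
  have hli := hst.li hS hs ht
  have hli' := LinearIndependent.pair_iff.1 hli
  refine ⟨(prj s, prj t), (prj t, prj s), ?_, fun z => ⟨?_, ?_⟩⟩
  · intro h
    rw [Prod.mk.injEq] at h
    obtain ⟨c, hc, e⟩ := prj_eq hs ht h.1
    exact one_ne_zero (hli' (-c) 1 (by rw [e]; module)).2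
  · rintro ⟨s', t', hs', ht', hZ', rfl, hD⟩
    have hsp' := hD.inj hG hF.a hF.b hoa.symm h1
    obtain ⟨x, y, x', y', e1, e2⟩ := span_coords hsp'
    have key : ∀ v, (x * x') * tri F s s v + (y * y') * tri F t t v = 0 := by
      intro v
      have := hZ'.1.1 v
      rw [e1, e2] at this
      simp only [tri_add1, tri_add2, tri_smul1, tri_smul2, gam6 hst] at this
      linear_combination this
    obtain ⟨k1, k2⟩ := hst.indep hS hs ht key
    rcases mul_eq_zero.1 k1 with hx | hx
    · right
      have hy : y ≠ 0 := by rintro rfl; exact hs' (by rw [e1, hx]; simp)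
      have hy' := (mul_eq_zero.1 k2).resolve_left hy
      have hx' : x' ≠ 0 := by rintro rfl; exact ht' (by rw [e2, hy']; simp)
      rw [e1, e2, hx, hy', zero_smul, zero_smul, zero_add, add_zero, prj_smul hy, prj_smul hx']
    · left
      have hy : y' ≠ 0 := by rintro rfl; exact ht' (by rw [e2, hx]; simp)
      have hy' := (mul_eq_zero.1 k2).resolve_right hy
      have hx' : x ≠ 0 := by rintro rfl; exact hs' (by rw [e1, hy']; simp)
      rw [e1, e2, hx, hy', zero_smul, zero_smul, zero_add, add_zero, prj_smul hy, prj_smul hx']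
  · rintro (rfl | rfl)
    · exact ⟨s, t, hs, ht, hZ, rfl, h1⟩
    · exact ⟨t, s, ht, hs, hZ.swap, rfl, by rw [Set.pair_comm]; exact h1⟩

theorem ss_720 {F : Cub} (hF : Good F) : (SS F).Finite ∧ (SS F).ncard = 720 := by
  classical
  obtain ⟨hfin, hcard⟩ := zset_1440 hF.q
  have hex : ∀ z : Zset F 1 (fun _ _ => 0), ∃ l, l ∈ SS F ∧ Rel F z.1 l := fun z => rel_ex hF z.2
  choose f hf1 hf2 using hex
  have hmem : ∀ {z l}, Rel F z l → z ∈ Zset F 1 (fun _ _ => 0) := by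
    rintro z l ⟨s, t, hs, ht, hZ, rfl, -⟩
    exact ⟨s, t, hs, ht, hZ, rfl⟩
  have hff : ∀ z l, f z = l ↔ Rel F z.1 l := by
    intro z l
    constructor
    · rintro rfl; exact hf2 z
    · intro h; exact rel_uniq hF (hf2 z) h
  haveI := hfin.fintype
  have hSS : SS F = ↑(Finset.univ.image f) := by
    ext l
    simp only [Finset.coe_image, Finset.coe_univ, Set.image_univ, Set.mem_range]
    constructor
    · intro hl
      obtain ⟨z1, z2, -, h⟩ := rel_two hF hl
      have h1 := (h z1).2 (Or.inl rfl)
      exact ⟨⟨z1, hmem h1⟩, (hff _ _).2 h1⟩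
    · rintro ⟨z, rfl⟩; exact hf1 z
  refine ⟨hSS ▸ Finset.finite_toSet _, ?_⟩
  have hc := Finset.card_eq_sum_card_fiberwise (f := f) (s := Finset.univ) (t := Finset.univ.image f)
    (fun z _ => Finset.mem_coe.2 (Finset.mem_image_of_mem f (Finset.mem_univ z)))
  have h2 : ∀ l ∈ Finset.univ.image f, (Finset.univ.filter fun z => f z = l).card = 2 := by
    intro l hl
    have hl' : l ∈ SS F := by rw [hSS]; exact hl
    obtain ⟨z1, z2, hne, h⟩ := rel_two hF hl'
    rw [Finset.card_eq_two]
    have h1 := (h z1).2 (Or.inl rfl)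
    have h3 := (h z2).2 (Or.inr rfl)
    refine ⟨⟨z1, hmem h1⟩, ⟨z2, hmem h3⟩, fun e => hne (congrArg Subtype.val e), ?_⟩
    ext z
    simp only [Finset.mem_filter, Finset.mem_univ, true_and, hff, h, Finset.mem_insert, Finset.mem_singleton, Subtype.ext_iff]
  rw [Finset.sum_congr rfl h2, Finset.sum_const, Finset.card_univ, smul_eq_mul] at hc
  have h14 : Fintype.card (Zset F 1 (fun _ _ => 0)) = 1440 := by
    rw [← hcard, ← Nat.card_coe_set_eq, Nat.card_eq_fintype_card]
  rw [h14] at hc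
  rw [hSS, Set.ncard_coe_finset]
  omega

/-! ### translation of the cycle conditions -/

theorem dd_of_cycle {G : MvPolynomial (Fin 5) ℂ} {F : Cub} (hG : ∀ p, eval p G = tri F p p p) {l r Pl : Submodule ℂ E5}
    (h : CycleLplus2R G l r Pl) : DD F r l := by
  obtain ⟨hl, hr, hP, hlP, hrP, hne, c, L, R, hc, -, -, hL, hR, hf⟩ := h
  unfold IsLine at hl hr
  unfold IsPlane at hP
  have hsum := Submodule.finrank_sup_add_finrank_inf_eq l r
  have hsup : Module.finrank ℂ (l ⊔ r : Submodule ℂ E5) ≤ 3 := by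
    rw [← hP]; exact Submodule.finrank_mono (sup_le hlP hrP)
  have hinf : (l ⊓ r : Submodule ℂ E5) ≠ ⊥ := by
    intro h0
    rw [h0, finrank_bot, hl, hr] at hsum
    omega
  obtain ⟨o, ho, ho0⟩ := Submodule.exists_mem_ne_zero_of_ne_bot hinf
  obtain ⟨hol, hor⟩ := Submodule.mem_inf.1 ho
  obtain ⟨a, har, hal⟩ : ∃ a ∈ r, a ∉ l := by
    by_contra hcon
    push Not at hcon
    exact hne (Submodule.eq_of_le_of_finrank_eq hcon (by rw [hl, hr]))
  obtain ⟨b, hbl, hbr⟩ : ∃ b ∈ l, b ∉ r := by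
    by_contra hcon
    push Not at hcon
    exact hne (Submodule.eq_of_le_of_finrank_eq hcon (by rw [hl, hr])).symm
  have inL : ∀ {v}, v ∈ l → L v = 0 := fun {v} hv => by
    rw [← hL] at hv; exact (Submodule.mem_inf.1 hv).2
  have inR : ∀ {v}, v ∈ r → R v = 0 := fun {v} hv => by
    rw [← hR] at hv; exact (Submodule.mem_inf.1 hv).2
  have hLa : L a ≠ 0 := fun h => hal (by rw [← hL]; exact Submodule.mem_inf.2 ⟨hrP har, h⟩)
  have hRb : R b ≠ 0 := fun h => hbr (by rw [← hR]; exact Submodule.mem_inf.2 ⟨hlP hbl, h⟩)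
  have hli : LinearIndependent ℂ ![o, a, b] := by
    rw [li3]
    intro x y z hz
    have e1 := congrArg L hz
    have e2 := congrArg R hz
    simp only [map_add, map_smul, smul_eq_mul, inL hol, inL hbl, inR hor, inR har, map_zero, mul_zero, add_zero, zero_add] at e1 e2
    have hy := (mul_eq_zero.1 e1).resolve_right hLa
    have hz' := (mul_eq_zero.1 e2).resolve_right hRb
    rw [hy, hz'] at hz
    simp [ho0] at hz
    exact ⟨hz, hy, hz'⟩
  have key : ∀ x y z : ℂ, tri F (x • o + y • a + z • b) (x • o + y • a + z • b) (x • o + y • a + z • b) =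
      c * (y * L a) * (z * R b) ^ 2 := by
    intro x y z
    rw [← hG, hf _ (Pl.add_mem (Pl.add_mem (Pl.smul_mem _ (hlP hol)) (Pl.smul_mem _ (hrP har))) (Pl.smul_mem _ (hlP hbl)))]
    simp only [map_add, map_smul, smul_eq_mul, inL hol, inL hbl, inR hor, inR har, mul_zero, add_zero, zero_add]
  have ex : ∀ x y z : ℂ, x ^ 3 * tri F o o o + y ^ 3 * tri F a a a + z ^ 3 * tri F b b b + 3 * x ^ 2 * y * tri F o o a +
      3 * x * y ^ 2 * tri F o a a + 3 * x ^ 2 * z * tri F o o b + 3 * x * z ^ 2 * tri F o b b + 3 * y ^ 2 * z * tri F a a b +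
      3 * y * z ^ 2 * tri F a b b + 6 * x * y * z * tri F o a b = c * L a * R b ^ 2 * (y * z ^ 2) := by
    intro x y z
    have := key x y z
    simp only [tri_add1, tri_add2, tri_add3, tri_smul1, tri_smul2, tri_smul3] at this
    rw [tri_comm12 F a o o, tri_comm12 F a o a, tri_comm13 F a a o,
      tri_comm12 F b o o, tri_comm12 F b o b, tri_comm13 F b b o,
      tri_comm12 F b a a, tri_comm12 F b a b, tri_comm13 F b b a,
      tri_comm23 F o b a, tri_comm12 F a o b, tri_comm23 F a b o, tri_comm12 F a o b, tri_comm12 F b o a, tri_comm23 F o b a,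
      tri_comm13 F b a o] at this
    rw [tri_comm23 F o a o, tri_comm23 F o b o, tri_comm23 F a b a] at this
    linear_combination this
  refine ⟨o, a, b, ⟨hli, ⟨?_, ?_, ?_, ?_⟩, ⟨?_, ?_, ?_, ?_, ?_⟩, ?_⟩, ?_, ?_⟩
  · linear_combination ex 1 0 0
  · linear_combination (ex 1 1 0 - ex 1 (-1) 0 - 2 * ex 0 1 0) / 6
  · linear_combination (ex 1 1 0 + ex 1 (-1) 0 - 2 * ex 1 0 0) / 6
  · linear_combination ex 0 1 0
  · linear_combination (ex 1 0 1 - ex 1 0 (-1) - 2 * ex 0 0 1) / 6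
  · linear_combination (ex 1 1 1 - ex 1 1 0 - ex 1 0 1 - ex 0 1 1 + ex 1 0 0 + ex 0 1 0 + ex 0 0 1) / 6
  · linear_combination (ex 0 1 1 - ex 0 1 (-1) - 2 * ex 0 0 1) / 6
  · linear_combination (ex 1 0 1 + ex 1 0 (-1) - 2 * ex 1 0 0) / 6
  · linear_combination ex 0 0 1
  · intro h0
    have : c * L a * R b ^ 2 = 0 := by
      linear_combination 3 * h0 - (ex 0 1 1 + ex 0 1 (-1) - 2 * ex 0 1 0) / 2
    simp [hc, hLa, hRb] at this
  · symm
    refine Submodule.eq_of_le_of_finrank_eq ?_ ?_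
    · rw [Submodule.span_le]; rintro v (rfl | rfl)
      · exact hor
      · exact har
    · rw [finrank_pair (li_of_li3 hli).1, hr]
  · symm
    refine Submodule.eq_of_le_of_finrank_eq ?_ ?_
    · rw [Submodule.span_le]; rintro v (rfl | rfl)
      · exact hol
      · exact hbl
    · rw [finrank_pair (li_of_li3 hli).2, hl]

theorem finrank_triple {o a b : E5} (h : LinearIndependent ℂ ![o, a, b]) : Module.finrank ℂ (Submodule.span ℂ {o, a, b}) = 3 := by
  have := finrank_span_eq_card h
  rwa [Matrix.range_cons, Matrix.range_cons, Matrix.range_cons, Matrix.range_empty, Set.union_empty, Set.singleton_union, Set.singleton_union] at this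

theorem cycle_of_dd {G : MvPolynomial (Fin 5) ℂ} {F : Cub} (hG : ∀ p, eval p G = tri F p p p) {l r : Submodule ℂ E5}
    (h : DD F r l) : (∃ Pl, CycleLplus2R G l r Pl) ∧ LiesOn G l ∧ LiesOn G r ∧ IsLine l := by
  obtain ⟨o, a, b, ⟨hl, ⟨h1, h2, h3, h4⟩, ⟨h5, h6, h7, h8, h9⟩, h10⟩, rfl, rfl⟩ := h
  have hli := li3.1 hl
  have ex : ∀ x y z : ℂ, eval (x • o + y • a + z • b) G = 3 * tri F a b b * y * z ^ 2 := by
    intro x y z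
    rw [hG]
    simp only [tri_add1, tri_add2, tri_add3, tri_smul1, tri_smul2, tri_smul3, h1, h4, h9, perm6 h2, perm6 h3, perm6 h5, perm6 h6, perm6 h7,
      perm6 h8, mul_zero, zero_add, add_zero, tri_comm12 F b a, tri_comm13 F b b a]
    ring
  refine ⟨⟨Submodule.span ℂ {o, a, b}, finrank_pair (li_of_li3 hl).2, finrank_pair (li_of_li3 hl).1, finrank_triple hl, ?_, ?_, ?_, ?_⟩, ?_, ?_,
    finrank_pair (li_of_li3 hl).2⟩
  · rw [Submodule.span_le]
    rintro v (rfl | rfl)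
    · exact Submodule.subset_span (Or.inl rfl)
    · exact Submodule.subset_span (Or.inr (Or.inr rfl))
  · rw [Submodule.span_le]
    rintro v (rfl | rfl)
    · exact Submodule.subset_span (Or.inl rfl)
    · exact Submodule.subset_span (Or.inr (Or.inl rfl))
  · intro e
    have : a ∈ Submodule.span ℂ {o, b} := e ▸ Submodule.subset_span (by simp)
    obtain ⟨x, z, hz⟩ := Submodule.mem_span_pair.1 this
    have := hli x (-1) z (by rw [← hz]; module)
    simp at this
  · obtain ⟨p, q, hpq⟩ := extend3 hl
    let B := basisOfLinearIndependentOfCardEqFinrank hpq (by simp)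
    have hB : ∀ i, B i = ![o, a, b, p, q] i := fun i => by simp [B]
    have B0 : B 0 = o := hB 0
    have B1 : B 1 = a := hB 1
    have B2 : B 2 = b := hB 2
    have c1 : ∀ x y z : ℂ, B.coord 1 (x • o + y • a + z • b) = y := by
      intro x y z
      rw [← B0, ← B1, ← B2]
      simp [Module.Basis.coord_apply]
    have c2 : ∀ x y z : ℂ, B.coord 2 (x • o + y • a + z • b) = z := by
      intro x y z
      rw [← B0, ← B1, ← B2]
      simp [Module.Basis.coord_apply]
    have mem : ∀ x y z : ℂ, x • o + y • a + z • b ∈ Submodule.span ℂ {o, a, b} := fun x y z =>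
      Submodule.mem_span_triple.2 ⟨x, y, z, rfl⟩
    refine ⟨3 * tri F a b b, B.coord 1, B.coord 2, by simpa using h10, ⟨a, ?_, ?_⟩, ⟨b, ?_, ?_⟩, ?_, ?_, ?_⟩
    · exact Submodule.subset_span (by simp)
    · have := c1 0 1 0
      simp only [zero_smul, one_smul, zero_add, add_zero] at this
      rw [this]; exact one_ne_zero
    · exact Submodule.subset_span (by simp)
    · have := c2 0 0 1
      simp only [zero_smul, one_smul, zero_add, add_zero] at this
      rw [this]; exact one_ne_zero
    · ext v
      rw [Submodule.mem_inf, LinearMap.mem_ker, Submodule.mem_span_triple, Submodule.mem_span_pair]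
      constructor
      · rintro ⟨⟨x, y, z, rfl⟩, hv⟩
        rw [c1] at hv
        exact ⟨x, z, by rw [hv]; simp⟩
      · rintro ⟨x, z, rfl⟩
        have e : x • o + z • b = x • o + (0:ℂ) • a + z • b := by simp
        exact ⟨⟨x, 0, z, e.symm⟩, by rw [e, c1]⟩
    · ext v
      rw [Submodule.mem_inf, LinearMap.mem_ker, Submodule.mem_span_triple, Submodule.mem_span_pair]
      constructor
      · rintro ⟨⟨x, y, z, rfl⟩, hv⟩
        rw [c2] at hv
        exact ⟨x, y, by rw [hv]; simp⟩
      · rintro ⟨x, y, rfl⟩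
        have e : x • o + y • a = x • o + y • a + (0:ℂ) • b := by simp
        exact ⟨⟨x, y, 0, e.symm⟩, by rw [e, c2]⟩
    · intro v hv
      obtain ⟨x, y, z, rfl⟩ := Submodule.mem_span_triple.1 hv
      rw [ex, c1, c2]
  · intro v hv
    obtain ⟨x, z, rfl⟩ := Submodule.mem_span_pair.1 hv
    have := ex x 0 z
    simpa using this
  · intro v hv
    obtain ⟨x, y, rfl⟩ := Submodule.mem_span_pair.1 hv
    have := ex x y 0
    simpa using this

theorem cycle_flip {G : MvPolynomial (Fin 5) ℂ} {l r Pl : Submodule ℂ E5} : Cycle2LplusR G l r Pl ↔ CycleLplus2R G r l Pl := by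
  constructor
  · rintro ⟨hl, hr, hP, hlP, hrP, hne, c, L, R, hc, h1, h2, hL, hR, hf⟩
    exact ⟨hr, hl, hP, hrP, hlP, hne.symm, c, R, L, hc, h2, h1, hR, hL, fun p hp => by rw [hf p hp]; ring⟩
  · rintro ⟨hl, hr, hP, hlP, hrP, hne, c, L, R, hc, h1, h2, hL, hR, hf⟩
    exact ⟨hr, hl, hP, hrP, hlP, hne.symm, c, R, L, hc, h2, h1, hR, hL, fun p hp => by rw [hf p hp]; ring⟩

theorem set_eq {G : MvPolynomial (Fin 5) ℂ} {F : Cub} (hG : ∀ p, eval p G = tri F p p p) :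
    {l : Submodule ℂ (Fin 5 → ℂ) | IsLine l ∧ LiesOn G l ∧
          ∃ Pl₁ Pl₂ r₁ r₂ : Submodule ℂ (Fin 5 → ℂ),
            LiesOn G r₁ ∧ LiesOn G r₂ ∧
            CycleLplus2R G l r₁ Pl₁ ∧ Cycle2LplusR G l r₂ Pl₂} = SS F := by
  ext l
  constructor
  · rintro ⟨-, -, P1, P2, r1, r2, -, -, h1, h2⟩
    exact ⟨r1, r2, dd_of_cycle hG h1, dd_of_cycle hG (cycle_flip.1 h2)⟩
  · rintro ⟨r1, r2, h1, h2⟩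
    obtain ⟨⟨P1, k1⟩, a1, a2, a3⟩ := cycle_of_dd hG h1
    obtain ⟨⟨P2, k2⟩, b1, b2, b3⟩ := cycle_of_dd hG h2
    exact ⟨a3, a1, P1, P2, r1, r2, a2, b1, k1, cycle_flip.2 k2⟩

/-! ### coefficients and polarisation -/

def toD (s : Sym (Fin 5) 3) : Deg3Monomials := ⟨Multiset.toFinsupp (s : Multiset (Fin 5)), by
  have := Multiset.toFinsupp_sum_eq (s : Multiset (Fin 5))
  exact this.trans s.2⟩

theorem toD_inj : Function.Injective toD := by
  intro s s' h
  have := congrArg Subtype.val h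
  exact Subtype.ext (Multiset.toFinsupp.injective this)

/-- number of orderings -/
def Nn (s : Sym (Fin 5) 3) : ℂ := ((Finset.univ.filter fun q : Fin 5 × Fin 5 × Fin 5 => mk3 q.1 q.2.1 q.2.2 = s).card : ℂ)

theorem Nn_ne (s : Sym (Fin 5) 3) : Nn s ≠ 0 := by
  obtain ⟨⟨i, j, k⟩, h⟩ := mk3_surj s
  unfold Nn
  rw [Nat.cast_ne_zero, Finset.card_ne_zero]
  exact ⟨(i, j, k), Finset.mem_filter.2 ⟨Finset.mem_univ _, h⟩⟩

def cf (G : MvPolynomial (Fin 5) ℂ) : Cub := fun s => (Nn s)⁻¹ * G.coeff (toD s).1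

def mval (p : E5) (s : Sym (Fin 5) 3) : ℂ := ((s : Multiset (Fin 5)).map p).prod

theorem mval_mk3 (p : E5) (i j k : Fin 5) : mval p (mk3 i j k) = p i * p j * p k := by
  change (Multiset.map p (i ::ₘ j ::ₘ k ::ₘ 0)).prod = _
  simp [mul_assoc]

theorem tri_diag (F : Cub) (p : E5) : tri F p p p = ∑ s, Nn s * F s * mval p s := by
  have e : tri F p p p = ∑ q : Fin 5 × Fin 5 × Fin 5, F (mk3 q.1 q.2.1 q.2.2) * mval p (mk3 q.1 q.2.1 q.2.2) := by
    simp only [Fintype.sum_prod_type, mval_mk3, tri]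
    refine Finset.sum_congr rfl fun i _ => Finset.sum_congr rfl fun j _ => Finset.sum_congr rfl fun k _ => by ring
  rw [e, ← Finset.sum_fiberwise Finset.univ (fun q : Fin 5 × Fin 5 × Fin 5 => mk3 q.1 q.2.1 q.2.2)]
  refine Finset.sum_congr rfl fun s _ => ?_
  have : ∀ q ∈ Finset.univ.filter (fun q : Fin 5 × Fin 5 × Fin 5 => mk3 q.1 q.2.1 q.2.2 = s),
      F (mk3 q.1 q.2.1 q.2.2) * mval p (mk3 q.1 q.2.1 q.2.2) = F s * mval p s := by
    intro q hq
    rw [(Finset.mem_filter.1 hq).2]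
  rw [Finset.sum_congr rfl this, Finset.sum_const, nsmul_eq_mul, Nn]
  ring

theorem eval_cf {G : MvPolynomial (Fin 5) ℂ} (hG : G.IsHomogeneous 3) (p : E5) : eval p G = tri (cf G) p p p := by
  classical
  rw [tri_diag, eval_eq']
  have hval : ∀ s : Sym (Fin 5) 3, ∏ i, p i ^ (toD s).1 i = mval p s := by
    intro s
    simp only [toD, Multiset.toFinsupp_apply, mval]
    exact (Finset.prod_multiset_map_count (s : Multiset (Fin 5)) p).trans (Finset.prod_subset (Finset.subset_univ _) (by
      intro x _ hx
      rw [Multiset.mem_toFinset] at hx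
      rw [Multiset.count_eq_zero_of_notMem hx, pow_zero])) |>.symm
  have hsub : G.support ⊆ Finset.univ.image (fun s => (toD s).1) := by
    intro d hd
    have hdeg := hG (mem_support_iff.1 hd)
    have h3 : (Finsupp.toMultiset d).card = 3 := by
      rw [Finsupp.card_toMultiset]
      have h4 : (d.sum fun _ c => c) = 3 := by simpa [Finsupp.weight_apply, Finsupp.degree] using hdeg
      exact h4
    refine Finset.mem_image.2 ⟨⟨Finsupp.toMultiset d, h3⟩, Finset.mem_univ _, ?_⟩
    simp [toD]
  rw [Finset.sum_subset hsub (by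
    intro d _ hd
    rw [notMem_support_iff.1 hd, zero_mul])]
  rw [Finset.sum_image (by
    intro s _ s' _ h
    exact toD_inj (Subtype.ext h))]
  refine Finset.sum_congr rfl fun s _ => ?_
  rw [hval, cf, mul_inv_cancel_left₀ (Nn_ne s)]

theorem smooth_of {G : MvPolynomial (Fin 5) ℂ} {F : Cub} (hG : ∀ p, eval p G = tri F p p p) (hS : Smooth3 F) : IsSmoothCubic G := by
  have e : G = ∑ i, ∑ j, ∑ k, C (F (mk3 i j k)) * X i * X j * X k := by
    refine MvPolynomial.funext fun p => ?_
    rw [hG]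
    simp [tri]
  intro p hp
  refine hS p fun x => ?_
  have hb : ∀ l, tri F p p (bv l) = 0 := by
    intro l
    have h := hp l
    have : eval p (pderiv l G) = tri F (bv l) p p + tri F p (bv l) p + tri F p p (bv l) := by
      rw [e]
      simp only [map_sum, pderiv_mul, pderiv_C, pderiv_X, tri, ← Finset.sum_add_distrib]
      refine Finset.sum_congr rfl fun i _ => Finset.sum_congr rfl fun j _ => Finset.sum_congr rfl fun k _ => ?_
      have hs : ∀ m : Fin 5, eval p (Pi.single (M := fun _ => MvPolynomial (Fin 5) ℂ) l 1 m) = bv l m := by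
        intro m
        by_cases hm : m = l
        · subst hm; simp [bv]
        · simp [bv, hm]
      simp only [map_add, map_mul, hs, eval_C, eval_X, map_zero]
      ring
    rw [this, tri_comm13 F (bv l) p p, tri_comm23 F p (bv l) p] at h
    linear_combination h / 3
  rw [vec_eq_sum x, tri_sum3]
  refine Finset.sum_eq_zero fun i _ => ?_
  rw [tri_smul3, hb, mul_zero]

theorem transfer {Q : Cub → Prop} (h : Thin Q) : ∃ P : MvPolynomial Deg3Monomials ℂ, P ≠ 0 ∧
    ∀ G : MvPolynomial (Fin 5) ℂ, eval (fun d : Deg3Monomials => G.coeff d.1) P ≠ 0 → ¬ Q (cf G) := by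
  obtain ⟨P, hP, hP2⟩ := h
  have key : ∀ g : Deg3Monomials → ℂ, eval g (aeval (fun s => (C (Nn s)⁻¹ * X (toD s) : MvPolynomial Deg3Monomials ℂ)) P) =
      eval (fun s => (Nn s)⁻¹ * g (toD s)) P := by
    intro g
    have h1 := MvPolynomial.comp_aeval_apply (fun s => (C (Nn s)⁻¹ * X (toD s) : MvPolynomial Deg3Monomials ℂ)) (aeval g : MvPolynomial Deg3Monomials ℂ →ₐ[ℂ] ℂ) P
    rw [← coe_aeval_eq_eval, ← coe_aeval_eq_eval]
    change aeval g _ = aeval _ P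
    rw [h1]
    simp
  refine ⟨aeval (fun s => C (Nn s)⁻¹ * X (toD s)) P, ?_, ?_⟩
  · intro h0
    apply hP
    refine MvPolynomial.funext fun x => ?_
    have := key (Function.extend toD (fun s => Nn s * x s) 0)
    rw [h0, map_zero] at this
    simp only [toD_inj.extend_apply, inv_mul_cancel_left₀ (Nn_ne _)] at this
    rw [map_zero]
    exact this.symm
  · intro G hG hQ
    rw [key] at hG
    exact hG (hP2 _ hQ)

theorem thin_good : Thin fun F => ¬ Good F := by
  refine (((thin_notgood.or thin_triple).or thin_bad4a).or thin_bad4b).mono fun F hF => ?_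
  by_contra hcon
  rw [not_or, not_or, not_or] at hcon
  exact hF ⟨not_not.1 hcon.1.1.1, hcon.1.1.2, hcon.1.2, hcon.2⟩

end CT

/-- A general smooth cubic threefold `V ⊂ ℙ⁴` contains exactly `720` lines `l` for
which there exist 2-planes `π₁, π₂` and lines `r₁, r₂` on `V` with
`V·π₁ = l + 2r₁` and `V·π₂ = 2l + r₂` (the intersection points of `Γ` and `Γ'`). -/
theorem general_cubic_has_720_intersections :
    ∃ P : MvPolynomial Deg3Monomials ℂ, P ≠ 0 ∧
      ∀ F : MvPolynomial (Fin 5) ℂ, F.IsHomogeneous 3 →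
        eval (fun d : Deg3Monomials => F.coeff d.1) P ≠ 0 →
        IsSmoothCubic F ∧
        {l : Submodule ℂ (Fin 5 → ℂ) | IsLine l ∧ LiesOn F l ∧
          ∃ Pl₁ Pl₂ r₁ r₂ : Submodule ℂ (Fin 5 → ℂ),
            LiesOn F r₁ ∧ LiesOn F r₂ ∧
            CycleLplus2R F l r₁ Pl₁ ∧ Cycle2LplusR F l r₂ Pl₂}.Finite ∧
        {l : Submodule ℂ (Fin 5 → ℂ) | IsLine l ∧ LiesOn F l ∧
          ∃ Pl₁ Pl₂ r₁ r₂ : Submodule ℂ (Fin 5 → ℂ),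
            LiesOn F r₁ ∧ LiesOn F r₂ ∧
            CycleLplus2R F l r₁ Pl₁ ∧ Cycle2LplusR F l r₂ Pl₂}.ncard = 720 := by
  obtain ⟨P, hP, hP2⟩ := CT.transfer CT.thin_good
  refine ⟨P, hP, fun F hF hne => ?_⟩
  have hgood := not_not.1 (hP2 F hne)
  have hev := CT.eval_cf hF
  rw [CT.set_eq hev]
  exact ⟨CT.smooth_of hev hgood.q.smooth, CT.ss_720 hgood⟩

end
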